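/- arXiv:1610.03027 — 4 statements merged into one kernel-verified Lean document; each statement's English description precedes it below -/
import Mathlib

section
/- For each integer r ≥ 2, there exists a constant C = C(r) > 0 such that the following holds. Let n, k be positive integers with n ≥ 2k + C·k^{2/3}, and let F ⊆ {S ⊆ {1,...,n} : |S| = k} be a union of at most r intersecting families. Then |F| ≤ C(n,k) − C(n−r,k), where C(a,b) denotes the binomial coefficient 'a choose b'. -/
open Finset

/-- A family of finite sets is intersecting if any two of its members have
nonempty intersection. -/
def Intersecting' {n : ℕ} (F : Finset (Finset (Fin n))) : Prop :=
  ∀ A ∈ F, ∀ B ∈ F, (A ∩ B).Nonempty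

section Density

variable {α : Type*}

open Classical in
/-- The proportion of subsets of `s` satisfying `D`. -/
noncomputable def density (s : Finset α) (D : Finset α → Prop) : ℝ :=
  (∑ S ∈ s.powerset, if D S then 1 else 0) / 2 ^ #s

theorem density_nonneg (s : Finset α) (D : Finset α → Prop) : 0 ≤ density s D := by
  unfold density
  positivity

theorem density_mono {s : Finset α} {D E : Finset α → Prop} (h : ∀ S ⊆ s, D S → E S) :
    density s D ≤ density s E := by
  unfold density
  gcongr with S hS
  have := h S (mem_powerset.1 hS)
  split_ifs <;> simp_all

theorem density_add_density_not (s : Finset α) (D : Finset α → Prop) :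
    density s D + (density s fun S => ¬ D S) = 1 := by
  unfold density
  rw [← add_div, ← sum_add_distrib, div_eq_one_iff_eq (by positivity)]
  rw [sum_congr rfl (g := fun _ => (1 : ℝ))]
  · simp
  · intro S _
    by_cases h : D S <;> simp [h]

theorem density_le_one (s : Finset α) (D : Finset α → Prop) : density s D ≤ 1 := by
  linarith [density_add_density_not s D, density_nonneg s fun S => ¬ D S]

open Classical in
theorem density_empty (D : Finset α → Prop) : density ∅ D = if D ∅ then 1 else 0 := by
  unfold density
  rw [powerset_empty, sum_singleton]
  simp

open Classical in
theorem density_mul_two_pow (s : Finset α) (D : Finset α → Prop) :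
    density s D * 2 ^ #s = #{S ∈ s.powerset | D S} := by
  rw [density, div_mul_cancel₀ _ (by positivity), card_filter]
  push_cast
  rfl

variable [DecidableEq α]

/-- The total influence of `D` on the cube of subsets of `s`, for a decreasing predicate `D`. -/
noncomputable def totalInfluence (s : Finset α) (D : Finset α → Prop) : ℝ :=
  ∑ i ∈ s, (density (s.erase i) D - density (s.erase i) fun S => D (insert i S))

/-- The amount by which `D` fails to be extremal in the edge-isoperimetric inequality. -/
noncomputable def isoDeficiency (s : Finset α) (D : Finset α → Prop) : ℝ :=
  Real.log 2 * totalInfluence s D - 2 * Real.negMulLog (density s D)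

theorem density_insert {s : Finset α} {i : α} (hi : i ∉ s) (D : Finset α → Prop) :
    density (insert i s) D = (density s D + density s fun S => D (insert i S)) / 2 := by
  unfold density
  rw [sum_powerset_insert hi, card_insert_of_notMem hi, pow_succ]
  field_simp

theorem density_eq_erase {s : Finset α} {i : α} (hi : i ∈ s) (D : Finset α → Prop) :
    density s D =
      (density (s.erase i) D + density (s.erase i) fun S => D (insert i S)) / 2 := by
  conv_lhs => rw [← insert_erase hi]
  exact density_insert (notMem_erase i s) D

theorem density_compl (s : Finset α) (D : Finset α → Prop) :
    (density s fun S => D (s \ S)) = density s D := by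
  unfold density
  congr 1
  refine sum_bij' (fun S _ => s \ S) (fun S _ => s \ S) ?_ ?_ ?_ ?_ ?_
  · simp
  · simp
  · intro S hS
    simpa using mem_powerset.1 hS
  · intro S hS
    simpa using mem_powerset.1 hS
  · intro S hS
    rfl

/-- Cross-intersecting families have total density at most one, phrased for their complements. -/
theorem one_le_density_add_density {s : Finset α} {D E : Finset α → Prop}
    (h : ∀ S ⊆ s, D S ∨ E (s \ S)) : 1 ≤ density s D + density s E := by
  rw [← density_add_density_not s D, ← density_compl s E]
  gcongr
  exact density_mono fun S hS hD => (h S hS).resolve_left hD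

theorem Antitone.comp_insert {D : Finset α → Prop} (hD : Antitone D) (i : α) :
    Antitone fun S => D (insert i S) :=
  fun _ _ h => hD (insert_subset_insert i h)

theorem density_comp_insert_le {D : Finset α → Prop} (hD : Antitone D) (s : Finset α) (i : α) :
    (density s fun S => D (insert i S)) ≤ density s D :=
  density_mono fun _ _ h => hD (subset_insert _ _) h

theorem density_sdiff_le (R s : Finset α) (hR : R ⊆ s) (D : Finset α → Prop) :
    density (s \ R) D ≤ 2 ^ #R * density s D := by
  induction R using Finset.induction_on with
  | empty => simp
  | insert i R hi ih =>
    have hi' : i ∈ s \ R := by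
      simp [hi, hR (mem_insert_self i R)]
    have h1 := ih ((subset_insert i R).trans hR)
    rw [density_eq_erase hi'] at h1
    rw [card_insert_of_notMem hi, sdiff_insert, pow_succ]
    linarith [density_nonneg ((s \ R).erase i) fun S => D (insert i S)]

/-- Harris' inequality. -/
theorem density_mul_le_density_and (s : Finset α) {D E : Finset α → Prop}
    (hD : Antitone D) (hE : Antitone E) :
    density s D * density s E ≤ density s fun S => D S ∧ E S := by
  induction s using Finset.induction_on generalizing D E with
  | empty =>
    by_cases h : D ∅ <;> by_cases h' : E ∅ <;> simp [density_empty, h, h']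
  | insert i s hi ih =>
    rw [density_insert hi, density_insert hi, density_insert hi]
    have h1 := ih hD hE
    have h2 := ih (hD.comp_insert i) (hE.comp_insert i)
    nlinarith [mul_nonneg (sub_nonneg.2 (density_comp_insert_le hD s i))
      (sub_nonneg.2 (density_comp_insert_le hE s i))]

theorem prod_density_le {ι : Type*} (t : Finset ι) (s : Finset α) {D : ι → Finset α → Prop}
    (hD : ∀ j, Antitone (D j)) :
    ∏ j ∈ t, density s (D j) ≤ density s fun S => ∀ j ∈ t, D j S := by
  classical
  induction t using Finset.induction_on with
  | empty => simp [density]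
  | insert j t hj ih =>
    rw [prod_insert hj]
    calc _ ≤ density s (D j) * density s fun S => ∀ j ∈ t, D j S := by
            gcongr
            exact density_nonneg _ _
      _ ≤ density s fun S => D j S ∧ ∀ j ∈ t, D j S :=
            density_mul_le_density_and s (hD j) fun S T h hT i hi => hD i h (hT i hi)
      _ ≤ _ := density_mono fun S _ h => by simpa using h

theorem totalInfluence_insert {s : Finset α} {i : α} (hi : i ∉ s) (D : Finset α → Prop) :
    totalInfluence (insert i s) D = (density s D - density s fun S => D (insert i S)) +
      (totalInfluence s D + totalInfluence s fun S => D (insert i S)) / 2 := by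
  unfold totalInfluence
  rw [sum_insert hi, erase_insert hi, ← sum_add_distrib, sum_div]
  congr 1
  refine sum_congr rfl fun j hj => ?_
  have hij : i ≠ j := fun h => hi (h ▸ hj)
  have hi' : i ∉ s.erase j := fun h => hi (mem_of_mem_erase h)
  rw [erase_insert_of_ne hij, density_insert hi', density_insert hi']
  simp only [insert_comm j i]
  ring

open Classical in
theorem totalInfluence_eq_sum (s : Finset α) (D : Finset α → Prop) :
    totalInfluence s D =
      2 * (∑ S ∈ s.powerset, if D S then (#s - 2 * #S : ℝ) else 0) / 2 ^ #s := by
  induction s using Finset.induction_on generalizing D with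
  | empty => simp [totalInfluence]
  | insert i s hi ih =>
    rw [totalInfluence_insert hi, ih, ih, sum_powerset_insert hi, card_insert_of_notMem hi]
    have h1 : ∑ S ∈ s.powerset, (if D S then (((#s + 1 : ℕ) : ℝ) - 2 * #S) else 0) =
        (∑ S ∈ s.powerset, if D S then (#s - 2 * #S : ℝ) else 0) +
          ∑ S ∈ s.powerset, if D S then (1 : ℝ) else 0 := by
      rw [← sum_add_distrib]
      refine sum_congr rfl fun S _ => ?_
      split_ifs <;> push_cast <;> ring
    have h2 : ∑ S ∈ s.powerset, (if D (insert i S) then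
          (((#s + 1 : ℕ) : ℝ) - 2 * #(insert i S)) else 0) =
        (∑ S ∈ s.powerset, if D (insert i S) then (#s - 2 * #S : ℝ) else 0) -
          ∑ S ∈ s.powerset, if D (insert i S) then (1 : ℝ) else 0 := by
      rw [← sum_sub_distrib]
      refine sum_congr rfl fun S hS => ?_
      rw [card_insert_of_notMem fun h => hi (mem_powerset.1 hS h)]
      split_ifs <;> push_cast <;> ring
    rw [h1, h2]
    unfold density
    field_simp
    ring

/-- A quantitative form of the two-point inequality behind the edge-isoperimetric inequality. -/
theorem min_le_two_point_gap {a b : ℝ} (hb : 0 ≤ b) (hab : b ≤ a) :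
    min b (a - b) / 4 ≤ Real.log 2 * (a - b) + Real.negMulLog a + Real.negMulLog b
      - 2 * Real.negMulLog ((a + b) / 2) := by
  rcases (add_nonneg (hb.trans hab) hb).eq_or_lt with h0 | hpos
  · have hb0 : b = 0 := by linarith
    have ha0 : a = 0 := by linarith
    simp [hb0, ha0]
  set w := a + b with hw
  obtain ⟨x, hx⟩ : ∃ x, x = b / w := ⟨_, rfl⟩
  have hbx : b = w * x := by rw [hx]; field_simp
  have hax : a = w * (1 - x) := by linear_combination hw.symm - hbx
  have hx0 : 0 ≤ x := by rw [hx]; positivity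
  have hx1 : x ≤ 1 / 2 := by
    rw [hx, div_le_iff₀ hpos]; linarith
  have hgap : Real.log 2 * (a - b) + Real.negMulLog a + Real.negMulLog b
      - 2 * Real.negMulLog (w / 2) = w * (Real.binEntropy x - 2 * x * Real.log 2) := by
    rw [hax, hbx, Real.negMulLog_mul, Real.negMulLog_mul,
      Real.binEntropy_eq_negMulLog_add_negMulLog_one_sub, div_eq_mul_inv, Real.negMulLog_mul]
    have : Real.negMulLog (2⁻¹ : ℝ) = Real.log 2 / 2 := by
      rw [Real.negMulLog, Real.log_inv]; ring
    rw [this]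
    ring
  rw [hgap]
  have hq : Real.log (4 / 3) ≥ 1 / 4 := by
    have := Real.one_sub_inv_le_log_of_pos (show (0 : ℝ) < 4 / 3 by norm_num)
    norm_num at this ⊢
    linarith
  have hH4 : Real.binEntropy (1 / 4) = Real.log 2 / 2 + 3 / 4 * Real.log (4 / 3) := by
    rw [Real.binEntropy]
    have h4 : Real.log 4 = 2 * Real.log 2 := by
      rw [show (4 : ℝ) = 2 ^ 2 by norm_num, Real.log_pow]; norm_num
    norm_num
    rw [h4]
    ring
  have hH2 : Real.binEntropy (1 / 2) = Real.log 2 := by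
    rw [one_div]; exact Real.binEntropy_two_inv
  have conc := Real.strictConcave_binEntropy.concaveOn
  rcases le_total x (1 / 4) with h | h
  · have key := conc.2 (show (0 : ℝ) ∈ Set.Icc 0 1 by norm_num)
      (show (1 / 4 : ℝ) ∈ Set.Icc 0 1 by norm_num)
      (show 0 ≤ 1 - 4 * x by linarith) (show 0 ≤ 4 * x by linarith) (by ring)
    simp only [smul_eq_mul, Real.binEntropy_zero, mul_zero, zero_add] at key
    rw [hH4, show 4 * x * (1 / 4) = x by ring] at key
    have h1 : x / 4 ≤ Real.binEntropy x - 2 * x * Real.log 2 := by nlinarith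
    calc min b (a - b) / 4 ≤ b / 4 := by gcongr; exact min_le_left _ _
      _ = w * (x / 4) := by rw [hbx]; ring
      _ ≤ _ := by gcongr
  · have key := conc.2 (show (1 / 4 : ℝ) ∈ Set.Icc 0 1 by norm_num)
      (show (1 / 2 : ℝ) ∈ Set.Icc 0 1 by norm_num)
      (show 0 ≤ 2 - 4 * x by linarith) (show 0 ≤ 4 * x - 1 by linarith) (by ring)
    simp only [smul_eq_mul] at key
    rw [hH4, hH2, show (2 - 4 * x) * (1 / 4) + (4 * x - 1) * (1 / 2) = x by ring] at key
    have h1 : (1 - 2 * x) / 4 ≤ Real.binEntropy x - 2 * x * Real.log 2 := by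
      nlinarith [mul_nonneg (show 0 ≤ 1 - 2 * x by linarith) (sub_nonneg.2 hq)]
    calc min b (a - b) / 4 ≤ (a - b) / 4 := by gcongr; exact min_le_right _ _
      _ = w * ((1 - 2 * x) / 4) := by rw [hax, hbx]; ring
      _ ≤ _ := by gcongr

theorem isoDeficiency_insert {s : Finset α} {i : α} (hi : i ∉ s) {D : Finset α → Prop}
    (hD : Antitone D) :
    min (density s fun S => D (insert i S))
        (density s D - density s fun S => D (insert i S)) / 4 +
      (isoDeficiency s D + isoDeficiency s fun S => D (insert i S)) / 2 ≤
        isoDeficiency (insert i s) D := by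
  have h := min_le_two_point_gap (density_nonneg s fun S => D (insert i S))
    (density_comp_insert_le hD s i)
  unfold isoDeficiency
  rw [totalInfluence_insert hi, density_insert hi]
  linarith

/-- The edge-isoperimetric inequality for decreasing families. -/
theorem isoDeficiency_nonneg (s : Finset α) {D : Finset α → Prop} (hD : Antitone D) :
    0 ≤ isoDeficiency s D := by
  induction s using Finset.induction_on generalizing D with
  | empty => by_cases h : D ∅ <;> simp [isoDeficiency, totalInfluence, density_empty, h]
  | insert i s hi ih =>
    have h1 := isoDeficiency_insert hi hD
    have h2 : 0 ≤ min (density s fun S => D (insert i S))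
        (density s D - density s fun S => D (insert i S)) :=
      le_min (density_nonneg _ _) (sub_nonneg.2 (density_comp_insert_le hD s i))
    linarith [ih hD, ih (hD.comp_insert i)]

/-- A decreasing family of density about `2⁻ᵗ` which is nearly extremal in the edge-isoperimetric
inequality is close to a subcube of codimension `t`. -/
theorem exists_subcube_of_isoDeficiency_le (t : ℕ) (s : Finset α) {D : Finset α → Prop}
    (hD : Antitone D) {τ : ℝ} (hdef : isoDeficiency s D ≤ τ)
    (hdens : |density s D - (1 / 2) ^ t| ≤ τ) (hτ : 16 * (#s + 1) * 6 ^ t * τ < 1) :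
    ∃ R ⊆ s, #R = t ∧ 1 - 6 ^ t * τ ≤ density (s \ R) D ∧
      ∀ i ∈ R, (density (s \ R) fun S => D (insert i S)) ≤ 6 ^ t * τ := by
  induction t generalizing s τ with
  | zero =>
    refine ⟨∅, empty_subset s, rfl, ?_, by simp⟩
    have := (abs_le.1 hdens).1
    simp only [pow_zero, sdiff_empty] at this ⊢
    linarith
  | succ t ih =>
    have hτ0 : 0 ≤ τ := (abs_nonneg _).trans hdens
    obtain ⟨hl, hu⟩ := abs_le.1 hdens
    have h6 : (2 : ℝ) ^ t ≤ 6 ^ t := pow_le_pow_left₀ (by norm_num) (by norm_num) t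
    have h2 : (1 : ℝ) ≤ 2 ^ t := one_le_pow₀ (by norm_num)
    have hhalf : (1 / 2 : ℝ) ^ (t + 1) * 2 ^ t = 1 / 2 := by
      rw [pow_succ, mul_right_comm, ← mul_pow]; norm_num
    have hsmall : 32 * (#s + 1) * τ < (1 / 2 : ℝ) ^ (t + 1) := by
      have : 96 * (#s + 1) * τ * 2 ^ t < 1 := by
        refine lt_of_le_of_lt ?_ hτ
        calc 96 * (#s + 1) * τ * 2 ^ t ≤ 96 * (#s + 1) * τ * 6 ^ t := by gcongr
          _ = _ := by ring
      by_contra hcon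
      push Not at hcon
      have := mul_le_mul_of_nonneg_right hcon (zero_le_one.trans h2)
      nlinarith
    have hpow : (1 / 2 : ℝ) ^ (t + 1) ≤ 1 / 2 := by
      rw [pow_succ]
      have : (1 / 2 : ℝ) ^ t ≤ 1 := pow_le_one₀ (by norm_num) (by norm_num)
      linarith
    have hcard : (0 : ℝ) ≤ #s := by positivity
    have hsτ : 0 ≤ #s * τ := by positivity
    obtain ⟨i, hi, hinf⟩ : ∃ i ∈ s, 4 * τ <
        density (s.erase i) D - density (s.erase i) fun S => D (insert i S) := by
      by_contra hcon
      push Not at hcon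
      have h1 : totalInfluence s D ≤ #s * (4 * τ) := by
        have := sum_le_card_nsmul s _ (4 * τ) hcon
        simpa [totalInfluence] using this
      have h3 := isoDeficiency_nonneg s hD
      unfold isoDeficiency at h3
      set μ := density s D
      have hμ : 0 < μ := by nlinarith
      have h4 : μ * (1 - μ) ≤ Real.negMulLog μ := by
        have := Real.log_le_sub_one_of_pos hμ
        unfold Real.negMulLog
        nlinarith
      have h5 : Real.log 2 * totalInfluence s D ≤ #s * (4 * τ) := by
        have : Real.log 2 ≤ 1 := by linarith [Real.log_two_lt_d9]
        have := Real.log_pos (show (1 : ℝ) < 2 by norm_num)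
        nlinarith
      have h6 : 1 / 4 ≤ 1 - μ := by nlinarith
      have h7 : (1 / 2 : ℝ) ^ (t + 1) / 2 ≤ μ := by nlinarith
      nlinarith
    have hins := isoDeficiency_insert (notMem_erase i s) hD
    rw [insert_erase hi] at hins
    have hn1 := isoDeficiency_nonneg (s.erase i) hD
    have hn2 := isoDeficiency_nonneg (s.erase i) (hD.comp_insert i)
    have hin : (density (s.erase i) fun S => D (insert i S)) ≤ 4 * τ := by
      have hmin : min (density (s.erase i) fun S => D (insert i S))
        (density (s.erase i) D - density (s.erase i) fun S => D (insert i S)) ≤ 4 * τ := by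
        linarith
      exact (min_le_iff.1 hmin).resolve_right (not_le.2 hinf)
    have hin0 := density_nonneg (s.erase i) fun S => D (insert i S)
    have hmin0 : 0 ≤ min (density (s.erase i) fun S => D (insert i S))
        (density (s.erase i) D - density (s.erase i) fun S => D (insert i S)) :=
      le_min hin0 (by linarith)
    have hsplit := density_eq_erase hi D
    obtain ⟨R, hRs, hRt, hR1, hR2⟩ := ih (s.erase i) (τ := 6 * τ) (by linarith)
      (by rw [abs_le]; rw [pow_succ] at hl hu; constructor <;> linarith)
      (by
        rw [card_erase_of_mem hi]
        refine lt_of_le_of_lt ?_ hτ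
        have : ((#s - 1 : ℕ) : ℝ) ≤ #s := by exact_mod_cast Nat.sub_le _ _
        calc 16 * (((#s - 1 : ℕ) : ℝ) + 1) * 6 ^ t * (6 * τ)
            ≤ 16 * ((#s : ℝ) + 1) * 6 ^ t * (6 * τ) := by gcongr
          _ = _ := by ring)
    have hiR : i ∉ R := fun h => notMem_erase i s (hRs h)
    have hsd : s \ insert i R = s.erase i \ R := by
      rw [sdiff_insert, erase_sdiff_comm]
    refine ⟨insert i R, insert_subset hi (hRs.trans (erase_subset i s)),
      by rw [card_insert_of_notMem hiR, hRt], ?_, ?_⟩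
    · rw [hsd, pow_succ]; linarith
    · rw [hsd]
      intro j hj
      rcases mem_insert.1 hj with rfl | hj
      · refine (density_sdiff_le R _ hRs _).trans ?_
        rw [hRt, pow_succ]
        calc (2 : ℝ) ^ t * _ ≤ 6 ^ t * (4 * τ) := by gcongr
          _ ≤ _ := by nlinarith [mul_nonneg (pow_nonneg (show (0 : ℝ) ≤ 6 by norm_num) t) hτ0]
      · rw [pow_succ]
        linarith [hR2 j hj]

end Density

section Layers

/-- The Lovász form of the Kruskal–Katona theorem, in terms of subsets of members. -/
theorem choose_le_card_subsets {n m t j : ℕ} {𝒜 : Finset (Finset (Fin n))} (hjm : j ≤ m)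
    (hmt : m ≤ t) (htn : t ≤ n) (hsz : ∀ S ∈ 𝒜, #S = m) (h : t.choose m ≤ #𝒜) :
    t.choose j ≤ #{T : Finset (Fin n) | #T = j ∧ ∃ S ∈ 𝒜, T ⊆ S} := by
  have hkk := kruskal_katona_lovasz_form (i := m - j) (Nat.sub_le m j) hmt htn
    (fun S hS => hsz S hS) h
  rw [Nat.sub_sub_self hjm] at hkk
  refine hkk.trans (card_le_card fun T hT => ?_)
  obtain ⟨S, hS, hTS, hcard⟩ := mem_shadow_iterate_iff_exists_sdiff.1 hT
  rw [card_sdiff_of_subset hTS, hsz S hS] at hcard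
  have := card_le_card hTS
  rw [hsz S hS] at this
  simp only [mem_filter, mem_univ, true_and]
  exact ⟨by lia, S, hS, hTS⟩

open Classical in
/-- If a decreasing family has fewer `k`-sets than a subcube of codimension `r`, then it has at most
as many `m`-sets as that subcube for every `m ≥ k`. -/
theorem card_layer_le_choose {n k m r : ℕ} {D : Finset (Fin n) → Prop} (hD : Antitone D)
    (hkm : k ≤ m) (hk : k ≤ n - r) (hlt : #{S : Finset (Fin n) | #S = k ∧ D S} < (n - r).choose k) :
    #{S : Finset (Fin n) | #S = m ∧ D S} ≤ (n - r).choose m := by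
  have key : ∀ l, k ≤ l → l ≤ n - r →
      #{S : Finset (Fin n) | #S = l ∧ D S} < (n - r).choose l := by
    intro l hkl hl
    by_contra hcon
    push Not at hcon
    refine hlt.not_ge ((choose_le_card_subsets hkl hl (Nat.sub_le n r) (fun S hS => ?_) hcon).trans
      (card_le_card fun T hT => ?_))
    · exact (mem_filter.1 hS).2.1
    · simp only [mem_filter, mem_univ, true_and] at hT ⊢
      obtain ⟨hT, S, ⟨-, hS⟩, hTS⟩ := hT
      exact ⟨hT, hD hTS hS⟩
  rcases le_or_gt m (n - r) with hm | hm
  · exact (key m hkm hm).le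
  · rw [Nat.choose_eq_zero_of_lt hm, Nat.le_zero, card_eq_zero, filter_eq_empty_iff]
    rintro S - ⟨hS, hDS⟩
    obtain ⟨T, hTS, hT⟩ := exists_subset_card_eq (hS.symm ▸ hm.le : n - r ≤ #S)
    have h1 := key (n - r) hk le_rfl
    rw [Nat.choose_self, Nat.lt_one_iff, card_eq_zero, filter_eq_empty_iff] at h1
    exact h1 (mem_univ T) ⟨hT, hD hTS hDS⟩

open Classical in
theorem sum_powerset_ite_eq_sum_layers {n : ℕ} (D : Finset (Fin n) → Prop) (g : ℕ → ℝ) :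
    (∑ S ∈ (univ : Finset (Fin n)).powerset, if D S then g #S else 0) =
      ∑ m ∈ range (n + 1), (#{S : Finset (Fin n) | #S = m ∧ D S} : ℝ) * g m := by
  rw [powerset_univ, ← sum_fiberwise_of_maps_to (g := card) (t := range (n + 1))]
  · refine sum_congr rfl fun m _ => ?_
    rw [← sum_filter, filter_filter, sum_congr rfl (g := fun _ => g m), sum_const, nsmul_eq_mul]
    intro S hS
    rw [(mem_filter.1 hS).2.1]
  · intro S _
    exact mem_range.2 (Nat.lt_succ_of_le (card_finset_fin_le S))

theorem sum_range_choose_of_le {N n : ℕ} (h : N ≤ n) :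
    ∑ m ∈ range (n + 1), (N.choose m : ℝ) = 2 ^ N := by
  rw [← sum_subset (range_subset_range.2 (Nat.succ_le_succ h))]
  · exact_mod_cast Nat.sum_range_choose N
  · intro m _ hm
    rw [Nat.choose_eq_zero_of_lt (by simpa using hm), Nat.cast_zero]

theorem sum_range_choose_mul_sub_of_le {N n : ℕ} (h : N ≤ n) :
    ∑ m ∈ range (n + 1), (N.choose m : ℝ) * (n - 2 * m) = (n - N) * 2 ^ N := by
  have h1 : ∑ m ∈ range (n + 1), (m * N.choose m : ℝ) * 2 = N * 2 ^ N := by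
    rw [← sum_subset (range_subset_range.2 (Nat.succ_le_succ h)), ← sum_mul]
    · have := Nat.sum_range_mul_choose N
      rcases N.eq_zero_or_pos with rfl | hN
      · simp
      · rw [show N = N - 1 + 1 by lia, pow_succ, ← mul_assoc]
        rw [show N - 1 + 1 = N by lia]
        congr 1
        exact_mod_cast this
    · intro m _ hm
      rw [Nat.choose_eq_zero_of_lt (by simpa using hm)]
      simp
  have h2 := sum_range_choose_of_le h
  calc _ = ∑ m ∈ range (n + 1), ((N.choose m : ℝ) * n - (m * N.choose m : ℝ) * 2) :=
        sum_congr rfl fun m _ => by ring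
    _ = _ := by rw [sum_sub_distrib, ← sum_mul, h1, h2]; ring

/-- The proportion of subsets of an `n`-set of size less than `k`. -/
noncomputable def lowerTail (n k : ℕ) : ℝ := (∑ m ∈ range k, (n.choose m : ℝ)) / 2 ^ n

theorem lowerTail_nonneg (n k : ℕ) : 0 ≤ lowerTail n k := by
  unfold lowerTail
  positivity

theorem lowerTail_le_exp {n k : ℕ} (hn : 0 < n) (hkn : 2 * k ≤ n) :
    lowerTail n k ≤ Real.exp (-((n - 2 * k : ℝ) ^ 2 / n) / 2) := by
  have hn' : (0 : ℝ) < n := by exact_mod_cast hn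
  have hkn' : (2 * k : ℝ) ≤ n := by exact_mod_cast hkn
  set d : ℝ := n - 2 * k with hd
  have hd0 : 0 ≤ d := by linarith
  set x := d / n with hx
  have hx0 : 0 ≤ x := by positivity
  rw [lowerTail, div_le_iff₀ (by positivity)]
  calc ∑ m ∈ range k, (n.choose m : ℝ)
      ≤ ∑ m ∈ range k, Real.exp (-x * d) *
          (Real.exp (-x) ^ m * Real.exp x ^ (n - m) * n.choose m) := by
        refine sum_le_sum fun m hm => ?_
        have hm' : m < k := mem_range.1 hm
        rw [← mul_assoc]
        refine le_mul_of_one_le_left (by positivity) ?_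
        rw [← Real.exp_nat_mul, ← Real.exp_nat_mul, ← Real.exp_add, ← Real.exp_add]
        apply Real.one_le_exp
        rw [Nat.cast_sub (by lia)]
        have : (m : ℝ) ≤ k := by exact_mod_cast hm'.le
        nlinarith
    _ ≤ ∑ m ∈ range (n + 1), Real.exp (-x * d) *
          (Real.exp (-x) ^ m * Real.exp x ^ (n - m) * n.choose m) := by
        refine sum_le_sum_of_subset_of_nonneg (range_subset_range.2 (by lia)) ?_
        intros
        positivity
    _ = Real.exp (-x * d) * (2 * Real.cosh x) ^ n := by
        rw [← mul_sum, ← add_pow, Real.cosh_eq]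
        congr 2
        ring
    _ ≤ Real.exp (-x * d) * (2 * Real.exp (x ^ 2 / 2)) ^ n := by
        have := Real.cosh_pos x
        gcongr
        exact Real.cosh_le_exp_half_sq x
    _ = _ := by
        rw [mul_pow, ← Real.exp_nat_mul, mul_left_comm, ← Real.exp_add, mul_comm]
        congr 2
        rw [hx]
        field_simp
        ring

open Classical in
/-- A decreasing family of density at least `2⁻ʳ` having fewer `k`-sets than a subcube of
codimension `r` has density about `2⁻ʳ`, and is nearly extremal in the edge-isoperimetric
inequality. -/
theorem density_le_and_isoDeficiency_le {n k r : ℕ} {D : Finset (Fin n) → Prop} (hD : Antitone D)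
    (hrn : r ≤ n) (hk : k ≤ n - r)
    (hlt : #{S : Finset (Fin n) | #S = k ∧ D S} < (n - r).choose k)
    (hdens : (1 / 2) ^ r ≤ density univ D) :
    density univ D ≤ (1 / 2) ^ r + lowerTail n k ∧
      isoDeficiency univ D ≤ (4 * n + 2) * lowerTail n k := by
  set T := lowerTail n k with hT
  have hT0 : 0 ≤ T := lowerTail_nonneg n k
  set d : ℕ → ℝ := fun m => (#{S : Finset (Fin n) | #S = m ∧ D S} : ℝ) with hd
  set e : ℕ → ℝ := fun m => d m - (n - r).choose m with he
  have hpow : (2 : ℝ) ^ (n - r) = (1 / 2) ^ r * 2 ^ n := by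
    rw [← Nat.sub_add_cancel hrn, pow_add, Nat.add_sub_cancel, one_div, inv_pow]
    field_simp
  have hdens_eq : density univ D * 2 ^ n = ∑ m ∈ range (n + 1), d m := by
    have h1 := sum_powerset_ite_eq_sum_layers D fun _ => 1
    simp only [mul_one] at h1
    rw [density, card_fin, div_mul_cancel₀ _ (by positivity), h1]
  have hinf_eq : totalInfluence univ D * 2 ^ n =
      2 * ∑ m ∈ range (n + 1), d m * (n - 2 * m) := by
    have h1 := sum_powerset_ite_eq_sum_layers D fun m => (n - 2 * m : ℝ)
    rw [totalInfluence_eq_sum, card_fin, div_mul_cancel₀ _ (by positivity), h1]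
  have hsum : ∑ m ∈ range (n + 1), e m = (density univ D - (1 / 2) ^ r) * 2 ^ n := by
    rw [he, sum_sub_distrib, sum_range_choose_of_le (Nat.sub_le n r), hpow, ← hdens_eq]
    ring
  have hsum0 : 0 ≤ ∑ m ∈ range (n + 1), e m := by
    rw [hsum]
    exact mul_nonneg (sub_nonneg.2 hdens) (by positivity)
  have hTsum : ∑ m ∈ range (n + 1), (if m < k then (n.choose m : ℝ) else 0) = T * 2 ^ n := by
    rw [hT, lowerTail, div_mul_cancel₀ _ (by positivity), ← sum_filter]
    refine sum_congr ?_ fun _ _ => rfl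
    ext m
    simp only [mem_filter, mem_range]
    lia
  have he_high : ∀ m, k ≤ m → e m ≤ 0 := by
    intro m hm
    have := card_layer_le_choose hD hm hk hlt
    simp only [he, hd, sub_nonpos]
    exact_mod_cast this
  have he_low : ∀ m, e m ≤ n.choose m := by
    intro m
    have h1 : #{S : Finset (Fin n) | #S = m ∧ D S} ≤ n.choose m := by
      calc _ ≤ #(powersetCard m (univ : Finset (Fin n))) := card_le_card fun S hS => by
              simp only [mem_filter, mem_univ, true_and] at hS
              simp [hS.1]
        _ = _ := by rw [card_powersetCard, card_fin]
    have h2 : (0 : ℝ) ≤ (n - r).choose m := by positivity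
    have h3 : d m ≤ n.choose m := by
      simp only [hd]
      exact_mod_cast h1
    simp only [he]
    linarith
  have hupper : density univ D ≤ (1 / 2) ^ r + T := by
    have : ∑ m ∈ range (n + 1), e m ≤ T * 2 ^ n := by
      rw [← hTsum]
      refine sum_le_sum fun m _ => ?_
      split_ifs with h
      · exact he_low m
      · exact he_high m (not_lt.1 h)
    rw [hsum] at this
    linarith [le_of_mul_le_mul_right this (by positivity)]
  refine ⟨hupper, ?_⟩
  have hinf : totalInfluence univ D ≤ 2 * r * (1 / 2) ^ r + 4 * n * T := by
    have h1 : ∑ m ∈ range (n + 1), e m * (n - 2 * m) ≤ 2 * n * (T * 2 ^ n) := by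
      calc _ ≤ ∑ m ∈ range (n + 1),
            (2 * n * (if m < k then (n.choose m : ℝ) else 0) - n * e m) := by
            refine sum_le_sum fun m hm => ?_
            have hmn : (m : ℝ) ≤ n := by exact_mod_cast Nat.lt_succ_iff.1 (mem_range.1 hm)
            have hm0 : (0 : ℝ) ≤ m := by positivity
            split_ifs with h
            · have h2 := he_low m
              have h3 : (0 : ℝ) ≤ n.choose m := by positivity
              nlinarith [mul_nonneg (sub_nonneg.2 hmn) (sub_nonneg.2 h2), mul_nonneg hm0 h3]
            · have h2 := he_high m (not_lt.1 h)
              nlinarith [mul_nonneg (sub_nonneg.2 hmn) (neg_nonneg.2 h2)]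
        _ ≤ _ := by
            rw [sum_sub_distrib, ← mul_sum, ← mul_sum, hTsum]
            have : (0 : ℝ) ≤ n * ∑ m ∈ range (n + 1), e m := by positivity
            linarith
    have h2 : ∑ m ∈ range (n + 1), e m * (n - 2 * m) =
        (∑ m ∈ range (n + 1), d m * (n - 2 * m)) - r * ((1 / 2) ^ r * 2 ^ n) := by
      have h3 := sum_range_choose_mul_sub_of_le (Nat.sub_le n r)
      rw [hpow, Nat.cast_sub hrn] at h3
      rw [show (n : ℝ) - (n - r) = r by ring] at h3
      rw [← h3, ← sum_sub_distrib]
      refine sum_congr rfl fun m _ => ?_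
      simp only [he]
      ring
    have h4 : (0 : ℝ) < 2 ^ n := by positivity
    refine le_of_mul_le_mul_right ?_ h4
    rw [hinf_eq]
    linarith
  have hent : r * Real.log 2 * (1 / 2) ^ r - T ≤ Real.negMulLog (density univ D) := by
    set μ := density univ D
    set c : ℝ := (1 / 2) ^ r with hc
    have hc0 : 0 < c := by positivity
    have hc1 : Real.log c = -(r * Real.log 2) := by
      rw [hc, Real.log_pow, one_div, Real.log_inv]
      ring
    have hμ0 : 0 < μ := hc0.trans_le hdens
    have h1 : Real.log μ - Real.log c ≤ T / c := by
      rw [← Real.log_div hμ0.ne' hc0.ne']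
      refine (Real.log_le_sub_one_of_pos (by positivity)).trans ?_
      rw [← sub_nonneg]
      have : T / c - (μ / c - 1) = (c + T - μ) / c := by field_simp; ring
      rw [this]
      exact div_nonneg (by linarith) hc0.le
    have h2 : c * (Real.log μ - Real.log c) ≤ T := by
      calc _ ≤ c * (T / c) := by gcongr
        _ = T := by field_simp
    have h3 : Real.log μ ≤ 0 := Real.log_nonpos hμ0.le (density_le_one _ _)
    rw [hc1] at h2
    unfold Real.negMulLog
    nlinarith [mul_nonneg (sub_nonneg.2 hdens) (neg_nonneg.2 h3)]
  have hl1 : Real.log 2 ≤ 1 := by linarith [Real.log_two_lt_d9]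
  have hl0 : 0 ≤ Real.log 2 := Real.log_nonneg (by norm_num)
  unfold isoDeficiency
  have h5 := mul_le_mul_of_nonneg_left hinf hl0
  have h6 : Real.log 2 * (4 * n * T) ≤ 4 * n * T := mul_le_of_le_one_left (by positivity) hl1
  linarith

end Layers

section Growth

theorem pow_mul_choose_le {N k a : ℕ} (hk : 1 ≤ k) (hak : a ≤ k) (hN : 2 * k + 2 ≤ N)
    (t : ℕ) (htN : t ≤ N) :
    ((N - k + 1 : ℝ) / (k + 1)) ^ t * N.choose (k - 1) * (N - t).choose (N - a - 1) ≤
      (N - t).choose (k - 1) * N.choose (N - a - 1) := by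
  induction t with
  | zero => simp
  | succ t ih =>
    set x : ℝ := (N - k + 1 : ℝ) / (k + 1) with hx
    set L := N - a - 1 with hL
    obtain ⟨m, hm⟩ : ∃ m, N - t = m + 1 := ⟨N - t - 1, by lia⟩
    have hm' : N - (t + 1) = m := by lia
    have hNk : (2 * k + 2 : ℝ) ≤ N := by exact_mod_cast hN
    have hx0 : 0 ≤ x := div_nonneg (by linarith) (by positivity)
    have ih := ih (by lia)
    rw [hm] at ih
    rw [hm']
    have h1 : (m.choose L : ℝ) * (m + 1) = (m + 1).choose L * (m + 1 - L : ℕ) := by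
      exact_mod_cast Nat.choose_mul_succ_eq m L
    have h2 : (m.choose (k - 1) : ℝ) * (m + 1) =
        (m + 1).choose (k - 1) * (m + 1 - (k - 1) : ℕ) := by
      exact_mod_cast Nat.choose_mul_succ_eq m (k - 1)
    have h3 : x * (m + 1 - L : ℕ) ≤ (m + 1 - (k - 1) : ℕ) := by
      rcases le_or_gt (a + 1) t with ht | ht
      · rw [show m + 1 - L = 0 by lia, Nat.cast_zero, mul_zero]
        positivity
      · rw [show m + 1 - L = a + 1 - t by lia, hx, div_mul_eq_mul_div,
          div_le_iff₀ (by positivity)]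
        have h4 : (N - t - k + 1 : ℝ) ≤ (m + 1 - (k - 1) : ℕ) := by
          have : (N : ℝ) + 1 ≤ (m + 1 - (k - 1) : ℕ) + t + k := by
            exact_mod_cast (by lia : N + 1 ≤ (m + 1 - (k - 1)) + t + k)
          linarith
        have h5 : ((a + 1 - t : ℕ) : ℝ) ≤ k + 1 - t := by
          rw [Nat.cast_sub ht.le]
          push_cast
          have : (a : ℝ) ≤ k := by exact_mod_cast hak
          linarith
        have ht0 : (0 : ℝ) ≤ t := by positivity
        calc (N - k + 1 : ℝ) * (a + 1 - t : ℕ) ≤ (N - k + 1) * (k + 1 - t) :=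
              mul_le_mul_of_nonneg_left h5 (by linarith)
          _ ≤ (N - t - k + 1) * (k + 1) := by nlinarith
          _ ≤ _ := mul_le_mul_of_nonneg_right h4 (by positivity)
    refine le_of_mul_le_mul_right ?_ (show (0 : ℝ) < m + 1 by positivity)
    calc x ^ (t + 1) * N.choose (k - 1) * m.choose L * (m + 1)
        = (x * (m + 1 - L : ℕ)) * (x ^ t * N.choose (k - 1) * (m + 1).choose L) := by
          rw [mul_assoc _ (m.choose L : ℝ), h1]; ring
      _ ≤ (m + 1 - (k - 1) : ℕ) * ((m + 1).choose (k - 1) * N.choose L) := by gcongr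
      _ = m.choose (k - 1) * N.choose L * (m + 1) := by
          rw [mul_right_comm, h2]; ring

theorem choose_succ_le_two_mul_sq {N k a : ℕ} (hk : 1 ≤ k) (hak : a ≤ k)
    (hN : 2 * k + 2 ≤ N) :
    (N.choose (a + 1) : ℝ) ≤ 2 * ((N - k + 1 : ℝ) / (k + 1)) ^ 2 * N.choose (k - 1) := by
  have hmono : N.choose (a + 1) ≤ N.choose (k + 1) := by
    have h : ∀ b, b ≤ k + 1 → N.choose (k + 1 - b) ≤ N.choose (k + 1) := by
      intro b hb
      induction b with
      | zero => simp
      | succ b ih =>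
        refine le_trans ?_ (ih (by lia))
        have := Nat.choose_le_succ_of_lt_half_left (r := k + 1 - (b + 1)) (n := N) (by lia)
        rwa [show k + 1 - (b + 1) + 1 = k + 1 - b by lia] at this
    have := h (k - a) (by lia)
    rwa [show k + 1 - (k - a) = a + 1 by lia] at this
  have hNk : (2 * k + 2 : ℝ) ≤ N := by exact_mod_cast hN
  have hk' : (1 : ℝ) ≤ k := by exact_mod_cast hk
  have h1 : (N.choose (k + 1) : ℝ) * (k + 1) = N.choose k * (N - k) := by
    have := Nat.choose_succ_right_eq N k
    rw [← Nat.cast_sub (by lia)]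
    exact_mod_cast this
  have h2 : (N.choose k : ℝ) * k = N.choose (k - 1) * (N - k + 1) := by
    have := Nat.choose_succ_right_eq N (k - 1)
    rw [Nat.sub_add_cancel hk] at this
    rw [show (N - k + 1 : ℝ) = ((N - (k - 1) : ℕ) : ℝ) by
      rw [Nat.cast_sub (by lia), Nat.cast_sub hk]; push_cast; ring]
    exact_mod_cast this
  calc (N.choose (a + 1) : ℝ) ≤ N.choose (k + 1) := by exact_mod_cast hmono
    _ = N.choose (k - 1) * ((N - k + 1) * (N - k) / (k * (k + 1))) := by
        have h3 : (N.choose (k + 1) : ℝ) * (k * (k + 1)) =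
            N.choose (k - 1) * ((N - k + 1) * (N - k)) := by
          linear_combination k * h1 + (N - k : ℝ) * h2
        rw [← mul_div_assoc, eq_div_iff (by positivity), h3]
    _ ≤ N.choose (k - 1) * (2 * ((N - k + 1 : ℝ) / (k + 1)) ^ 2) := by
        gcongr
        rw [div_pow, mul_div_assoc', div_le_div_iff₀ (by positivity) (by positivity)]
        have hp : 0 ≤ (N - k + 1 : ℝ) * (k + 1) := mul_nonneg (by linarith) (by positivity)
        calc (N - k + 1 : ℝ) * (N - k) * (k + 1) ^ 2
            = ((N - k + 1) * (k + 1)) * ((N - k) * (k + 1)) := by ring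
          _ ≤ ((N - k + 1) * (k + 1)) * ((N - k + 1) * (2 * k)) := by
              gcongr <;> linarith
          _ = _ := by ring
    _ = _ := by ring

theorem mul_choose_le_choose {N k a t r : ℕ} (hk : 1 ≤ k) (hak : a ≤ k)
    (hN : 2 * k + 2 ≤ N) (ht : 2 ≤ t) (htN : t ≤ N)
    (hlarge : (4 * r * (k + 1) : ℝ) ≤ (t - 2) * (N - 2 * k)) :
    r * (N - t + 1).choose (N - a) ≤ (N - t).choose (k - 1) := by
  set x : ℝ := (N - k + 1 : ℝ) / (k + 1) with hx
  have hNk : (2 * k + 2 : ℝ) ≤ N := by exact_mod_cast hN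
  have hx1 : x - 1 = (N - 2 * k) / (k + 1) := by rw [hx]; field_simp; ring
  have hx0 : 0 < x - 1 := by rw [hx1]; exact div_pos (by linarith) (by positivity)
  have hbern : (4 * r : ℝ) ≤ x ^ (t - 2) := by
    have h1 := one_add_mul_le_pow (show (-2 : ℝ) ≤ x - 1 by linarith) (t - 2)
    rw [Nat.cast_sub ht, add_sub_cancel] at h1
    have h2 : (4 * r : ℝ) ≤ (t - 2) * (x - 1) := by
      rw [hx1, mul_div_assoc', le_div_iff₀ (by positivity)]
      exact hlarge
    push_cast at h1
    linarith
  have hC : 0 < (N.choose (k - 1) : ℝ) := by exact_mod_cast Nat.choose_pos (by lia)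
  have hL : N.choose (N - a - 1) = N.choose (a + 1) := by
    rw [← Nat.choose_symm (show a + 1 ≤ N by lia), Nat.sub_sub]
  have h1 := pow_mul_choose_le hk hak hN t htN
  rw [← hx, hL] at h1
  have h2 := choose_succ_le_two_mul_sq hk hak hN
  rw [← hx] at h2
  have h3 : x ^ (t - 2) * (N - t).choose (N - a - 1) ≤ 2 * (N - t).choose (k - 1) := by
    have hpos : 0 < x ^ 2 * N.choose (k - 1) := by
      have : 0 < x := by linarith
      positivity
    refine le_of_mul_le_mul_right ?_ hpos
    calc x ^ (t - 2) * (N - t).choose (N - a - 1) * (x ^ 2 * N.choose (k - 1))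
        = x ^ t * N.choose (k - 1) * (N - t).choose (N - a - 1) := by
          rw [← Nat.sub_add_cancel ht, pow_add, Nat.add_sub_cancel]; ring
      _ ≤ (N - t).choose (k - 1) * N.choose (a + 1) := h1
      _ ≤ (N - t).choose (k - 1) * (2 * x ^ 2 * N.choose (k - 1)) := by gcongr
      _ = _ := by ring
  have h4 : (N - t + 1).choose (N - a) ≤ 2 * (N - t).choose (N - a - 1) := by
    have h := Nat.add_one_mul_choose_eq (N - t) (N - a - 1)
    rw [Nat.sub_add_cancel (show 1 ≤ N - a by lia)] at h
    refine Nat.le_of_mul_le_mul_right (?_ : _ * (N - a) ≤ _ * (N - a)) (by lia)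
    rw [← h, mul_right_comm]
    exact Nat.mul_le_mul_right _ (by lia)
  have h5 : ((N - t + 1).choose (N - a) : ℝ) ≤ 2 * (N - t).choose (N - a - 1) := by
    exact_mod_cast h4
  have h6 : (r * (N - t + 1).choose (N - a) : ℝ) ≤ (N - t).choose (k - 1) := by
    have h7 : (4 * r : ℝ) * (N - t).choose (N - a - 1) ≤ 2 * (N - t).choose (k - 1) :=
      (mul_le_mul_of_nonneg_right hbern (by positivity)).trans h3
    have h8 := mul_le_mul_of_nonneg_left h5 (show (0 : ℝ) ≤ r by positivity)
    linarith
  exact_mod_cast h6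

/-- If the increasing family generated by a family of `a`-sets is sparse, then there are many more
`(k - 1)`-sets disjoint from some member of the family than there are members. -/
theorem mul_card_le_card_of_sparse {n k a r : ℕ} {Y : Finset (Fin n)}
    {𝓑 𝓜 : Finset (Finset (Fin n))} {η : ℝ} (hk : 1 ≤ k) (hak : a ≤ k) (hY : 2 * k + 2 ≤ #Y)
    (h𝓑 : ∀ B ∈ 𝓑, B ⊆ Y ∧ #B = a) (hη : (density Y fun S => ∃ B ∈ 𝓑, B ⊆ S) ≤ η)
    (h𝓜 : ∀ T ⊆ Y, #T = k - 1 → (∃ B ∈ 𝓑, Disjoint B T) → T ∈ 𝓜)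
    (hlarge : ∀ t : ℕ, 1 ≤ (n + 1) * η * 2 ^ t →
      2 ≤ t ∧ (4 * r * (k + 1) : ℝ) ≤ (t - 2) * (#Y - 2 * k)) :
    r * #𝓑 ≤ #𝓜 := by
  classical
  rcases 𝓑.eq_empty_or_nonempty with rfl | hne
  · simp
  set N := #Y with hN
  have hNn : N ≤ n := by simpa using card_le_univ Y
  set 𝒜 := 𝓑.image fun B => Y \ B with h𝒜
  have hcard : #𝒜 = #𝓑 := by
    refine card_image_of_injOn fun B hB C hC h => ?_
    have h' : Y \ (Y \ B) = Y \ (Y \ C) := by rw [show Y \ B = Y \ C from h]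
    rwa [Finset.sdiff_sdiff_eq_self (h𝓑 B hB).1, Finset.sdiff_sdiff_eq_self (h𝓑 C hC).1] at h'
  have hsz : ∀ S ∈ 𝒜, #S = N - a := by
    intro S hS
    obtain ⟨B, hB, rfl⟩ := mem_image.1 hS
    rw [card_sdiff_of_subset (h𝓑 B hB).1, (h𝓑 B hB).2]
  set s := Nat.findGreatest (fun s => s.choose (N - a) ≤ #𝓑) N with hs
  have hbase : (N - a).choose (N - a) ≤ #𝓑 := by
    rw [Nat.choose_self]; exact hne.card_pos
  have hsN : s ≤ N := Nat.findGreatest_le N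
  have has : N - a ≤ s := Nat.le_findGreatest (Nat.sub_le N a) hbase
  have hschoose : s.choose (N - a) ≤ #𝓑 :=
    Nat.findGreatest_spec (P := fun s => s.choose (N - a) ≤ #𝓑) (Nat.sub_le N a) hbase
  have hkk : ∀ j ≤ N - a, s.choose j ≤ #{T : Finset (Fin n) | #T = j ∧ ∃ S ∈ 𝒜, T ⊆ S} :=
    fun j hj => choose_le_card_subsets hj has (hsN.trans hNn) hsz (hcard ▸ hschoose)
  have hM : s.choose (k - 1) ≤ #𝓜 := by
    refine (hkk (k - 1) (by lia)).trans (card_le_card fun T hT => ?_)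
    simp only [mem_filter, mem_univ, true_and, h𝒜, mem_image] at hT
    obtain ⟨hT, _, ⟨B, hB, rfl⟩, hTB⟩ := hT
    exact h𝓜 T (hTB.trans sdiff_subset) hT ⟨B, hB, (disjoint_sdiff.mono_right hTB)⟩
  have hmid : (s.choose (s / 2) : ℝ) ≤ η * 2 ^ N := by
    have h1 : (#{T : Finset (Fin n) | #T = s / 2 ∧ ∃ S ∈ 𝒜, T ⊆ S} : ℝ) ≤
        (density Y fun S => ∃ B ∈ 𝓑, B ⊆ S) * 2 ^ N := by
      rw [← density_compl, density_mul_two_pow]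
      refine Nat.cast_le.2 (card_le_card fun T hT => ?_)
      simp only [mem_filter, mem_univ, true_and, h𝒜, mem_image] at hT
      obtain ⟨-, _, ⟨B, hB, rfl⟩, hTB⟩ := hT
      simp only [mem_filter, mem_powerset]
      refine ⟨hTB.trans sdiff_subset, B, hB, fun x hx => ?_⟩
      exact mem_sdiff.2 ⟨(h𝓑 B hB).1 hx, fun hxT => (mem_sdiff.1 (hTB hxT)).2 hx⟩
    calc (s.choose (s / 2) : ℝ) ≤ _ := Nat.cast_le.2 (hkk (s / 2) (by lia))
      _ ≤ _ := h1
      _ ≤ _ := by gcongr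
  have hpow : (2 : ℝ) ^ s ≤ (n + 1) * (η * 2 ^ N) := by
    have h1 : 2 ^ s ≤ (s + 1) * s.choose (s / 2) := by
      rw [← Nat.sum_range_choose]
      simpa using sum_le_card_nsmul (range (s + 1)) (fun m => s.choose m) _
        fun m _ => Nat.choose_le_middle m s
    calc (2 : ℝ) ^ s ≤ (s + 1) * s.choose (s / 2) := by exact_mod_cast h1
      _ ≤ (n + 1) * (η * 2 ^ N) := by
          have : (s : ℝ) ≤ n := by exact_mod_cast hsN.trans hNn
          gcongr
  obtain ⟨ht2, ht⟩ := hlarge (N - s) (by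
    have h1 : (2 : ℝ) ^ N = 2 ^ (N - s) * 2 ^ s := by rw [← pow_add, Nat.sub_add_cancel hsN]
    rw [h1] at hpow
    refine le_of_mul_le_mul_right ?_ (show (0 : ℝ) < 2 ^ s by positivity)
    linarith)
  have hgt : #𝓑 < (s + 1).choose (N - a) := by
    by_contra hcon
    have := Nat.le_findGreatest (P := fun s => s.choose (N - a) ≤ #𝓑)
      (show s + 1 ≤ N by lia) (not_lt.1 hcon)
    rw [← hs] at this
    lia
  have hfin := mul_choose_le_choose (r := r) hk hak hY ht2 (Nat.sub_le N s) ht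
  rw [Nat.sub_sub_self hsN] at hfin
  exact (Nat.mul_le_mul_left r hgt.le).trans (hfin.trans hM)

end Growth

section Structure

variable {n k r : ℕ}

/-- No member of `𝓕` is contained in `S`. -/
def Avoids (𝓕 : Finset (Finset (Fin n))) (S : Finset (Fin n)) : Prop :=
  ∀ T ∈ 𝓕, ¬ T ⊆ S

theorem antitone_avoids (𝓕 : Finset (Finset (Fin n))) : Antitone (Avoids 𝓕) :=
  fun _ _ h hS T hT hTS => hS T hT (hTS.trans h)

theorem Intersecting'.one_le_density_add_density {𝓕 : Finset (Finset (Fin n))}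
    (h𝓕 : Intersecting' 𝓕) {s : Finset (Fin n)} {A B : Finset (Fin n)} (hAB : Disjoint A B)
    (hA : Disjoint A s) (hB : Disjoint B s) :
    1 ≤ (density s fun S => Avoids 𝓕 (A ∪ S)) + density s fun S => Avoids 𝓕 (B ∪ S) := by
  refine _root_.one_le_density_add_density fun S hS => ?_
  by_contra hcon
  simp only [Avoids, not_or, not_forall, not_not] at hcon
  obtain ⟨⟨T, hT, hTS⟩, U, hU, hUS⟩ := hcon
  obtain ⟨x, hx⟩ := h𝓕 T hT U hU
  have hx1 := hTS (mem_inter.1 hx).1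
  have hx2 := hUS (mem_inter.1 hx).2
  rw [disjoint_left] at hAB hA hB
  simp only [mem_union, mem_sdiff] at hx1 hx2
  have := @hS x
  have := @hAB x
  have := @hA x
  have := @hB x
  tauto

theorem one_half_pow_le_density_avoids {Fs : Fin r → Finset (Finset (Fin n))}
    (hFs : ∀ j, Intersecting' (Fs j)) :
    (1 / 2 : ℝ) ^ r ≤ density univ fun S => ∀ j ∈ univ, Avoids (Fs j) S := by
  refine le_trans ?_ (prod_density_le univ univ fun j => antitone_avoids (Fs j))
  have h : ∀ j, (1 / 2 : ℝ) ≤ density univ (Avoids (Fs j)) := fun j => by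
    have := (hFs j).one_le_density_add_density (s := univ) (disjoint_empty_left ∅)
      (disjoint_empty_left _) (disjoint_empty_left _)
    simp only [empty_union] at this
    linarith
  calc (1 / 2 : ℝ) ^ r = ∏ _j : Fin r, (1 / 2 : ℝ) := by simp
    _ ≤ _ := prod_le_prod (fun _ _ => by norm_num) fun j _ => h j

/-- Each point of `R` is the centre of one of the families, and distinct points are centres of
distinct families. -/
theorem exists_centers (hr : 0 < r) {Fs : Fin r → Finset (Finset (Fin n))}
    (hFs : ∀ j, Intersecting' (Fs j)) {R : Finset (Fin n)} {η : ℝ} (hη0 : 0 ≤ η) (hη : η < 1 / 2)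
    (hR : ∀ i ∈ R,
      (density (univ \ R) fun S => ∀ j ∈ univ, Avoids (Fs j) (insert i S)) < η ^ r) :
    ∃ c : Fin n → Fin r, Set.InjOn c R ∧ ∀ i ∈ R, ∀ i' ∈ R, i' ≠ i →
      1 - η ≤ density (univ \ R) fun S => Avoids (Fs (c i)) (insert i' S) := by
  have hcross : ∀ j, ∀ i ∈ R, ∀ i' ∈ R, i' ≠ i →
      1 ≤ (density (univ \ R) fun S => Avoids (Fs j) (insert i S)) +
        density (univ \ R) fun S => Avoids (Fs j) (insert i' S) := by
    intro j i hi i' hi' hne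
    have := (hFs j).one_le_density_add_density (s := univ \ R) (A := {i}) (B := {i'})
      (by simpa using hne.symm) (by simpa using hi) (by simpa using hi')
    simpa only [singleton_union] using this
  have hex : ∀ i ∈ R, ∃ j,
      (density (univ \ R) fun S => Avoids (Fs j) (insert i S)) < η := by
    intro i hi
    by_contra! hcon
    have h1 := prod_density_le univ (univ \ R)
      fun j => (antitone_avoids (Fs j)).comp_insert i
    have h2 : η ^ r ≤
        ∏ j : Fin r, density (univ \ R) fun S => Avoids (Fs j) (insert i S) := by
      calc η ^ r = ∏ _j : Fin r, η := by simp
        _ ≤ _ := prod_le_prod (fun _ _ => hη0) fun j _ => hcon j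
    exact absurd (h2.trans h1) (not_le.2 (hR i hi))
  have : Nonempty (Fin r) := ⟨⟨0, hr⟩⟩
  choose! c hc using hex
  refine ⟨c, fun i hi i' hi' h => ?_, fun i hi i' hi' hne => ?_⟩
  · by_contra hne
    have h1 := hcross (c i) i hi i' hi' (Ne.symm hne)
    have h2 := hc i hi
    have h3 := hc i' hi'
    rw [← h] at h3
    linarith
  · linarith [hcross (c i) i hi i' hi' hne, hc i hi]

theorem card_filter_not_subset_sdiff (R : Finset (Fin n)) :
    #{S ∈ powersetCard k univ | ¬ S ⊆ univ \ R} = n.choose k - (n - #R).choose k := by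
  have h : #{S ∈ powersetCard k univ | S ⊆ univ \ R} = (n - #R).choose k := by
    have h' : ({S ∈ powersetCard k univ | S ⊆ univ \ R} : Finset (Finset (Fin n))) =
        powersetCard k (univ \ R) := by
      ext S
      simp [mem_powersetCard, and_comm]
    rw [h', card_powersetCard, ← compl_eq_univ_sdiff, card_compl, Fintype.card_fin]
  have h2 := card_filter_add_card_filter_not (s := powersetCard k (univ : Finset (Fin n)))
    fun S => S ⊆ univ \ R
  rw [card_powersetCard, card_univ, Fintype.card_fin] at h2
  lia

/-- If each `𝓖 i` misses many `k`-sets of the star at `i`, compared to the number of its members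
which avoid `R` and to the number of its members which meet `R` in a single other point, then the
union of the families is no larger than the union of the stars at the points of `R`. -/
theorem card_biUnion_le_of_mul_card_le {R : Finset (Fin n)} {𝓖 : Fin n → Finset (Finset (Fin n))}
    (hk : 1 ≤ k) (h𝓖 : ∀ i ∈ R, ∀ S ∈ 𝓖 i, #S = k)
    (hB : ∀ i ∈ R, #R * #{S ∈ 𝓖 i | S ⊆ univ \ R} ≤
      #{T ∈ powersetCard (k - 1) (univ \ R) | insert i T ∉ 𝓖 i})
    (hP : ∀ i ∈ R, ∀ i' ∈ R, i' ≠ i →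
      #R * #{T ∈ powersetCard (k - 1) (univ \ R) | insert i' T ∈ 𝓖 i} ≤
        #{T ∈ powersetCard (k - 1) (univ \ R) | insert i T ∉ 𝓖 i}) :
    #(R.biUnion 𝓖) ≤ n.choose k - (n - #R).choose k := by
  rcases R.eq_empty_or_nonempty with rfl | hne
  · simp
  rw [← card_filter_not_subset_sdiff R]
  set Y := univ \ R with hY
  set St : Finset (Finset (Fin n)) := {S ∈ powersetCard k univ | ¬ S ⊆ Y} with hSt
  set L := powersetCard (k - 1) Y with hL
  set M : Fin n → Finset (Finset (Fin n)) := fun i => {T ∈ L | insert i T ∉ 𝓖 i} with hM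
  set P : Fin n → Fin n → Finset (Finset (Fin n)) :=
    fun i i' => {T ∈ L | insert i' T ∈ 𝓖 i} with hPdef
  set B : Fin n → Finset (Finset (Fin n)) := fun i => {S ∈ 𝓖 i | S ⊆ Y} with hBdef
  have hRpos : 0 < #R := hne.card_pos
  have hinside : #{S ∈ R.biUnion 𝓖 | S ⊆ Y} ≤ ∑ i ∈ R, #(B i) := by
    rw [filter_biUnion]
    exact card_biUnion_le
  have hoff : ∀ T ∈ L, ∀ i ∈ R, ∀ i' ∈ R, i' ∈ insert i T → i' = i := by
    intro T hT i hi i' hi' h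
    refine (mem_insert.1 h).resolve_right fun h' => ?_
    exact (mem_sdiff.1 ((mem_powersetCard.1 hT).1 h')).2 hi'
  have hnot : ∀ T ∈ L, ∀ i ∈ R, i ∉ T := by
    intro T hT i hi h'
    exact (mem_sdiff.1 ((mem_powersetCard.1 hT).1 h')).2 hi
  set Q : Fin n → Finset (Finset (Fin n)) :=
    fun i => M i \ (R.erase i).biUnion fun i' => P i' i with hQ
  have hQL : ∀ i, Q i ⊆ L := fun i => sdiff_subset.trans (filter_subset _ _)
  have hmissing : ∑ i ∈ R, #(Q i) ≤ #(St \ R.biUnion 𝓖) := by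
    have h1 : ∀ i ∈ R, #((Q i).image (insert i)) = #(Q i) := by
      intro i hi
      refine card_image_of_injOn fun T hT U hU h => ?_
      rw [← erase_insert (hnot T (hQL i hT) i hi), ← erase_insert (hnot U (hQL i hU) i hi)]
      exact congrArg (fun S => S.erase i) h
    rw [← sum_congr rfl h1, ← card_biUnion]
    · refine card_le_card fun S hS => ?_
      simp only [mem_biUnion, mem_image] at hS
      obtain ⟨i, hi, T, hT, rfl⟩ := hS
      have hTL := hQL i hT
      have hTc := (mem_powersetCard.1 hTL).2
      simp only [hQ, hM, hPdef, mem_sdiff, mem_filter, mem_biUnion, mem_erase, not_exists,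
        not_and] at hT
      rw [mem_sdiff, hSt, mem_filter, mem_powersetCard, mem_biUnion]
      refine ⟨⟨⟨subset_univ _, ?_⟩, fun h => ?_⟩, ?_⟩
      · rw [card_insert_of_notMem (hnot T hTL i hi), hTc]
        lia
      · exact (mem_sdiff.1 (h (mem_insert_self i T))).2 hi
      · rintro ⟨i', hi', h⟩
        by_cases hii : i' = i
        · subst hii
          exact hT.1.2 h
        · exact hT.2 i' ⟨hii, hi'⟩ hTL h
    · intro i hi i' hi' hii
      refine disjoint_left.2 fun S hS hS' => hii ?_
      obtain ⟨T, hT, rfl⟩ := mem_image.1 hS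
      obtain ⟨U, hU, h⟩ := mem_image.1 hS'
      exact hoff U (hQL i' hU) i' hi' i hi (h ▸ mem_insert_self i T)
  have hQcard : ∀ i, #(M i) ≤ #(Q i) + ∑ i' ∈ R.erase i, #(P i' i) := by
    intro i
    have h1 : #(M i) ≤ #(Q i) + #((R.erase i).biUnion fun i' => P i' i) := by
      have := le_card_sdiff ((R.erase i).biUnion fun i' => P i' i) (M i)
      rw [hQ]
      lia
    exact h1.trans (Nat.add_le_add_left card_biUnion_le _)
  have hswap : ∑ i ∈ R, ∑ i' ∈ R.erase i, #(P i' i) = ∑ i ∈ R, ∑ i' ∈ R.erase i, #(P i i') :=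
    sum_comm' fun i i' => by simp only [mem_erase]; tauto
  have hMsum : ∑ i ∈ R, #(M i) ≤
      ∑ i ∈ R, #(Q i) + ∑ i ∈ R, ∑ i' ∈ R.erase i, #(P i i') := by
    rw [← hswap, ← sum_add_distrib]
    exact sum_le_sum fun i _ => hQcard i
  have hrow : ∀ i ∈ R, #R * (#(B i) + ∑ i' ∈ R.erase i, #(P i i')) ≤ #R * #(M i) := by
    intro i hi
    have h1 : #R * ∑ i' ∈ R.erase i, #(P i i') ≤ (#R - 1) * #(M i) := by
      rw [mul_sum, ← card_erase_of_mem hi, ← smul_eq_mul]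
      refine sum_le_card_nsmul _ _ _ fun i' hi' => ?_
      exact hP i hi i' (mem_of_mem_erase hi') (ne_of_mem_erase hi')
    calc #R * (#(B i) + ∑ i' ∈ R.erase i, #(P i i'))
        ≤ #(M i) + (#R - 1) * #(M i) := by
          rw [mul_add]
          exact Nat.add_le_add (hB i hi) h1
      _ = (1 + (#R - 1)) * #(M i) := by ring
      _ = #R * #(M i) := by rw [Nat.add_sub_cancel' hRpos]
  have hBsum : ∑ i ∈ R, #(B i) + ∑ i ∈ R, ∑ i' ∈ R.erase i, #(P i i') ≤ ∑ i ∈ R, #(M i) := by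
    rw [← sum_add_distrib]
    exact sum_le_sum fun i hi => Nat.le_of_mul_le_mul_left (hrow i hi) hRpos
  have houtside : #{S ∈ R.biUnion 𝓖 | ¬ S ⊆ Y} + #(St \ R.biUnion 𝓖) ≤ #St := by
    rw [add_comm, ← card_sdiff_add_card_inter St (R.biUnion 𝓖)]
    refine Nat.add_le_add_left (card_le_card fun S hS => ?_) _
    obtain ⟨hS, hSY⟩ := mem_filter.1 hS
    obtain ⟨i, hi, hSi⟩ := mem_biUnion.1 hS
    rw [mem_inter, hSt, mem_filter, mem_powersetCard]
    exact ⟨⟨⟨subset_univ S, h𝓖 i hi S hSi⟩, hSY⟩, hS⟩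
  have hsplit := card_filter_add_card_filter_not (s := R.biUnion 𝓖) fun S => S ⊆ Y
  lia

theorem card_biUnion_le_of_subcube (hr : 0 < r) (hk : 1 ≤ k)
    {Fs : Fin r → Finset (Finset (Fin n))} (hFs : ∀ j, Intersecting' (Fs j))
    (hcard : ∀ j, ∀ S ∈ Fs j, #S = k) {R : Finset (Fin n)} (hRr : #R = r)
    (hY : 2 * k + 2 ≤ #(univ \ R)) {η : ℝ} (hη0 : 0 ≤ η) (hη : η < 1 / 2)
    (hone : 1 - η ≤ density (univ \ R) fun S => ∀ j ∈ univ, Avoids (Fs j) S)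
    (hR : ∀ i ∈ R,
      (density (univ \ R) fun S => ∀ j ∈ univ, Avoids (Fs j) (insert i S)) < η ^ r)
    (hlarge : ∀ t : ℕ, 1 ≤ (n + 1) * η * 2 ^ t →
      2 ≤ t ∧ (4 * r * (k + 1) : ℝ) ≤ (t - 2) * (#(univ \ R) - 2 * k)) :
    #(univ.biUnion Fs) ≤ n.choose k - (n - r).choose k := by
  obtain ⟨c, hinj, hc⟩ := exists_centers hr hFs hη0 hη hR
  have himage : R.image c = univ := by
    rw [← card_eq_iff_eq_univ, card_image_of_injOn hinj, hRr, Fintype.card_fin]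
  rw [show univ.biUnion Fs = R.biUnion fun i => Fs (c i) by rw [← himage, image_biUnion], ← hRr]
  refine card_biUnion_le_of_mul_card_le hk (fun i _ => hcard (c i)) (fun i hi => ?_)
    fun i hi i' hi' hne => ?_
  · rw [hRr]
    refine mul_card_le_card_of_sparse (a := k) (n := n) (η := η) hk le_rfl hY ?_ ?_ ?_ hlarge
    · intro B hB
      exact ⟨(mem_filter.1 hB).2, hcard _ B (mem_filter.1 hB).1⟩
    · have h1 := density_add_density_not (univ \ R) (Avoids (Fs (c i)))
      have h2 : (density (univ \ R) fun S => ∀ j ∈ univ, Avoids (Fs j) S) ≤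
          density (univ \ R) (Avoids (Fs (c i))) := density_mono fun S _ h => h _ (mem_univ _)
      refine le_trans (density_mono (E := fun S => ¬ Avoids (Fs (c i)) S) ?_)
        (by linarith)
      rintro S - ⟨B, hB, hBS⟩ h
      exact h B (mem_filter.1 hB).1 hBS
    · rintro T hT hTk ⟨B, hB, hBT⟩
      obtain ⟨hB, hBY⟩ := mem_filter.1 hB
      refine mem_filter.2 ⟨mem_powersetCard.2 ⟨hT, hTk⟩, fun h => ?_⟩
      obtain ⟨x, hx⟩ := hFs (c i) B hB _ h
      obtain ⟨hxB, hxT⟩ := mem_inter.1 hx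
      rcases mem_insert.1 hxT with rfl | hxT
      · exact (mem_sdiff.1 (hBY hxB)).2 hi
      · exact disjoint_left.1 hBT hxB hxT
  · rw [hRr]
    refine mul_card_le_card_of_sparse (a := k - 1) (n := n) (η := η) hk (Nat.sub_le k 1) hY
      ?_ ?_ ?_ hlarge
    · intro B hB
      exact mem_powersetCard.1 (mem_filter.1 hB).1
    · have h1 := density_add_density_not (univ \ R) fun S => Avoids (Fs (c i)) (insert i' S)
      have h2 := hc i hi i' hi' hne
      refine le_trans (density_mono (E := fun S => ¬ Avoids (Fs (c i)) (insert i' S)) ?_)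
        (by linarith)
      rintro S - ⟨B, hB, hBS⟩ h
      exact h _ (mem_filter.1 hB).2 (insert_subset_insert i' hBS)
    · rintro T hT hTk ⟨B, hB, hBT⟩
      obtain ⟨hBL, hB⟩ := mem_filter.1 hB
      have hBY := (mem_powersetCard.1 hBL).1
      refine mem_filter.2 ⟨mem_powersetCard.2 ⟨hT, hTk⟩, fun h => ?_⟩
      obtain ⟨x, hx⟩ := hFs (c i) _ hB _ h
      obtain ⟨hxB, hxT⟩ := mem_inter.1 hx
      rcases mem_insert.1 hxT with rfl | hxT
      · exact (mem_sdiff.1 (hBY ((mem_insert.1 hxB).resolve_left hne.symm))).2 hi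
      · rcases mem_insert.1 hxB with rfl | hxB
        · exact (mem_sdiff.1 (hT hxT)).2 hi'
        · exact disjoint_left.1 hBT hxB hxT

open Classical in
/-- If the union is too large then the predicate of avoiding it is so close to being extremal
in the edge-isoperimetric inequality that the stability of the latter applies. -/
theorem card_biUnion_le_of_lowerTail_le (hr : 0 < r) (hk : 1 ≤ k)
    (hn : 2 * k + 2 + r ≤ n) {Fs : Fin r → Finset (Finset (Fin n))}
    (hFs : ∀ j, Intersecting' (Fs j)) (hcard : ∀ j, ∀ S ∈ Fs j, #S = k)
    {η : ℝ} (hη0 : 0 ≤ η) (hη : η < 1 / 2)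
    (hτ : 16 * (n + 1) * 6 ^ r * ((4 * n + 2) * lowerTail n k) < 1)
    (hτη : 6 ^ r * ((4 * n + 2) * lowerTail n k) < η ^ r)
    (hlarge : ∀ t : ℕ, 1 ≤ (n + 1) * η * 2 ^ t →
      2 ≤ t ∧ (4 * r * (k + 1) : ℝ) ≤ (t - 2) * (n - r - 2 * k)) :
    #(univ.biUnion Fs) ≤ n.choose k - (n - r).choose k := by
  by_contra! hcon
  set D : Finset (Fin n) → Prop := fun S => ∀ j ∈ univ, Avoids (Fs j) S with hDdef
  have hD : Antitone D := fun S T h hT j hj => antitone_avoids (Fs j) h (hT j hj)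
  have hlt : #{S : Finset (Fin n) | #S = k ∧ D S} < (n - r).choose k := by
    have h1 : #{S : Finset (Fin n) | #S = k ∧ D S} + #(univ.biUnion Fs) ≤ n.choose k := by
      rw [← card_union_of_disjoint]
      · calc _ ≤ #(powersetCard k (univ : Finset (Fin n))) := by
              refine card_le_card fun S hS => mem_powersetCard.2 ⟨subset_univ S, ?_⟩
              rcases mem_union.1 hS with hS | hS
              · exact (mem_filter.1 hS).2.1
              · obtain ⟨j, -, hj⟩ := mem_biUnion.1 hS
                exact hcard j S hj
          _ = n.choose k := by rw [card_powersetCard, card_univ, Fintype.card_fin]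
      · refine disjoint_left.2 fun S hS hS' => ?_
        obtain ⟨j, -, hj⟩ := mem_biUnion.1 hS'
        exact (mem_filter.1 hS).2.2 j (mem_univ j) S hj Subset.rfl
    have h2 : (n - r).choose k ≤ n.choose k := Nat.choose_le_choose k (Nat.sub_le n r)
    lia
  have hdens := one_half_pow_le_density_avoids hFs
  have hT := lowerTail_nonneg n k
  obtain ⟨hup, hdef⟩ := density_le_and_isoDeficiency_le (k := k) (r := r) hD (by lia) (by lia)
    (by convert hlt) hdens
  have habs : |density univ D - (1 / 2) ^ r| ≤ (4 * n + 2) * lowerTail n k := by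
    rw [abs_of_nonneg (sub_nonneg.2 hdens)]
    have : 0 ≤ (n : ℝ) * lowerTail n k := by positivity
    linarith
  obtain ⟨R, -, hRr, hR1, hR2⟩ := exists_subcube_of_isoDeficiency_le r univ hD hdef habs
    (by rwa [card_univ, Fintype.card_fin])
  have hYcard : #(univ \ R) = n - r := by
    rw [← compl_eq_univ_sdiff, card_compl, Fintype.card_fin, hRr]
  have hηr : η ^ r ≤ η := pow_le_of_le_one hη0 (by linarith) hr.ne'
  refine absurd (card_biUnion_le_of_subcube hr hk hFs hcard hRr (by lia) hη0 hη (by linarith)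
    (fun i hi => (hR2 i hi).trans_lt hτη) ?_) (not_le.2 hcon)
  rwa [hYcard, Nat.cast_sub (by lia)]

end Structure

section Numerics

theorem exists_forall_pow_le_exp (m : ℕ) {b c : ℝ} (hb : 0 < b) (hc : 0 < c) :
    ∃ K : ℝ, ∀ y ≥ K, y ^ m ≤ c * Real.exp (b * y) := by
  obtain ⟨K, hK⟩ := Filter.eventually_atTop.1
    ((isLittleO_pow_exp_pos_mul_atTop m hb).bound hc)
  refine ⟨K, fun y hy => (le_abs_self _).trans ?_⟩
  simpa only [Real.norm_eq_abs, Real.abs_exp] using hK y hy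

theorem mul_sq_le_cube {n k K : ℝ} (hk : 1 ≤ k) (hK : 1 ≤ K)
    (h : 2 * k + 9 * K * k ^ ((2 : ℝ) / 3) ≤ n) : K * n ^ 2 ≤ (n - 2 * k) ^ 3 := by
  set d := n - 2 * k with hd
  have hx1 : 1 ≤ k ^ ((2 : ℝ) / 3) := Real.one_le_rpow hk (by norm_num)
  have hx3 : (k ^ ((2 : ℝ) / 3)) ^ 3 = k ^ 2 := by
    rw [← Real.rpow_natCast, ← Real.rpow_mul (by linarith)]
    norm_num
  set x := k ^ ((2 : ℝ) / 3) with hx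
  have hdx : 9 * K * x ≤ d := by linarith
  have hn : n = 2 * k + d := by rw [hd]; ring
  have hKx : K ≤ K * x := le_mul_of_one_le_right (by linarith) hx1
  rcases le_total d k with hdk | hdk
  · calc K * n ^ 2 ≤ K * (3 * k) ^ 2 := by gcongr; linarith; linarith
      _ = 9 * K * x ^ 3 := by rw [hx3]; ring
      _ ≤ (9 * K) ^ 3 * x ^ 3 := by
          gcongr
          exact le_self_pow₀ (by linarith) (by norm_num)
      _ = (9 * K * x) ^ 3 := by ring
      _ ≤ d ^ 3 := by gcongr
  · calc K * n ^ 2 ≤ K * (3 * d) ^ 2 := by gcongr; linarith; linarith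
      _ = (9 * K) * d ^ 2 := by ring
      _ ≤ d * d ^ 2 := by gcongr; linarith
      _ = d ^ 3 := by ring

end Numerics

theorem union_of_intersecting_families_bound :
    ∀ r : ℕ, 2 ≤ r → ∃ C : ℝ, 0 < C ∧
      ∀ n k : ℕ, 0 < n → 0 < k →
      (n : ℝ) ≥ 2 * k + C * (k : ℝ) ^ ((2 : ℝ) / 3) →
      ∀ F : Finset (Finset (Fin n)), (∀ S ∈ F, S.card = k) →
      (∃ Fs : Fin r → Finset (Finset (Fin n)),
        (∀ i, Intersecting' (Fs i)) ∧ F = Finset.univ.biUnion Fs) →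
      F.card ≤ Nat.choose n k - Nat.choose (n - r) k := by
  intro r hr
  have hr0 : (2 : ℝ) ≤ r := by exact_mod_cast hr
  obtain ⟨K₁, hK₁⟩ := exists_forall_pow_le_exp 6 (b := 1 / 2) (c := 1 / (384 * 6 ^ r))
    (by norm_num) (by positivity)
  obtain ⟨K₂, hK₂⟩ := exists_forall_pow_le_exp 3 (b := 1 / 4) (c := 1 / (12 * 6 ^ r))
    (by norm_num) (by positivity)
  obtain ⟨K₃, hK₃⟩ := exists_forall_pow_le_exp 3 (b := 1 / (8 * r)) (c := 1 / 2)
    (by positivity) (by norm_num)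
  set K : ℝ := max (max (max K₁ K₂) K₃) (128 * r ^ 2) with hKdef
  have hKr : 128 * (r : ℝ) ^ 2 ≤ K := le_max_right _ _
  have hKr' : 256 * (r : ℝ) ≤ K := by nlinarith
  refine ⟨9 * K, by linarith, ?_⟩
  rintro n k hn hk hnk F hF ⟨Fs, hFs, rfl⟩
  have hn1 : (1 : ℝ) ≤ n := by exact_mod_cast hn
  have hk1 : (1 : ℝ) ≤ k := by exact_mod_cast hk
  have hcube := mul_sq_le_cube (n := n) hk1 (by linarith) hnk
  set d : ℝ := n - 2 * k with hd
  have hdn : d ≤ n := by linarith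
  have hd0 : 0 < d := by
    have := Real.rpow_pos_of_pos (show (0 : ℝ) < k by linarith) (2 / 3)
    have : 0 < 9 * K * (k : ℝ) ^ ((2 : ℝ) / 3) := by
      have : 0 < K := by linarith
      positivity
    linarith
  set y : ℝ := d ^ 2 / n with hy
  have hyd : y * d = d ^ 3 / n := by rw [hy]; ring
  have hKnyd : K * n ≤ y * d := by
    rw [hyd, le_div_iff₀ (by linarith)]
    linarith
  have hy0 : 0 < y := by positivity
  have hKy : K ≤ y := by
    refine le_of_mul_le_mul_right (a := (n : ℝ)) ?_ (by linarith)
    exact hKnyd.trans (by gcongr)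
  have hyd' : y ≤ d := by
    rw [hy, div_le_iff₀ (by linarith), sq]
    gcongr
  have hny : (n : ℝ) ≤ y ^ 3 := by
    have h1 : y ^ 3 = (y * d) ^ 2 / n := by rw [hy]; field_simp
    rw [h1, le_div_iff₀ (by linarith), ← sq]
    refine pow_le_pow_left₀ (by linarith) (le_trans ?_ hKnyd) 2
    exact le_mul_of_one_le_left (by linarith) (by linarith)
  have hn2k : 2 * k + 2 + r ≤ n := by
    have : (2 * k + 2 + r : ℝ) ≤ n := by linarith
    exact_mod_cast this
  have hE₁ := hK₁ y ((((le_max_left _ _).trans (le_max_left _ _)).trans (le_max_left _ _)).trans hKy)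
  have hE₂ := hK₂ y ((((le_max_right _ _).trans (le_max_left _ _)).trans (le_max_left _ _)).trans hKy)
  have hE₃ := hK₃ y (((le_max_right _ _).trans (le_max_left _ _)).trans hKy)
  have hT0 := lowerTail_nonneg n k
  have hT : lowerTail n k ≤ Real.exp (-(y / 2)) := by
    have := lowerTail_le_exp hn (show 2 * k ≤ n by lia)
    rwa [neg_div] at this
  have h6 : (0 : ℝ) < 6 ^ r := by positivity
  have hη : Real.exp (-(y / (4 * r))) < 1 / 2 := by
    have h1 : 64 ≤ y / (4 * r) := by
      rw [le_div_iff₀ (by linarith)]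
      linarith
    have h2 := Real.add_one_le_exp (y / (4 * r))
    rw [Real.exp_neg, inv_lt_comm₀ (Real.exp_pos _) (by norm_num)]
    linarith
  refine card_biUnion_le_of_lowerTail_le (η := Real.exp (-(y / (4 * r)))) (by lia) hk hn2k hFs
    (fun j S hS => hF S (mem_biUnion.2 ⟨j, mem_univ j, hS⟩)) (Real.exp_pos _).le hη ?_ ?_ ?_
  · calc 16 * ((n : ℝ) + 1) * 6 ^ r * ((4 * n + 2) * lowerTail n k)
        ≤ 16 * (2 * y ^ 3) * 6 ^ r * ((6 * y ^ 3) * Real.exp (-(y / 2))) := by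
          gcongr <;> linarith
      _ = 192 * 6 ^ r * y ^ 6 * Real.exp (-(y / 2)) := by ring
      _ ≤ 192 * 6 ^ r * (1 / (384 * 6 ^ r) * Real.exp (1 / 2 * y)) * Real.exp (-(y / 2)) := by
          gcongr
      _ = 1 / 2 * (Real.exp (1 / 2 * y) * Real.exp (-(y / 2))) := by field_simp; norm_num
      _ < 1 := by
          rw [← Real.exp_add, show 1 / 2 * y + -(y / 2) = 0 by ring, Real.exp_zero]
          norm_num
  · rw [← Real.exp_nat_mul, show (r : ℝ) * -(y / (4 * r)) = -(y / 4) by field_simp]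
    calc 6 ^ r * ((4 * (n : ℝ) + 2) * lowerTail n k)
        ≤ 6 ^ r * ((6 * y ^ 3) * Real.exp (-(y / 2))) := by
          gcongr; linarith
      _ ≤ 6 ^ r * ((6 * (1 / (12 * 6 ^ r) * Real.exp (1 / 4 * y))) * Real.exp (-(y / 2))) := by
          gcongr
      _ = 1 / 2 * (Real.exp (1 / 4 * y) * Real.exp (-(y / 2))) := by field_simp; norm_num
      _ = 1 / 2 * Real.exp (-(y / 4)) := by rw [← Real.exp_add]; ring_nf
      _ < Real.exp (-(y / 4)) := by linarith [Real.exp_pos (-(y / 4))]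
  · intro t ht
    have hyt : y / (8 * r) ≤ t := by
      have h2t : (2 : ℝ) ^ t ≤ Real.exp t := by
        rw [← mul_one (t : ℝ), Real.exp_nat_mul]
        gcongr
        linarith [Real.add_one_le_exp 1]
      have h1 : 1 ≤ Real.exp (1 / (8 * r) * y) * Real.exp (-(y / (4 * r))) * Real.exp t := by
        refine ht.trans ?_
        gcongr
        linarith
      rw [← Real.exp_add, ← Real.exp_add, Real.one_le_exp_iff] at h1
      have h2 : 1 / (8 * r) * y + -(y / (4 * r)) = -(y / (8 * r)) := by
        field_simp
        norm_num
      linarith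
    have hy32 : 32 ≤ y / (8 * r) := by
      rw [le_div_iff₀ (by linarith)]
      linarith
    refine ⟨by exact_mod_cast (show (2 : ℝ) ≤ t by linarith), ?_⟩
    have hk1n : (k + 1 : ℝ) ≤ n := by exact_mod_cast (show k + 1 ≤ n by lia)
    calc (4 * r * (k + 1) : ℝ) ≤ 4 * r * n := by gcongr
      _ = 128 * r ^ 2 * n / (32 * r) := by field_simp; norm_num
      _ ≤ K * n / (32 * r) := by gcongr
      _ ≤ y * d / (32 * r) := by gcongr
      _ = (y / (8 * r) / 2) * (d / 2) := by field_simp; norm_num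
      _ ≤ (t - 2) * (n - r - 2 * k) := by
          apply mul_le_mul <;> first | positivity | linarith
end

section
/- For each integer r ≥ 2, there exists a constant C = C(r) > 0 such that the following holds. Let n, k be positive integers with n ≥ 2k + C·k^{2/3}, and let F ⊆ {S ⊆ {1,...,n} : |S| = k} be a union of at most r intersecting families. If |F| = C(n,k) − C(n−r,k), then there exists a set R ⊆ {1,...,n} with |R| = r such that F = {S ⊆ {1,...,n} : |S| = k and S ∩ R ≠ ∅}. Here C(a,b) denotes the binomial coefficient 'a choose b'. -/
open Finset

section BiasedExpectation

variable {α : Type*} [DecidableEq α]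

/-- The expectation of `f` on a random subset of `l` containing each entry of `l` independently
with probability `p`. -/
def biasedExp (p : ℝ) : List α → (Finset α → ℝ) → ℝ
  | [], f => f ∅
  | a :: l, f => (1 - p) * biasedExp p l f + p * biasedExp p l (fun S => f (insert a S))

/-- The expectation of `f S * g T` over a random pair of disjoint subsets of `l`: each entry of `l`
is placed in `S` only, in `T` only, or in neither, with probabilities `p`, `p`, `1 - 2 * p`. -/
def disjointExp (p : ℝ) : List α → (Finset α → ℝ) → (Finset α → ℝ) → ℝ
  | [], f, g => f ∅ * g ∅
  | a :: l, f, g => (1 - 2 * p) * disjointExp p l f g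
      + p * disjointExp p l (fun S => f (insert a S)) g
      + p * disjointExp p l f (fun S => g (insert a S))

lemma biasedExp_linear (p : ℝ) (l : List α) (c d : ℝ) (f g : Finset α → ℝ) :
    biasedExp p l (fun S => c * f S + d * g S) = c * biasedExp p l f + d * biasedExp p l g := by
  induction l generalizing f g with
  | nil => rfl
  | cons a l ih =>
    simp only [biasedExp, ih]
    ring

lemma disjointExp_linear_left (p : ℝ) (l : List α) (c d : ℝ) (f g h : Finset α → ℝ) :
    disjointExp p l (fun S => c * f S + d * g S) h
      = c * disjointExp p l f h + d * disjointExp p l g h := by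
  induction l generalizing f g h with
  | nil => simp only [disjointExp]; ring
  | cons a l ih =>
    simp only [disjointExp, ih]
    ring

lemma disjointExp_linear_right (p : ℝ) (l : List α) (c d : ℝ) (f g h : Finset α → ℝ) :
    disjointExp p l h (fun S => c * f S + d * g S)
      = c * disjointExp p l h f + d * disjointExp p l h g := by
  induction l generalizing f g h with
  | nil => simp only [disjointExp]; ring
  | cons a l ih =>
    simp only [disjointExp, ih]
    ring

lemma biasedExp_mono {p : ℝ} (hp : 0 ≤ p) (hp1 : p ≤ 1) (l : List α) {f g : Finset α → ℝ}
    (hfg : ∀ S, f S ≤ g S) : biasedExp p l f ≤ biasedExp p l g := by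
  induction l generalizing f g with
  | nil => exact hfg _
  | cons a l ih =>
    simp only [biasedExp]
    have h1 := mul_le_mul_of_nonneg_left (ih hfg) (sub_nonneg.2 hp1)
    have h2 := mul_le_mul_of_nonneg_left (ih (fun S => hfg (insert a S))) hp
    linarith

lemma biasedExp_const (p : ℝ) (l : List α) (c : ℝ) : biasedExp p l (fun _ => c) = c := by
  induction l with
  | nil => rfl
  | cons a l ih => simp only [biasedExp, ih]; ring

lemma biasedExp_nonneg {p : ℝ} (hp : 0 ≤ p) (hp1 : p ≤ 1) (l : List α) {f : Finset α → ℝ}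
    (hf : ∀ S, 0 ≤ f S) : 0 ≤ biasedExp p l f := by
  simpa only [biasedExp_const] using biasedExp_mono hp hp1 l hf

/-- Splitting off the head coordinate: second moments. -/
lemma biasedExp_sq_cons (p : ℝ) (a : α) (l : List α) (f : Finset α → ℝ) :
    biasedExp p (a :: l) (fun S => f S ^ 2)
      = biasedExp p l (fun S => ((1 - p) * f S + p * f (insert a S)) ^ 2)
        + p * (1 - p) * biasedExp p l (fun S => (f (insert a S) - f S) ^ 2) := by
  have h := biasedExp_linear p l 1 (p * (1 - p))
    (fun S => ((1 - p) * f S + p * f (insert a S)) ^ 2) (fun S => (f (insert a S) - f S) ^ 2)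
  rw [one_mul] at h
  rw [← h, biasedExp, ← biasedExp_linear]
  congr 1
  funext S
  ring

/-- Splitting off the head coordinate: disjoint pairs. -/
lemma disjointExp_cons (p : ℝ) (a : α) (l : List α) (f : Finset α → ℝ) :
    disjointExp p (a :: l) f f
      = disjointExp p l (fun S => (1 - p) * f S + p * f (insert a S))
          (fun S => (1 - p) * f S + p * f (insert a S))
        - p ^ 2 * disjointExp p l (fun S => 1 * f (insert a S) + (-1) * f S)
          (fun S => 1 * f (insert a S) + (-1) * f S) := by
  simp only [disjointExp, disjointExp_linear_left, disjointExp_linear_right]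
  ring

lemma abs_disjointExp_le {p : ℝ} (hp : 0 ≤ p) (hp2 : 2 * p ≤ 1) (l : List α)
    (f g : Finset α → ℝ) :
    |disjointExp p l f g|
      ≤ (biasedExp p l (fun S => f S ^ 2) + biasedExp p l (fun S => g S ^ 2)) / 2 := by
  induction l generalizing f g with
  | nil =>
    simp only [disjointExp, biasedExp]
    rw [abs_le]
    constructor <;> nlinarith [sq_nonneg (f ∅ + g ∅), sq_nonneg (f ∅ - g ∅)]
  | cons a l ih =>
    simp only [disjointExp, biasedExp]
    have h0 := abs_le.1 (ih f g)
    have h1 := abs_le.1 (ih (fun S => f (insert a S)) g)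
    have h2 := abs_le.1 (ih f (fun S => g (insert a S)))
    have hq : 0 ≤ 1 - 2 * p := by linarith
    rw [abs_le]
    constructor
    · nlinarith [mul_le_mul_of_nonneg_left h0.1 hq, mul_le_mul_of_nonneg_left h1.1 hp,
        mul_le_mul_of_nonneg_left h2.1 hp]
    · nlinarith [mul_le_mul_of_nonneg_left h0.2 hq, mul_le_mul_of_nonneg_left h1.2 hp,
        mul_le_mul_of_nonneg_left h2.2 hp]

/-- The spectral gap of the disjointness operator. -/
lemma abs_disjointExp_sub_sq_le {p : ℝ} (hp : 0 ≤ p) (hp2 : 2 * p ≤ 1) (l : List α)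
    (f : Finset α → ℝ) :
    (1 - p) * |disjointExp p l f f - biasedExp p l f ^ 2|
      ≤ p * (biasedExp p l (fun S => f S ^ 2) - biasedExp p l f ^ 2) := by
  induction l generalizing f with
  | nil => simp [disjointExp, biasedExp, sq]
  | cons a l ih =>
    have hmean : biasedExp p (a :: l) f
        = biasedExp p l (fun S => (1 - p) * f S + p * f (insert a S)) := by
      rw [biasedExp, biasedExp_linear]
    rw [disjointExp_cons, biasedExp_sq_cons, hmean]
    have h0 := ih (fun S => (1 - p) * f S + p * f (insert a S))
    have h1 := abs_disjointExp_le hp hp2 l (fun S => 1 * f (insert a S) + (-1) * f S)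
      (fun S => 1 * f (insert a S) + (-1) * f S)
    have he : (fun S => (1 * f (insert a S) + (-1) * f S) ^ 2)
        = fun S => (f (insert a S) - f S) ^ 2 := by
      funext S; ring
    rw [he] at h1
    have hq : 0 ≤ 1 - p := by linarith
    set D := disjointExp p l (fun S => 1 * f (insert a S) + (-1) * f S)
      (fun S => 1 * f (insert a S) + (-1) * f S)
    set X := disjointExp p l (fun S => (1 - p) * f S + p * f (insert a S))
          (fun S => (1 - p) * f S + p * f (insert a S))
    set m := biasedExp p l (fun S => (1 - p) * f S + p * f (insert a S))
    have h2 : |X - p ^ 2 * D - m ^ 2| ≤ |X - m ^ 2| + p ^ 2 * |D| := by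
      have := abs_sub (X - m ^ 2) (p ^ 2 * D)
      rw [abs_mul, abs_of_nonneg (sq_nonneg p)] at this
      rwa [sub_right_comm] at this
    have h3 := mul_le_mul_of_nonneg_left h2 hq
    have h4 := mul_le_mul_of_nonneg_left h1 (mul_nonneg hq (sq_nonneg p))
    nlinarith

/-- If `f` is supported on an intersecting family, then the discrete derivative of `f` in the
head coordinate has small variance. -/
lemma variance_derivative_le {p : ℝ} (hp : 0 ≤ p) (hp2 : 2 * p ≤ 1) (a : α) (l : List α)
    (f : Finset α → ℝ) (h0 : disjointExp p (a :: l) f f = 0) :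
    p ^ 2 * (1 - 2 * p) * (biasedExp p l (fun S => (f (insert a S) - f S) ^ 2)
        - biasedExp p l (fun S => f (insert a S) - f S) ^ 2)
      ≤ p * biasedExp p (a :: l) (fun S => f S ^ 2) - biasedExp p (a :: l) f ^ 2 := by
  have hmean : biasedExp p (a :: l) f
      = biasedExp p l (fun S => (1 - p) * f S + p * f (insert a S)) := by
    rw [biasedExp, biasedExp_linear]
  rw [disjointExp_cons] at h0
  rw [biasedExp_sq_cons, hmean]
  have h1 := abs_disjointExp_sub_sq_le hp hp2 l (fun S => (1 - p) * f S + p * f (insert a S))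
  have h2 := abs_disjointExp_sub_sq_le hp hp2 l (fun S => 1 * f (insert a S) + (-1) * f S)
  have he : (fun S => 1 * f (insert a S) + (-1) * f S) = fun S => f (insert a S) - f S := by
    funext S; ring
  simp only [he] at h0 h2
  have he : (fun S => (1 * f (insert a S) + (-1) * f S) ^ 2)
      = fun S => (f (insert a S) - f S) ^ 2 := by
    funext S; ring
  simp only [he] at h2
  have hq : 0 ≤ 1 - p := by linarith
  set D := disjointExp p l (fun S => f (insert a S) - f S) (fun S => f (insert a S) - f S)
  set X := disjointExp p l (fun S => (1 - p) * f S + p * f (insert a S))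
        (fun S => (1 - p) * f S + p * f (insert a S))
  set m := biasedExp p l (fun S => (1 - p) * f S + p * f (insert a S))
  set d := biasedExp p l (fun S => f (insert a S) - f S)
  have h3 := mul_le_mul_of_nonneg_left (neg_abs_le (X - m ^ 2)) hq
  have h4 := mul_le_mul_of_nonneg_left (le_abs_self (D - d ^ 2)) hq
  have h5 := mul_le_mul_of_nonneg_left (h4.trans h2) (sq_nonneg p)
  have hX : X = p ^ 2 * D := by linarith
  rw [hX] at h3 h1
  nlinarith

lemma disjointExp_eq_zero (p : ℝ) {l : List α} (hl : l.Nodup) {f g : Finset α → ℝ}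
    (h : ∀ S T, S ⊆ l.toFinset → T ⊆ l.toFinset → Disjoint S T → f S * g T = 0) :
    disjointExp p l f g = 0 := by
  induction l generalizing f g with
  | nil => exact h ∅ ∅ (by simp) (by simp) (by simp)
  | cons a l ih =>
    have hal : a ∉ l.toFinset := by simpa using (List.nodup_cons.1 hl).1
    have hl' := (List.nodup_cons.1 hl).2
    have hsub : ∀ S, S ⊆ l.toFinset → S ⊆ (a :: l).toFinset := fun S hS => by
      rw [List.toFinset_cons]; exact hS.trans (subset_insert _ _)
    have hins : ∀ S, S ⊆ l.toFinset → insert a S ⊆ (a :: l).toFinset := fun S hS => by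
      rw [List.toFinset_cons]; exact insert_subset_insert _ hS
    simp only [disjointExp]
    rw [ih hl', ih hl', ih hl']
    · simp
    · intro S T hS hT hST
      exact h _ _ (hsub _ hS) (hins _ hT) (disjoint_insert_right.2 ⟨fun ha => hal (hS ha), hST⟩)
    · intro S T hS hT hST
      exact h _ _ (hins _ hS) (hsub _ hT) (disjoint_insert_left.2 ⟨fun ha => hal (hT ha), hST⟩)
    · intro S T hS hT hST
      exact h _ _ (hsub _ hS) (hsub _ hT) hST

/-- Harris's inequality. -/
lemma biasedExp_mul_le {p : ℝ} (hp : 0 ≤ p) (hp1 : p ≤ 1) (l : List α) {f g : Finset α → ℝ}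
    (hf : Antitone f) (hg : Antitone g) :
    biasedExp p l f * biasedExp p l g ≤ biasedExp p l (fun S => f S * g S) := by
  induction l generalizing f g with
  | nil => exact le_rfl
  | cons a l ih =>
    have hf' : Antitone fun S => f (insert a S) := fun S T h => hf (insert_subset_insert a h)
    have hg' : Antitone fun S => g (insert a S) := fun S T h => hg (insert_subset_insert a h)
    have h0 := mul_le_mul_of_nonneg_left (ih hf hg) (sub_nonneg.2 hp1)
    have h1 := mul_le_mul_of_nonneg_left (ih hf' hg') hp
    have h2 := biasedExp_mono hp hp1 l (fun S => hf (subset_insert a S))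
    have h3 := biasedExp_mono hp hp1 l (fun S => hg (subset_insert a S))
    simp only [biasedExp]
    nlinarith [mul_nonneg (mul_nonneg hp (sub_nonneg.2 hp1))
      (mul_nonneg (sub_nonneg.2 h2) (sub_nonneg.2 h3))]

lemma prod_biasedExp_le {ι : Type*} {p : ℝ} (hp : 0 ≤ p) (hp1 : p ≤ 1) (l : List α)
    (s : Finset ι) {f : ι → Finset α → ℝ} (hf : ∀ i, Antitone (f i)) (hf0 : ∀ i S, 0 ≤ f i S) :
    ∏ i ∈ s, biasedExp p l (f i) ≤ biasedExp p l (fun S => ∏ i ∈ s, f i S) := by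
  classical
  induction s using Finset.induction_on with
  | empty => simp [biasedExp_const]
  | insert i s hi ih =>
    simp only [prod_insert hi]
    refine (mul_le_mul_of_nonneg_left ih (biasedExp_nonneg hp hp1 l (hf0 i))).trans ?_
    refine biasedExp_mul_le hp hp1 l (hf i) ?_
    exact fun S T h => prod_le_prod (fun j _ => hf0 j T) fun j _ => hf j h

lemma biasedExp_congr (p : ℝ) {l : List α} {f g : Finset α → ℝ}
    (h : ∀ S ⊆ l.toFinset, f S = g S) : biasedExp p l f = biasedExp p l g := by
  induction l generalizing f g with
  | nil => exact h ∅ (by simp)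
  | cons a l ih =>
    simp only [biasedExp]
    rw [ih fun S hS => h S ?_, ih fun S hS => h (insert a S) ?_]
    · rw [List.toFinset_cons]; exact insert_subset_insert _ hS
    · rw [List.toFinset_cons]; exact hS.trans (subset_insert _ _)

/-- The Efron–Stein inequality. -/
lemma variance_biasedExp_le {p : ℝ} (hp : 0 ≤ p) (hp1 : p ≤ 1) {l : List α} (hl : l.Nodup)
    (f : Finset α → ℝ) :
    biasedExp p l (fun S => f S ^ 2) - biasedExp p l f ^ 2
      ≤ p * (1 - p) * ∑ i ∈ l.toFinset,
          biasedExp p l (fun S => (f (insert i S) - f (S.erase i)) ^ 2) := by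
  induction l generalizing f with
  | nil => simp [biasedExp]
  | cons a l ih =>
    have hal : a ∉ l.toFinset := by simpa using (List.nodup_cons.1 hl).1
    have hmean : biasedExp p (a :: l) f
        = biasedExp p l (fun S => (1 - p) * f S + p * f (insert a S)) := by
      rw [biasedExp, biasedExp_linear]
    have hq : 0 ≤ 1 - p := by linarith
    have hhead : biasedExp p (a :: l) (fun S => (f (insert a S) - f (S.erase a)) ^ 2)
        = biasedExp p l (fun S => (f (insert a S) - f S) ^ 2) := by
      have h0 : biasedExp p l (fun S => (f (insert a S) - f (S.erase a)) ^ 2)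
          = biasedExp p l (fun S => (f (insert a S) - f S) ^ 2) :=
        biasedExp_congr p fun S hS => by rw [erase_eq_of_notMem fun h => hal (hS h)]
      have h1 : biasedExp p l (fun S => (f (insert a (insert a S)) - f ((insert a S).erase a)) ^ 2)
          = biasedExp p l (fun S => (f (insert a S) - f S) ^ 2) :=
        biasedExp_congr p fun S hS => by
          rw [insert_idem, erase_insert fun h => hal (hS h)]
      rw [biasedExp, h0, h1]
      ring
    have htail : ∀ i ∈ l.toFinset,
        biasedExp p l (fun S => ((1 - p) * f (insert i S) + p * f (insert a (insert i S))
            - ((1 - p) * f (S.erase i) + p * f (insert a (S.erase i)))) ^ 2)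
          ≤ biasedExp p (a :: l) (fun S => (f (insert i S) - f (S.erase i)) ^ 2) := by
      intro i hi
      have hia : a ≠ i := fun h => hal (h ▸ hi)
      rw [biasedExp, ← biasedExp_linear]
      refine biasedExp_mono hp hp1 l fun S => ?_
      rw [insert_comm i a S, erase_insert_of_ne hia]
      nlinarith [mul_nonneg (mul_nonneg hp hq) (sq_nonneg
        (f (insert i S) - f (S.erase i) - (f (insert a (insert i S)) - f (insert a (S.erase i)))))]
    rw [biasedExp_sq_cons, hmean, List.toFinset_cons, sum_insert hal, hhead]
    have h1 := ih (List.nodup_cons.1 hl).2 (fun S => (1 - p) * f S + p * f (insert a S))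
    have h2 := mul_le_mul_of_nonneg_left (sum_le_sum htail) (mul_nonneg hp hq)
    linarith

lemma biasedExp_eq_sum (p : ℝ) {l : List α} (hl : l.Nodup) (f : Finset α → ℝ) :
    biasedExp p l f
      = ∑ S ∈ l.toFinset.powerset, p ^ #S * (1 - p) ^ (#l.toFinset - #S) * f S := by
  induction l generalizing f with
  | nil => simp [biasedExp]
  | cons a l ih =>
    have hal : a ∉ l.toFinset := by simpa using (List.nodup_cons.1 hl).1
    have hl' := (List.nodup_cons.1 hl).2
    rw [biasedExp, ih hl', ih hl', List.toFinset_cons, sum_powerset_insert hal, mul_sum, mul_sum]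
    congr 1 <;> refine sum_congr rfl fun S hS => ?_
    · have := card_le_card (mem_powerset.1 hS)
      rw [card_insert_of_notMem hal, Nat.succ_sub this, pow_succ]
      ring
    · rw [card_insert_of_notMem hal, card_insert_of_notMem fun h => hal (mem_powerset.1 hS h),
        Nat.add_sub_add_right, pow_succ]
      ring

end BiasedExpectation

section Layers

variable {n : ℕ}

/-- The `j`-element sets that contain a member of `F`. -/
def superLayer (F : Finset (Finset (Fin n))) (j : ℕ) : Finset (Finset (Fin n)) :=
  univ.filter fun S => #S = j ∧ ∃ A ∈ F, A ⊆ S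

/-- The `j`-element sets that meet `R`. -/
def meetLayer (R : Finset (Fin n)) (j : ℕ) : Finset (Finset (Fin n)) :=
  univ.filter fun S => #S = j ∧ (S ∩ R).Nonempty

lemma mem_superLayer {F : Finset (Finset (Fin n))} {j : ℕ} {S : Finset (Fin n)} :
    S ∈ superLayer F j ↔ #S = j ∧ ∃ A ∈ F, A ⊆ S := by
  simp [superLayer]

lemma mem_meetLayer {R : Finset (Fin n)} {j : ℕ} {S : Finset (Fin n)} :
    S ∈ meetLayer R j ↔ #S = j ∧ (S ∩ R).Nonempty := by
  simp [meetLayer]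

lemma card_meetLayer_add (R : Finset (Fin n)) (j : ℕ) :
    #(meetLayer R j) + (n - #R).choose j = n.choose j := by
  have h : meetLayer R j = powersetCard j univ \ powersetCard j Rᶜ := by
    ext S
    simp only [mem_meetLayer, mem_sdiff, mem_powersetCard, subset_univ, true_and, not_and,
      subset_compl_iff_disjoint_right, ← not_disjoint_iff_nonempty_inter]
    tauto
  have hsub : powersetCard j Rᶜ ⊆ powersetCard j univ := powersetCard_mono (subset_univ _)
  have h1 := card_sdiff_add_card_eq_card hsub
  rw [← h, card_powersetCard, card_powersetCard, card_compl, card_univ, Fintype.card_fin] at h1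
  exact h1

/-- The sets which do not contain a fixed final segment form an initial segment of colex. -/
lemma isInitSeg_compls_meetLayer {R : Finset (Fin n)} (hR : ∀ x ∈ R, ∀ y, x ≤ y → y ∈ R) (k : ℕ) :
    Colex.IsInitSeg (meetLayer R k).compls (n - k) := by
  refine ⟨fun S hS => ?_, fun s t hs ht => ?_⟩
  · have h1 := (mem_meetLayer.1 (mem_compls.1 (mem_coe.1 hS))).1
    have h2 := card_le_univ S
    rw [card_compl, Fintype.card_fin] at h1
    rw [Fintype.card_fin] at h2
    omega
  · obtain ⟨hs1, x, hx⟩ := mem_meetLayer.1 (mem_compls.1 hs)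
    rw [mem_inter, mem_compl] at hx
    have h1 := card_le_univ s
    have h2 := card_le_univ t
    rw [Fintype.card_fin] at h1 h2
    rw [card_compl, Fintype.card_fin] at hs1
    rw [mem_compls, mem_meetLayer]
    refine ⟨by rw [card_compl, Fintype.card_fin]; omega, ?_⟩
    by_cases hxt : x ∈ t
    · obtain ⟨b, hbs, hbt, hxb⟩ := (Colex.toColex_lt_toColex.1 ht.1).2 hxt hx.1
      exact ⟨b, mem_inter.2 ⟨mem_compl.2 hbt, hR x hx.2 b hxb⟩⟩
    · exact ⟨x, mem_inter.2 ⟨mem_compl.2 hxt, hx.2⟩⟩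

/-- A family with at least as many `k`-sets as the sets meeting an `r`-set has at least as
many supersets in every higher layer. -/
lemma choose_le_card_superLayer_add {r k j : ℕ} (hr : r ≤ n) (hk : 0 < k) (hkj : k ≤ j)
    {F : Finset (Finset (Fin n))} (hF : ∀ S ∈ F, #S = k)
    (hcard : n.choose k ≤ #F + (n - r).choose k) :
    n.choose j ≤ #(superLayer F j) + (n - r).choose j := by
  set R : Finset (Fin n) := univ.filter fun x => n - r ≤ x.val with hRdef
  have hRc : #R = r := by
    have h1 : #Rᶜ = n - r := by
      have : Rᶜ = univ.filter fun x : Fin n => x.val < n - r := by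
        ext x; simp [hRdef]; omega
      rw [this, Fin.card_filter_val_lt]
      omega
    rw [card_compl, Fintype.card_fin] at h1
    have := card_le_univ R
    rw [Fintype.card_fin] at this
    omega
  have hRup : ∀ x ∈ R, ∀ y, x ≤ y → y ∈ R := by
    intro x hx y hxy
    simp only [hRdef, mem_filter, mem_univ, true_and] at hx ⊢
    exact hx.trans hxy
  have hmk := card_meetLayer_add R k
  have hmj := card_meetLayer_add R j
  rw [hRc] at hmk hmj
  have hsz : (F.compls : Set (Finset (Fin n))).Sized (n - k) := by
    have : (F : Set (Finset (Fin n))).Sized k := fun S hS => hF S hS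
    simpa using this.compls
  have hkk := iterated_kk (k := j - k) hsz (𝒞 := (meetLayer R k).compls)
    (by rw [card_compls, card_compls]; omega) (isInitSeg_compls_meetLayer hRup k)
  have h1 : (meetLayer R j).compls ⊆ shadow^[j - k] (meetLayer R k).compls := by
    intro T hT
    obtain ⟨hTc, x, hx⟩ := mem_meetLayer.1 (mem_compls.1 hT)
    obtain ⟨A, hxA, hAT, hA⟩ := exists_subsuperset_card_eq
      (singleton_subset_iff.2 (mem_inter.1 hx).1) (by rw [card_singleton]; exact hk) (hkj.trans hTc.ge)
    refine mem_shadow_iterate_iff_exists_sdiff.2 ⟨Aᶜ, ?_, ?_, ?_⟩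
    · rw [mem_compls, compl_compl, mem_meetLayer]
      exact ⟨hA, x, mem_inter.2 ⟨singleton_subset_iff.1 hxA, (mem_inter.1 hx).2⟩⟩
    · rwa [subset_compl_comm]
    · have : Aᶜ \ T = Tᶜ \ A := by ext y; simp [and_comm]
      rw [this, card_sdiff_of_subset hAT, hA, hTc]
  have h2 : shadow^[j - k] F.compls ⊆ (superLayer F j).compls := by
    intro T hT
    obtain ⟨A, hA, hTA, hc⟩ := mem_shadow_iterate_iff_exists_sdiff.1 hT
    rw [mem_compls] at hA
    rw [mem_compls, mem_superLayer]
    have hsub : Aᶜ ⊆ Tᶜ := compl_subset_compl.2 hTA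
    refine ⟨?_, Aᶜ, hA, hsub⟩
    have h3 : A \ T = Tᶜ \ Aᶜ := by ext y; simp [and_comm]
    rw [h3] at hc
    have h4 := card_sdiff_add_card_eq_card hsub
    rw [hF _ hA, hc] at h4
    omega
  have h3 := (card_le_card h1).trans (hkk.trans (card_le_card h2))
  rw [card_compls, card_compls] at h3
  omega

/-- The density of the family of supersets does not decrease from one layer to a higher one. -/
lemma card_mul_choose_le_card_superLayer {k j : ℕ} (hkj : k ≤ j)
    {F : Finset (Finset (Fin n))} (hF : ∀ S ∈ F, #S = k) :
    #F * n.choose j ≤ #(superLayer F j) * n.choose k := by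
  have h := card_mul_le_card_mul (s := F) (t := superLayer F j) (fun A S => A ⊆ S)
    (m := (n - k).choose (j - k)) (n := j.choose k) ?_ ?_
  · have hpos : 0 < j.choose k := Nat.choose_pos hkj
    have hch := Nat.choose_mul (n := n) hkj
    refine Nat.le_of_mul_le_mul_right ?_ hpos
    calc #F * n.choose j * j.choose k = #F * (n - k).choose (j - k) * n.choose k := by
          rw [mul_assoc, hch]; ring
      _ ≤ #(superLayer F j) * j.choose k * n.choose k := Nat.mul_le_mul_right _ h
      _ = _ := by ring
  · intro A hA
    have hAk := hF A hA
    have h1 : #(powersetCard (j - k) Aᶜ) = (n - k).choose (j - k) := by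
      rw [card_powersetCard, card_compl, Fintype.card_fin, hAk]
    rw [← h1]
    refine card_le_card_of_injOn (fun B => A ∪ B) ?_ ?_
    · intro B hB
      have hB := mem_powersetCard.1 (mem_coe.1 hB)
      have hd : Disjoint A B := (subset_compl_iff_disjoint_right.1 hB.1).symm
      simp only [bipartiteAbove, coe_filter, Set.mem_ofPred_eq, mem_superLayer]
      refine ⟨⟨?_, A, hA, subset_union_left⟩, subset_union_left⟩
      rw [card_union_of_disjoint hd, hAk, hB.2]
      omega
    · intro B hB B' hB' he
      have hB := (mem_powersetCard.1 (mem_coe.1 hB)).1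
      have hB' := (mem_powersetCard.1 (mem_coe.1 hB')).1
      have hd : Disjoint A B := (subset_compl_iff_disjoint_right.1 hB).symm
      have hd' : Disjoint A B' := (subset_compl_iff_disjoint_right.1 hB').symm
      have := congrArg (fun X => X \ A) he
      simpa [union_sdiff_cancel_left hd, union_sdiff_cancel_left hd'] using this
  · intro S hS
    rw [← (mem_superLayer.1 hS).1, ← card_powersetCard]
    refine card_le_card fun A hA => ?_
    rw [bipartiteBelow, mem_filter] at hA
    exact mem_powersetCard.2 ⟨hA.2, hF A hA.1⟩

end Layers

section BiasedMeasure

variable {n : ℕ}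

/-- The `p`-biased measure of a family of subsets of `Fin n`. -/
noncomputable def biasedMeasure (p : ℝ) (P : Set (Finset (Fin n))) : ℝ :=
  ∑ S : Finset (Fin n), p ^ #S * (1 - p) ^ (n - #S) * P.indicator 1 S

lemma biasedExp_eq_sum_univ (p : ℝ) {l : List (Fin n)} (hl : l.Nodup) (hmem : ∀ x, x ∈ l)
    (f : Finset (Fin n) → ℝ) :
    biasedExp p l f = ∑ S : Finset (Fin n), p ^ #S * (1 - p) ^ (n - #S) * f S := by
  have h : l.toFinset = univ := by ext x; simp [hmem x]
  rw [biasedExp_eq_sum p hl, h, powerset_univ, card_univ, Fintype.card_fin]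

lemma biasedExp_indicator (p : ℝ) {l : List (Fin n)} (hl : l.Nodup) (hmem : ∀ x, x ∈ l)
    (P : Set (Finset (Fin n))) : biasedExp p l (P.indicator 1) = biasedMeasure p P :=
  biasedExp_eq_sum_univ p hl hmem _

lemma biased_weight_nonneg {p : ℝ} (hp : 0 ≤ p) (hp1 : p ≤ 1) (S : Finset (Fin n)) :
    0 ≤ p ^ #S * (1 - p) ^ (n - #S) :=
  mul_nonneg (pow_nonneg hp _) (pow_nonneg (sub_nonneg.2 hp1) _)

lemma biasedMeasure_nonneg {p : ℝ} (hp : 0 ≤ p) (hp1 : p ≤ 1) (P : Set (Finset (Fin n))) :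
    0 ≤ biasedMeasure p P :=
  sum_nonneg fun S _ => mul_nonneg (biased_weight_nonneg hp hp1 S)
    (Set.indicator_nonneg (fun _ _ => zero_le_one) S)

lemma biasedMeasure_mono {p : ℝ} (hp : 0 ≤ p) (hp1 : p ≤ 1) {P Q : Set (Finset (Fin n))}
    (h : P ⊆ Q) : biasedMeasure p P ≤ biasedMeasure p Q :=
  sum_le_sum fun S _ => mul_le_mul_of_nonneg_left
    (Set.indicator_le_indicator_of_subset h (fun _ => zero_le_one) S)
    (biased_weight_nonneg hp hp1 S)

lemma sum_biased_weight (p : ℝ) :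
    ∑ S : Finset (Fin n), p ^ #S * (1 - p) ^ (n - #S) = 1 := by
  have h := Fintype.sum_pow_mul_eq_add_pow (Fin n) p (1 - p)
  rw [Fintype.card_fin] at h
  rw [h]
  simp

lemma biasedMeasure_compl (p : ℝ) (P : Set (Finset (Fin n))) :
    biasedMeasure p Pᶜ = 1 - biasedMeasure p P := by
  rw [← sum_biased_weight (n := n) p, biasedMeasure, biasedMeasure, ← sum_sub_distrib]
  refine sum_congr rfl fun S _ => ?_
  by_cases h : S ∈ P <;> simp [h]

lemma biasedMeasure_union_le {p : ℝ} (hp : 0 ≤ p) (hp1 : p ≤ 1) (P Q : Set (Finset (Fin n))) :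
    biasedMeasure p (P ∪ Q) ≤ biasedMeasure p P + biasedMeasure p Q := by
  rw [biasedMeasure, biasedMeasure, biasedMeasure, ← sum_add_distrib]
  refine sum_le_sum fun S _ => ?_
  rw [← mul_add]
  refine mul_le_mul_of_nonneg_left ?_ (biased_weight_nonneg hp hp1 S)
  by_cases h : S ∈ P <;> by_cases h' : S ∈ Q <;> simp [h, h']

lemma biasedMeasure_iUnion_le {p : ℝ} (hp : 0 ≤ p) (hp1 : p ≤ 1) {r : ℕ}
    (P : Fin r → Set (Finset (Fin n))) :
    biasedMeasure p (⋃ i, P i) ≤ ∑ i, biasedMeasure p (P i) := by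
  simp only [biasedMeasure]
  rw [sum_comm]
  refine sum_le_sum fun S _ => ?_
  rw [← mul_sum]
  refine mul_le_mul_of_nonneg_left ?_ (biased_weight_nonneg hp hp1 S)
  have hnn : ∀ i ∈ univ, (0 : ℝ) ≤ (P i).indicator 1 S :=
    fun i _ => Set.indicator_nonneg (fun _ _ => zero_le_one) S
  by_cases h : S ∈ ⋃ i, P i
  · obtain ⟨i, hi⟩ := Set.mem_iUnion.1 h
    rw [Set.indicator_of_mem h]
    refine le_trans ?_ (single_le_sum hnn (mem_univ i))
    rw [Set.indicator_of_mem hi]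
  · rw [Set.indicator_of_notMem h]
    exact sum_nonneg hnn

/-- Comparing the measures of two families layer by layer. -/
lemma mul_biasedMeasure_le_of_layers {p : ℝ} (hp : 0 ≤ p) (hp1 : p ≤ 1) (c : ℝ)
    (P Q : Set (Finset (Fin n))) [DecidablePred (· ∈ P)] [DecidablePred (· ∈ Q)]
    (h : ∀ j ≤ n, c * #(univ.filter fun S => #S = j ∧ S ∈ P)
      ≤ #(univ.filter fun S => #S = j ∧ S ∈ Q)) :
    c * biasedMeasure p P ≤ biasedMeasure p Q := by
  have key : ∀ (P : Set (Finset (Fin n))) [DecidablePred (· ∈ P)], biasedMeasure p P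
      = ∑ j ∈ range (n + 1), p ^ j * (1 - p) ^ (n - j)
          * #(univ.filter fun S => #S = j ∧ S ∈ P) := by
    intro P _
    have hmaps : ∀ S ∈ (univ : Finset (Finset (Fin n))), #S ∈ range (n + 1) := fun S _ => by
      have := card_le_univ S
      rw [Fintype.card_fin] at this
      exact mem_range.2 (by omega)
    rw [biasedMeasure, ← sum_fiberwise_of_maps_to hmaps]
    refine sum_congr rfl fun j _ => ?_
    rw [← filter_filter, card_filter, Nat.cast_sum, mul_sum]
    refine sum_congr rfl fun S hS => ?_
    rw [(mem_filter.1 hS).2]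
    by_cases hSP : S ∈ P <;> simp [hSP]
  rw [key P, key Q, mul_sum]
  refine sum_le_sum fun j hj => ?_
  have h1 := h j (by have := mem_range.1 hj; omega)
  have h2 : 0 ≤ p ^ j * (1 - p) ^ (n - j) :=
    mul_nonneg (pow_nonneg hp _) (pow_nonneg (sub_nonneg.2 hp1) _)
  calc _ = p ^ j * (1 - p) ^ (n - j) * (c * #(univ.filter fun S => #S = j ∧ S ∈ P)) := by ring
    _ ≤ _ := mul_le_mul_of_nonneg_left h1 h2

lemma biasedMeasure_disjoint (p : ℝ) (R : Finset (Fin n)) :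
    biasedMeasure p {S | Disjoint S R} = (1 - p) ^ #R := by
  have h1 : biasedMeasure p {S | Disjoint S R}
      = ∑ S ∈ Rᶜ.powerset, p ^ #S * (1 - p) ^ (n - #S) := by
    rw [biasedMeasure, ← sum_subset (subset_univ Rᶜ.powerset)]
    · refine sum_congr rfl fun S hS => ?_
      have : Disjoint S R := subset_compl_iff_disjoint_right.1 (mem_powerset.1 hS)
      simp [this]
    · intro S _ hS
      have : ¬ Disjoint S R := fun h => hS (mem_powerset.2 (subset_compl_iff_disjoint_right.2 h))
      simp [this]
  have h2 := Finset.sum_pow_mul_eq_add_pow p (1 - p) Rᶜ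
  rw [add_sub_cancel, one_pow] at h2
  calc biasedMeasure p {S | Disjoint S R}
      = (1 - p) ^ #R * ∑ S ∈ Rᶜ.powerset, p ^ #S * (1 - p) ^ (#Rᶜ - #S) := ?_
    _ = (1 - p) ^ #R := by rw [h2, mul_one]
  rw [h1, mul_sum]
  refine sum_congr rfl fun S hS => ?_
  have hS := card_le_card (mem_powerset.1 hS)
  have hR := card_le_univ R
  have hc := card_compl R
  rw [Fintype.card_fin] at hR hc
  have : n - #S = #R + (#Rᶜ - #S) := by omega
  rw [this, pow_add]
  ring

/-- The Chernoff bound. -/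
lemma biasedMeasure_card_lt_le {p : ℝ} (hp : 0 ≤ p) (hp1 : p ≤ 1) (k : ℕ) {θ : ℝ} (hθ : 0 ≤ θ)
    (hθ1 : θ ≤ 1) :
    biasedMeasure p {S : Finset (Fin n) | #S < k}
      ≤ Real.exp (θ * k + n * p * (θ ^ 2 - θ)) := by
  have h1 : biasedMeasure p {S : Finset (Fin n) | #S < k}
      ≤ Real.exp (θ * k) * ∑ S : Finset (Fin n), (p * Real.exp (-θ)) ^ #S * (1 - p) ^ (n - #S) := by
    rw [biasedMeasure, mul_sum]
    refine sum_le_sum fun S _ => ?_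
    have hw := biased_weight_nonneg hp hp1 S
    have he : Real.exp (θ * k) * ((p * Real.exp (-θ)) ^ #S * (1 - p) ^ (n - #S))
        = p ^ #S * (1 - p) ^ (n - #S) * Real.exp (θ * (k - #S)) := by
      have : θ * ((k : ℝ) - #S) = θ * k + #S * -θ := by ring
      rw [mul_pow, ← Real.exp_nat_mul, this, Real.exp_add]
      ring
    rw [he]
    refine mul_le_mul_of_nonneg_left ?_ hw
    by_cases hS : #S < k
    · have : S ∈ {S : Finset (Fin n) | #S < k} := hS
      rw [Set.indicator_of_mem this]
      have hc : (#S : ℝ) ≤ k := by exact_mod_cast hS.le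
      exact Real.one_le_exp (mul_nonneg hθ (by linarith))
    · have : S ∉ {S : Finset (Fin n) | #S < k} := hS
      rw [Set.indicator_of_notMem this]
      exact (Real.exp_pos _).le
  have h2 := Fintype.sum_pow_mul_eq_add_pow (Fin n) (p * Real.exp (-θ)) (1 - p)
  rw [Fintype.card_fin] at h2
  rw [h2] at h1
  refine h1.trans ?_
  rw [Real.exp_add]
  refine mul_le_mul_of_nonneg_left ?_ (Real.exp_pos _).le
  have h3 : Real.exp (-θ) ≤ 1 - θ + θ ^ 2 := by
    have := Real.abs_exp_sub_one_sub_id_le (x := -θ) (by rw [abs_neg, abs_of_nonneg hθ]; exact hθ1)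
    have := (abs_le.1 this).2
    nlinarith
  have h4 : p * Real.exp (-θ) + (1 - p) ≤ Real.exp (p * (θ ^ 2 - θ)) := by
    have := Real.add_one_le_exp (p * (θ ^ 2 - θ))
    nlinarith [mul_le_mul_of_nonneg_left h3 hp]
  have h5 : 0 ≤ p * Real.exp (-θ) + (1 - p) :=
    add_nonneg (mul_nonneg hp (Real.exp_pos _).le) (sub_nonneg.2 hp1)
  calc _ ≤ Real.exp (p * (θ ^ 2 - θ)) ^ n := pow_le_pow_left₀ h5 h4 n
    _ = _ := by rw [← Real.exp_nat_mul]; ring_nf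

/-- Harris's inequality for the union of several upper sets. -/
lemma prod_one_sub_biasedMeasure_le {p : ℝ} (hp : 0 ≤ p) (hp1 : p ≤ 1) {r : ℕ}
    {P : Fin r → Set (Finset (Fin n))} (hP : ∀ i, IsUpperSet (P i)) :
    ∏ i, (1 - biasedMeasure p (P i)) ≤ 1 - biasedMeasure p (⋃ i, P i) := by
  have hl : (univ : Finset (Fin n)).toList.Nodup := nodup_toList _
  have hmem : ∀ x, x ∈ (univ : Finset (Fin n)).toList := fun x => by simp
  have h := prod_biasedExp_le hp hp1 (univ : Finset (Fin n)).toList (univ : Finset (Fin r))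
    (f := fun i => (P i)ᶜ.indicator 1) ?_ ?_
  · simp only [biasedExp_indicator p hl hmem, biasedMeasure_compl] at h
    refine h.trans_eq ?_
    rw [← biasedMeasure_compl, ← biasedExp_indicator p hl hmem]
    congr 1
    funext S
    by_cases hS : S ∈ ⋃ i, P i
    · obtain ⟨i, hi⟩ := Set.mem_iUnion.1 hS
      have h1 : S ∉ (⋃ i, P i)ᶜ := fun h => h hS
      rw [Set.indicator_of_notMem h1]
      exact prod_eq_zero (mem_univ i) (Set.indicator_of_notMem (Set.notMem_compl_iff.2 hi) _)
    · rw [Set.indicator_of_mem (show S ∈ (⋃ i, P i)ᶜ from hS)]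
      refine prod_eq_one fun i _ => ?_
      rw [Set.indicator_of_mem]
      · rfl
      · exact fun h => hS (Set.mem_iUnion.2 ⟨i, h⟩)
  · intro i S T hST
    by_cases hS : S ∈ P i
    · have hT := hP i hST hS
      simp [hS, hT]
    · by_cases hT : T ∈ P i <;> simp [hS, hT]
  · exact fun i S => Set.indicator_nonneg (fun _ _ => zero_le_one) S

lemma indicator_one_sq (P : Set (Finset (Fin n))) :
    (fun S => (P.indicator (1 : Finset (Fin n) → ℝ) S) ^ 2) = P.indicator 1 := by
  funext S
  by_cases hS : S ∈ P <;> simp [hS]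

lemma disjointExp_indicator_eq_zero (p : ℝ) {l : List (Fin n)} (hl : l.Nodup)
    {P : Set (Finset (Fin n))} (hP : ∀ A ∈ P, ∀ B ∈ P, ¬ Disjoint A B) :
    disjointExp p l (P.indicator 1) (P.indicator 1) = 0 := by
  refine disjointExp_eq_zero p hl fun S T _ _ hST => ?_
  by_cases hS : S ∈ P
  · have hT : T ∉ P := fun hT => hP S hS T hT hST
    simp [hT]
  · simp [hS]

/-- An intersecting family has `p`-biased measure at most `p`, when `p ≤ 1 / 2`. -/
lemma biasedMeasure_le_of_intersecting {p : ℝ} (hp : 0 ≤ p) (hp2 : 2 * p ≤ 1)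
    {P : Set (Finset (Fin n))} (hP : ∀ A ∈ P, ∀ B ∈ P, ¬ Disjoint A B) :
    biasedMeasure p P ≤ p := by
  have hl : (univ : Finset (Fin n)).toList.Nodup := nodup_toList _
  have hmem : ∀ x, x ∈ (univ : Finset (Fin n)).toList := fun x => by simp
  have h := abs_disjointExp_sub_sq_le hp hp2 (univ : Finset (Fin n)).toList (P.indicator 1)
  rw [disjointExp_indicator_eq_zero p hl hP, indicator_one_sq, biasedExp_indicator p hl hmem,
    zero_sub, abs_neg, abs_of_nonneg (sq_nonneg _)] at h
  have h0 := biasedMeasure_nonneg hp (by linarith : p ≤ 1) P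
  by_contra hc
  push Not at hc
  nlinarith

/-- Stability: an intersecting upper set of nearly maximal measure is close to a dictatorship. -/
lemma exists_dictator_of_intersecting {p η : ℝ} (hp : 1 / 4 ≤ p) (hp2 : 2 * p < 1)
    {P : Set (Finset (Fin n))} (hup : IsUpperSet P) (hP : ∀ A ∈ P, ∀ B ∈ P, ¬ Disjoint A B)
    (hμ : 1 / 8 ≤ biasedMeasure p P)
    (hη : p - biasedMeasure p P ≤ p * (1 - 2 * p) * η) (hη1 : 8 * n * η < 1) :
    ∃ i, biasedMeasure p {S | S.erase i ∈ P} ≤ 2 * η := by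
  have hp0 : 0 ≤ p := by linarith
  have hp1 : p ≤ 1 := by linarith
  have hμp := biasedMeasure_le_of_intersecting hp0 hp2.le hP
  set μ := biasedMeasure p P with hμdef
  set f : Finset (Fin n) → ℝ := P.indicator 1 with hf
  set D : Fin n → ℝ := fun i =>
    biasedExp p (univ.erase i).toList (fun S => f (insert i S) - f S) with hD
  have hlist : ∀ i : Fin n, (i :: (univ.erase i).toList).Nodup ∧
      ∀ x, x ∈ i :: (univ.erase i).toList := by
    intro i
    refine ⟨List.nodup_cons.2 ⟨by simp, nodup_toList _⟩, fun x => ?_⟩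
    by_cases h : x = i <;> simp [h]
  have hmono : ∀ {S T : Finset (Fin n)}, S ⊆ T → f S ≤ f T := by
    intro S T hST
    by_cases hS : S ∈ P
    · have hT := hup hST hS
      simp [hf, hS, hT]
    · by_cases hT : T ∈ P <;> simp [hf, hS, hT]
  have hder : ∀ i S, (f (insert i S) - f S) ^ 2 = f (insert i S) - f S := by
    intro i S
    by_cases hS : S ∈ P
    · have hT := hup (subset_insert i S) hS
      simp [hf, hS, hT]
    · by_cases hT : insert i S ∈ P <;> simp [hf, hS, hT]
  have hDvar : ∀ i, D i - D i ^ 2 ≤ η := by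
    intro i
    have h := variance_derivative_le hp0 hp2.le i (univ.erase i).toList f
      (disjointExp_indicator_eq_zero p (hlist i).1 hP)
    simp only [hder] at h
    rw [hf, indicator_one_sq, biasedExp_indicator p (hlist i).1 (hlist i).2, ← hf, ← hμdef] at h
    have h1 : p * (p * (1 - 2 * p) * (D i - D i ^ 2)) ≤ p * (p * (1 - 2 * p) * η) := by
      have h2 : p * μ - μ ^ 2 ≤ p * (p - μ) := by nlinarith
      have h3 := mul_le_mul_of_nonneg_left hη hp0
      have h4 : p ^ 2 * (1 - 2 * p) * (D i - D i ^ 2) ≤ p * μ - μ ^ 2 := h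
      linarith
    have h5 : 0 < p * (p * (1 - 2 * p)) := by
      have : 0 < p := by linarith
      have : 0 < 1 - 2 * p := by linarith
      positivity
    refine le_of_mul_le_mul_left ?_ h5
    linarith
  have hsum : μ - μ ^ 2 ≤ p * (1 - p) * ∑ i, D i := by
    have hl : (univ : Finset (Fin n)).toList.Nodup := nodup_toList _
    have hmem : ∀ x, x ∈ (univ : Finset (Fin n)).toList := fun x => by simp
    have h := variance_biasedExp_le hp0 hp1 hl f
    rw [hf, indicator_one_sq, biasedExp_indicator p hl hmem, toList_toFinset, ← hf, ← hμdef] at h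
    refine h.trans_eq ?_
    congr 1
    refine sum_congr rfl fun i _ => ?_
    rw [biasedExp_eq_sum_univ p hl hmem, ← biasedExp_eq_sum_univ p (hlist i).1 (hlist i).2,
      biasedExp]
    have hi : ∀ S ⊆ (univ.erase i).toList.toFinset, i ∉ S := fun S hS h => by
      simpa using hS h
    rw [biasedExp_congr p (l := (univ.erase i).toList)
        (f := fun S => (f (insert i S) - f (S.erase i)) ^ 2)
        (g := fun S => f (insert i S) - f S)
        fun S hS => by rw [erase_eq_of_notMem (hi S hS), hder],
      biasedExp_congr p (l := (univ.erase i).toList)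
        (f := fun S => (f (insert i (insert i S)) - f ((insert i S).erase i)) ^ 2)
        (g := fun S => f (insert i S) - f S)
        fun S hS => by rw [insert_idem, erase_insert (hi S hS), hder]]
    simp only [hD]
    ring
  have hex : ∃ i, 1 / 2 < D i := by
    by_contra hcon
    push Not at hcon
    have h1 : ∀ i, D i ≤ 2 * η := by
      intro i
      have hDi : 0 ≤ D i := biasedExp_nonneg hp0 hp1 _ fun S =>
        sub_nonneg.2 (hmono (subset_insert i S))
      nlinarith [hDvar i, hcon i]
    have h2 : ∑ i, D i ≤ n * (2 * η) := by
      refine (sum_le_sum fun i _ => h1 i).trans_eq ?_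
      simp
    have h3 : p * (1 - p) ≤ 1 / 4 := by nlinarith [sq_nonneg (1 - 2 * p)]
    have h4 : 0 < p * (1 - p) := mul_pos (by linarith) (by linarith)
    have h5 : (1 : ℝ) / 16 ≤ μ - μ ^ 2 := by nlinarith
    have h6 : ∑ i, D i < 1 / 4 := by linarith
    nlinarith
  obtain ⟨i, hi⟩ := hex
  refine ⟨i, ?_⟩
  have hiη : 1 - D i ≤ 2 * η := by
    have hD1 : D i ≤ 1 := by
      have h := biasedExp_mono hp0 hp1 (univ.erase i).toList
        (f := fun S => f (insert i S) - f S) (g := fun _ => 1) fun S => by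
          by_cases hS : S ∈ P <;> by_cases hT : insert i S ∈ P <;> simp [hf, hS, hT]
      rwa [biasedExp_const] at h
    nlinarith [hDvar i]
  have hiS : ∀ S ⊆ (univ.erase i).toList.toFinset, i ∉ S := fun S hS h => by
    simpa using hS h
  have heq : biasedMeasure p {S | S.erase i ∈ P} = biasedExp p (univ.erase i).toList f := by
    rw [← biasedExp_indicator p (hlist i).1 (hlist i).2, biasedExp]
    rw [biasedExp_congr p (l := (univ.erase i).toList)
        (f := Set.indicator {S | S.erase i ∈ P} 1) (g := f)
        fun S hS => by
          by_cases h : S ∈ P <;> simp [hf, h, erase_eq_of_notMem (hiS S hS), Set.indicator],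
      biasedExp_congr p (l := (univ.erase i).toList)
        (f := fun S => Set.indicator {S | S.erase i ∈ P} 1 (insert i S)) (g := f)
        fun S hS => by
          by_cases h : S ∈ P <;> simp [hf, h, erase_insert (hiS S hS), Set.indicator]]
    ring
  have hle : biasedExp p (univ.erase i).toList f ≤ 1 - D i := by
    have h1 := biasedExp_linear p (univ.erase i).toList 1 (-1) (fun _ => 1)
      (fun S => f (insert i S) - f S)
    rw [biasedExp_const] at h1
    have h2 := biasedExp_mono hp0 hp1 (univ.erase i).toList (f := f)
      (g := fun S => 1 * 1 + (-1) * (f (insert i S) - f S)) fun S => by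
        by_cases hS : S ∈ P <;> by_cases hT : insert i S ∈ P <;> simp [hf, hS, hT]
    rw [h1] at h2
    simp only [hD]
    linarith
  rw [heq]
  linarith

end BiasedMeasure

section Binomials

lemma add_mul_mul_choose_le {N : ℕ} (s w t : ℕ) (h : w + t ≤ N) :
    (N + t * s) * w.choose s ≤ N * (w + t).choose s := by
  induction t with
  | zero => simp
  | succ t ih =>
    have ih := ih (by omega)
    cases s with
    | zero => simp
    | succ s =>
      have h1 : (w + t).choose (s + 1) * (s + 1) ≤ N * (w + t).choose s := by
        rw [Nat.choose_succ_right_eq, mul_comm]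
        exact Nat.mul_le_mul_right _ (by omega)
      have h2 : w.choose (s + 1) * (s + 1) ≤ (w + t).choose (s + 1) * (s + 1) :=
        Nat.mul_le_mul_right _ (Nat.choose_le_choose _ (by omega))
      rw [← add_assoc, Nat.choose_succ_succ']
      nlinarith

lemma mul_choose_succ_le_choose {N L a b x t s : ℕ} (hN : N ≤ 8 * (b + 1)) (has : a = b + 1 + s)
    (hax : a ≤ x) (hxN : x + 1 ≤ N) (ht : x + t ≤ a + b) (hL : 8 * N * L ≤ N + t * s) :
    L * (x + 1).choose a ≤ x.choose b := by
  have h1 := Nat.add_one_mul_choose_eq x b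
  have h2 : (x + 1).choose a * a.choose (b + 1)
      = (x + 1).choose (b + 1) * (x - b).choose s := by
    have h := Nat.choose_mul (n := x + 1) (k := a) (s := b + 1) (by omega)
    rwa [show x + 1 - (b + 1) = x - b by omega, show a - (b + 1) = s by omega] at h
  have h3 : a.choose (b + 1) = a.choose s := Nat.choose_symm_of_eq_add (by omega)
  have h4 := add_mul_mul_choose_le (N := N) s (x - b) t (by omega)
  have h5 : (x - b + t).choose s ≤ a.choose s := Nat.choose_le_choose _ (by omega)
  have hpos : 0 < (x - b).choose s := Nat.choose_pos (by omega)
  have hN0 : 0 < N := by omega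
  have h6 : (8 * L) * (x + 1).choose a ≤ (x + 1).choose (b + 1) := by
    refine Nat.le_of_mul_le_mul_left ?_ (Nat.mul_pos hN0 hpos)
    calc N * (x - b).choose s * (8 * L * (x + 1).choose a)
        = (8 * N * L) * (x - b).choose s * (x + 1).choose a := by ring
      _ ≤ (N + t * s) * (x - b).choose s * (x + 1).choose a := by gcongr
      _ ≤ N * a.choose s * (x + 1).choose a := by
        exact Nat.mul_le_mul_right _ (h4.trans (Nat.mul_le_mul_left _ h5))
      _ = N * ((x + 1).choose a * a.choose (b + 1)) := by rw [h3]; ring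
      _ = N * (x - b).choose s * (x + 1).choose (b + 1) := by rw [h2]; ring
  refine Nat.le_of_mul_le_mul_left ?_ (show 0 < 8 * (b + 1) by omega)
  calc 8 * (b + 1) * (L * (x + 1).choose a) = (8 * L * (x + 1).choose a) * (b + 1) := by ring
    _ ≤ (x + 1).choose (b + 1) * (b + 1) := Nat.mul_le_mul_right _ h6
    _ = (x + 1) * x.choose b := h1.symm
    _ ≤ 8 * (b + 1) * x.choose b := Nat.mul_le_mul_right _ (by omega)

lemma choose_add_add_le (n k u : ℕ) (h : n + u ≤ 16 * (k + 1)) :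
    (n + u).choose (k + u) ≤ 16 ^ u * n.choose k := by
  induction u with
  | zero => simp
  | succ u ih =>
    have ih := ih (by omega)
    have h1 := Nat.add_one_mul_choose_eq (n + u) (k + u)
    have h2 : (n + u + 1).choose (k + u + 1) ≤ 16 * (n + u).choose (k + u) := by
      refine Nat.le_of_mul_le_mul_right ?_ (show 0 < k + u + 1 by omega)
      rw [← h1]
      nlinarith [Nat.zero_le ((n + u).choose (k + u))]
    calc (n + (u + 1)).choose (k + (u + 1)) ≤ 16 * (n + u).choose (k + u) := h2
      _ ≤ 16 * (16 ^ u * n.choose k) := Nat.mul_le_mul_left _ ih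
      _ = 16 ^ (u + 1) * n.choose k := by ring

lemma choose_le_pow_mul_choose {n k r q t : ℕ} (hq : q ≤ r) (hrt : 16 * (r + t) ≤ n)
    (hn : n ≤ 8 * k) (hk : 2 * k ≤ n) :
    n.choose k ≤ 16 ^ (r + t) * (n - r - t).choose (n - (k + r - q)) := by
  have h1 := choose_add_add_le (n - (q + t)) (k - (q + t)) (q + t) (by omega)
  have h2 := choose_add_add_le (n - r - t) (n - (k + r - q)) (r - q) (by omega)
  rw [show n - (q + t) + (q + t) = n by omega, show k - (q + t) + (q + t) = k by omega] at h1
  rw [show n - r - t + (r - q) = n - (q + t) by omega,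
    show n - (k + r - q) + (r - q) = n - k by omega] at h2
  have h3 : (n - (q + t)).choose (k - (q + t)) = (n - (q + t)).choose (n - k) :=
    Nat.choose_symm_of_eq_add (by omega)
  calc n.choose k ≤ 16 ^ (q + t) * (n - (q + t)).choose (k - (q + t)) := h1
    _ ≤ 16 ^ (q + t) * (16 ^ (r - q) * (n - r - t).choose (n - (k + r - q))) := by
      rw [h3]; exact Nat.mul_le_mul_left _ h2
    _ = _ := by
      rw [← mul_assoc, ← pow_add]
      congr 2
      omega

end Binomials

section Bootstrapping

variable {n : ℕ}

/-- A sparse family of sets has many more sets in a much lower shadow. -/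
lemma mul_card_lt_card_shadow {k r q t L : ℕ} (hk : 0 < k) (hq : q ≤ r) (hrt : 16 * (r + t) ≤ n)
    (hn : n ≤ 8 * k) (hkr : 2 * k + r ≤ n)
    (hL : 8 * n * L ≤ n + (t - 1) * (n - 2 * k - r))
    {H : Finset (Finset (Fin n))} (hH : ∀ S ∈ H, #S = n - (k + r - q)) (hne : H.Nonempty)
    (hsmall : #H * 16 ^ (r + t) < n.choose k) (hL0 : 0 < L) :
    L * #H < #(shadow^[n - (k + r - q) - (k - 1)] H) := by
  set a := n - (k + r - q) with ha
  have hrt' : #H < (n - r - t).choose a := by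
    have h := choose_le_pow_mul_choose hq hrt hn (by omega : 2 * k ≤ n)
    rw [mul_comm] at hsmall
    exact Nat.lt_of_mul_lt_mul_left (hsmall.trans_le h)
  set x := Nat.findGreatest (fun y => y.choose a ≤ #H) n with hx
  have hax : a ≤ x := by
    refine Nat.le_findGreatest (by omega) ?_
    rw [Nat.choose_self]
    exact hne.card_pos
  have hxH : x.choose a ≤ #H :=
    Nat.findGreatest_spec (P := fun y => y.choose a ≤ #H) (m := a) (by omega)
      (by rw [Nat.choose_self]; exact hne.card_pos)
  have hxlt : x < n - r - t := by
    by_contra hcon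
    push Not at hcon
    exact absurd (hrt'.trans_le (Nat.choose_le_choose a hcon)) (by omega)
  have hxH' : #H < (x + 1).choose a := by
    have := Nat.findGreatest_is_greatest (P := fun y => y.choose a ≤ #H) (n := n) (k := x + 1)
      (by omega) (by omega)
    omega
  have hkk := kruskal_katona_lovasz_form (i := a - (k - 1)) (r := a) (k := x) (by omega) hax
    (by omega) (𝒜 := H) (fun S hS => hH S hS) hxH
  rw [show a - (a - (k - 1)) = k - 1 by omega] at hkk
  have hL' : 8 * n * L ≤ n + (t - 1) * (a - k) := by
    refine hL.trans (Nat.add_le_add_left (Nat.mul_le_mul_left _ (by omega)) _)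
  have hexp := mul_choose_succ_le_choose (N := n) (L := L) (a := a) (b := k - 1) (x := x)
    (t := t - 1) (s := a - k) (by omega) (by omega) hax (by omega) (by omega) hL'
  calc L * #H < L * (x + 1).choose a := Nat.mul_lt_mul_of_pos_left hxH' hL0
    _ ≤ _ := hexp.trans hkk

/-- If each family is close to a dictatorship, then their union, when large, consists of
all the sets that meet the set of dictators. -/
lemma eq_meetLayer_of_close_to_dictators {k r t : ℕ} (hr : 0 < r) (hk : 0 < k)
    (hrt : 16 * (r + t) ≤ n) (hn : n ≤ 8 * k) (hkr : 2 * k + r ≤ n)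
    (hL : 8 * n * (r * 2 ^ r) ≤ n + (t - 1) * (n - 2 * k - r))
    {F : Finset (Finset (Fin n))} {Fs : Fin r → Finset (Finset (Fin n))}
    (hF : F = univ.biUnion Fs) (hsz : ∀ i, ∀ S ∈ Fs i, #S = k)
    (hpair : ∀ i, ∀ A ∈ Fs i, ∀ B ∈ Fs i, ¬ Disjoint A B)
    (hcard : n.choose k ≤ #F + (n - r).choose k)
    {x : Fin r → Fin n} (hx : Function.Injective x)
    (hsmall : ∀ i, #((Fs i).filter (x i ∉ ·)) * 16 ^ (r + t) < n.choose k) :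
    F = meetLayer (univ.image x) k := by
  set R := univ.image x with hR
  have hRc : #R = r := by rw [hR, card_image_of_injective _ hx, card_univ, Fintype.card_fin]
  have hxR : ∀ i, x i ∈ R := fun i => mem_image_of_mem _ (mem_univ i)
  have hmeet := card_meetLayer_add R k
  rw [hRc] at hmeet
  set E : Fin r → Finset (Finset (Fin n)) := fun i => (Fs i).filter (x i ∉ ·) with hE
  obtain ⟨j, -, hj⟩ := exists_max_image (univ : Finset (Fin r)) (fun i => #(E i))
    ⟨⟨0, hr⟩, mem_univ _⟩
  rcases (E j).eq_empty_or_nonempty with hEj | hEj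
  · refine eq_of_subset_of_card_le ?_ (by omega)
    intro S hS
    rw [hF] at hS
    obtain ⟨i, -, hi⟩ := mem_biUnion.1 hS
    have hEi : E i = ∅ := by
      have := hj i (mem_univ i)
      rw [hEj, card_empty] at this
      exact card_eq_zero.1 (by omega)
    have hxi : x i ∈ S := by
      by_contra hcon
      have : S ∈ E i := mem_filter.2 ⟨hi, hcon⟩
      rw [hEi] at this
      exact absurd this (notMem_empty _)
    exact mem_meetLayer.2 ⟨hsz i S hi, x i, mem_inter.2 ⟨hxi, hxR i⟩⟩
  · exfalso
    obtain ⟨Q, hQ, hQcard⟩ : ∃ Q ∈ R.powerset,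
        #(E j) ≤ 2 ^ r * #((E j).filter fun A => A ∩ R = Q) := by
      by_contra hcon
      push Not at hcon
      have h1 := card_eq_sum_card_fiberwise (s := E j) (t := R.powerset) (f := fun A => A ∩ R)
        fun A _ => mem_coe.2 (mem_powerset.2 inter_subset_right)
      have h2 : ∑ Q ∈ R.powerset, 2 ^ r * #((E j).filter fun A => A ∩ R = Q)
          < ∑ Q ∈ R.powerset, #(E j) := sum_lt_sum_of_nonempty ⟨∅, by simp⟩ hcon
      rw [← mul_sum, ← h1, sum_const, card_powerset, hRc, smul_eq_mul] at h2
      exact absurd h2 (lt_irrefl _)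
    set G := (E j).filter fun A => A ∩ R = Q with hG
    have hQr : #Q ≤ r := hRc ▸ card_le_card (mem_powerset.1 hQ)
    have hGE : ∀ A ∈ G, A ∈ Fs j ∧ x j ∉ A ∧ A ∩ R = Q := by
      intro A hA
      have h1 := mem_filter.1 hA
      have h2 := mem_filter.1 h1.1
      exact ⟨h2.1, h2.2, h1.2⟩
    set H := G.image fun A => (A ∪ R)ᶜ with hH
    have hHG : #H = #G := by
      refine card_image_of_injOn fun A hA B hB hAB => ?_
      have h1 : A ∪ R = B ∪ R := compl_injective hAB
      have h2 : A ∩ R = B ∩ R := (hGE A hA).2.2.trans (hGE B hB).2.2.symm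
      ext y
      have e1 := Finset.ext_iff.1 h1 y
      have e2 := Finset.ext_iff.1 h2 y
      simp only [mem_union, mem_inter] at e1 e2
      tauto
    have hGpos : 0 < #G := by
      by_contra hcon
      have h0 : #G = 0 := by omega
      rw [h0, mul_zero] at hQcard
      have := hEj.card_pos
      omega
    have hHsz : ∀ S ∈ H, #S = n - (k + r - #Q) := by
      intro S hS
      obtain ⟨A, hA, rfl⟩ := mem_image.1 hS
      have h1 := card_union_add_card_inter A R
      rw [(hGE A hA).2.2, hsz j A (hGE A hA).1, hRc] at h1
      rw [card_compl, Fintype.card_fin]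
      omega
    have hHle : #H ≤ #(E j) := hHG ▸ card_le_card (filter_subset _ _)
    have hexp := mul_card_lt_card_shadow hk hQr hrt hn hkr hL hHsz
      (card_pos.1 (by omega)) ((Nat.mul_le_mul_right _ hHle).trans_lt (hsmall j))
      (Nat.mul_pos hr (by positivity))
    set W := shadow^[n - (k + r - #Q) - (k - 1)] H with hW
    have hWmem : ∀ T ∈ W, #T = k - 1 ∧ ∃ A ∈ G, Disjoint T A ∧ Disjoint T R := by
      intro T hT
      obtain ⟨S, hS, hTS, hc⟩ := mem_shadow_iterate_iff_exists_sdiff.1 hT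
      have hSc := hHsz S hS
      have h1 := card_sdiff_add_card_eq_card hTS
      obtain ⟨A, hA, rfl⟩ := mem_image.1 hS
      have h2 := subset_compl_iff_disjoint_right.1 hTS
      exact ⟨by omega, A, hA, disjoint_union_right.1 h2⟩
    have hxT : ∀ T ∈ W, x j ∉ T := fun T hT h => by
      obtain ⟨A, -, -, hTR⟩ := (hWmem T hT).2
      exact disjoint_left.1 hTR h (hxR j)
    set D := W.image (insert (x j)) with hD
    have hDW : #D = #W := by
      refine card_image_of_injOn fun S hS T hT hST => ?_
      rw [← erase_insert (hxT S hS), ← erase_insert (hxT T hT)]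
      exact congrArg (fun X => X.erase (x j)) hST
    have hDmeet : D ⊆ meetLayer R k := by
      intro S hS
      obtain ⟨T, hT, rfl⟩ := mem_image.1 hS
      refine mem_meetLayer.2 ⟨?_, x j, mem_inter.2 ⟨mem_insert_self _ _, hxR j⟩⟩
      rw [card_insert_of_notMem (hxT T hT), (hWmem T hT).1]
      omega
    have hFsub : F ⊆ (meetLayer R k \ D) ∪ univ.biUnion E := by
      intro S hS
      rw [hF] at hS
      obtain ⟨i, -, hi⟩ := mem_biUnion.1 hS
      by_cases hxi : x i ∈ S
      · refine mem_union_left _ (mem_sdiff.2 ⟨?_, fun hSD => ?_⟩)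
        · exact mem_meetLayer.2 ⟨hsz i S hi, x i, mem_inter.2 ⟨hxi, hxR i⟩⟩
        · obtain ⟨T, hT, rfl⟩ := mem_image.1 hSD
          obtain ⟨A, hA, hTA, hTR⟩ := (hWmem T hT).2
          have hij : i = j := by
            rcases mem_insert.1 hxi with h | h
            · exact hx h
            · exact absurd (hxR i) (disjoint_left.1 hTR h)
          subst hij
          exact hpair i _ hi A (hGE A hA).1 (disjoint_insert_left.2 ⟨(hGE A hA).2.1, hTA⟩)
      · exact mem_union_right _ (mem_biUnion.2 ⟨i, mem_univ i, mem_filter.2 ⟨hi, hxi⟩⟩)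
    have h1 : #F ≤ #(meetLayer R k \ D) + #(univ.biUnion E) :=
      (card_le_card hFsub).trans (card_union_le _ _)
    have h2 := card_sdiff_add_card_eq_card hDmeet
    have h3 : #(univ.biUnion E) ≤ r * #(E j) := by
      have := card_biUnion_le_card_mul (univ : Finset (Fin r)) E (#(E j))
        fun i _ => hj i (mem_univ i)
      simpa using this
    have h4 : r * #(E j) ≤ r * 2 ^ r * #H := by
      rw [hHG, mul_assoc]
      exact Nat.mul_le_mul_left _ hQcard
    omega

end Bootstrapping

section Stability

variable {n : ℕ}

lemma one_sub_biasedMeasure_superset_le {p : ℝ} (hp : 0 ≤ p) (hp1 : p ≤ 1) {r k : ℕ} (hr : r ≤ n)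
    (hk : 0 < k) {F : Finset (Finset (Fin n))} (hF : ∀ S ∈ F, #S = k)
    (hcard : n.choose k ≤ #F + (n - r).choose k) :
    1 - biasedMeasure p {S | ∃ A ∈ F, A ⊆ S}
      ≤ biasedMeasure p {S : Finset (Fin n) | #S < k} + (1 - p) ^ r := by
  classical
  obtain ⟨R, -, hR⟩ := exists_subset_card_eq (s := (univ : Finset (Fin n))) (n := r) (by simpa)
  set U : Set (Finset (Fin n)) := {S | ∃ A ∈ F, A ⊆ S}
  have h1 : Uᶜ ⊆ {S | #S < k} ∪ {S | k ≤ #S ∧ S ∉ U} := fun S hS => by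
    by_cases h : #S < k
    · exact Or.inl h
    · exact Or.inr ⟨not_lt.1 h, hS⟩
  have h2 : biasedMeasure p {S : Finset (Fin n) | k ≤ #S ∧ S ∉ U} ≤ (1 - p) ^ r := by
    rw [← hR, ← biasedMeasure_disjoint p R, ← one_mul (biasedMeasure p {S | k ≤ #S ∧ S ∉ U})]
    refine mul_biasedMeasure_le_of_layers hp hp1 _ _ _ fun j _ => ?_
    rw [one_mul, Nat.cast_le]
    by_cases hkj : k ≤ j
    · have h3 := choose_le_card_superLayer_add hr hk hkj hF hcard
      have h4 : (univ.filter fun S : Finset (Fin n) => #S = j ∧ S ∈ {S | k ≤ #S ∧ S ∉ U})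
          = powersetCard j univ \ superLayer F j := by
        ext S
        simp only [Set.mem_ofPred_eq, mem_filter, mem_univ, true_and, mem_sdiff, mem_powersetCard,
          subset_univ, mem_superLayer, U]
        grind
      have h5 : (univ.filter fun S : Finset (Fin n) => #S = j ∧ S ∈ {S | Disjoint S R})
          = powersetCard j Rᶜ := by
        ext S
        simp only [Set.mem_ofPred_eq, mem_filter, mem_univ, true_and, mem_powersetCard,
          subset_compl_iff_disjoint_right]
        tauto
      have h6 : superLayer F j ⊆ powersetCard j univ := fun S hS =>
        mem_powersetCard.2 ⟨subset_univ _, (mem_superLayer.1 hS).1⟩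
      rw [h4, h5, card_sdiff_of_subset h6, card_powersetCard, card_powersetCard, card_compl, hR,
        card_univ, Fintype.card_fin]
      omega
    · rw [filter_false_of_mem]
      · simp
      · rintro S - ⟨rfl, h, -⟩
        exact hkj h
  rw [← biasedMeasure_compl]
  linarith [biasedMeasure_mono hp hp1 h1, biasedMeasure_union_le hp hp1
    {S : Finset (Fin n) | #S < k} {S | k ≤ #S ∧ S ∉ U}]

lemma card_mul_one_sub_le {p : ℝ} (hp : 0 ≤ p) (hp1 : p ≤ 1) {k : ℕ} (hk : k ≤ n)
    {F : Finset (Finset (Fin n))} (hF : ∀ S ∈ F, #S = k) :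
    #F * (1 - biasedMeasure p {S : Finset (Fin n) | #S < k})
      ≤ n.choose k * biasedMeasure p {S | ∃ A ∈ F, A ⊆ S} := by
  classical
  have hpos : (0 : ℝ) < n.choose k := by exact_mod_cast Nat.choose_pos hk
  rw [← biasedMeasure_compl, ← div_le_iff₀' hpos, mul_div_right_comm]
  refine mul_biasedMeasure_le_of_layers hp hp1 _ _ _ fun j _ => ?_
  rw [div_mul_eq_mul_div, div_le_iff₀ hpos]
  norm_cast
  by_cases hkj : k ≤ j
  · have h1 : #(univ.filter fun S : Finset (Fin n) => #S = j ∧ S ∈ {S | #S < k}ᶜ)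
        ≤ n.choose j :=
      (card_le_card (t := powersetCard j univ) fun S hS =>
        mem_powersetCard.2 ⟨subset_univ _, (mem_filter.1 hS).2.1⟩).trans_eq (by simp)
    refine (Nat.mul_le_mul_left _ h1).trans ((card_mul_choose_le_card_superLayer hkj hF).trans ?_)
    exact Nat.mul_le_mul_right _ (card_le_card fun S hS =>
      mem_filter.2 ⟨mem_univ _, mem_superLayer.1 hS⟩)
  · rw [filter_false_of_mem]
    · simp
    · rintro S - ⟨rfl, h⟩
      exact h (not_le.1 hkj)

lemma exists_injective_dictators {r k : ℕ} (hr : 0 < r) (hrn : r ≤ n) (hk : 0 < k) (hkn : k ≤ n)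
    {Fs : Fin r → Finset (Finset (Fin n))} {F : Finset (Finset (Fin n))}
    (hF : F = univ.biUnion Fs) (hsz : ∀ i, ∀ S ∈ Fs i, #S = k)
    (hpair : ∀ i, ∀ A ∈ Fs i, ∀ B ∈ Fs i, ¬ Disjoint A B)
    (hcard : n.choose k ≤ #F + (n - r).choose k) {p ε η : ℝ} (hp : 1 / 4 ≤ p) (hp2 : 2 * p < 1)
    (hε : biasedMeasure p {S : Finset (Fin n) | #S < k} ≤ ε) (hε1 : 2 ^ r * ε ≤ 1 / 8)
    (hη : 2 ^ r * ε ≤ p * (1 - 2 * p) * η) (hη1 : 8 * n * η < 1)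
    (hηr : 2 ^ (r + 1) * (ε + 2 * r * η) < 1) :
    ∃ x : Fin r → Fin n, Function.Injective x ∧
      ∀ i, (#((Fs i).filter (x i ∉ ·)) : ℝ) ≤ 4 * η * n.choose k := by
  have hp0 : 0 ≤ p := by linarith
  have hp1 : p ≤ 1 := by linarith
  have hε0 : 0 ≤ ε := (biasedMeasure_nonneg hp0 hp1 _).trans hε
  have hεhalf : ε ≤ 1 / 2 := by
    have : (1 : ℝ) ≤ 2 ^ r := one_le_pow₀ (by norm_num)
    nlinarith
  obtain ⟨s, rfl⟩ : ∃ s, r = s + 1 := ⟨r - 1, by omega⟩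
  have hq : 1 ≤ 2 ^ s * (1 - p) ^ s := by
    rw [← mul_pow]
    exact one_le_pow₀ (by linarith)
  have hq0 : 0 ≤ (1 - p) ^ s := pow_nonneg (by linarith) _
  have hFsz : ∀ S ∈ F, #S = k := fun S hS => by
    rw [hF] at hS
    obtain ⟨i, -, hi⟩ := mem_biUnion.1 hS
    exact hsz i S hi
  set P : Fin (s + 1) → Set (Finset (Fin n)) := fun i => {S | ∃ A ∈ Fs i, A ⊆ S} with hPdef
  have hup : ∀ i, IsUpperSet (P i) := fun i S T hST ⟨A, hA, hAS⟩ => ⟨A, hA, hAS.trans hST⟩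
  have hPint : ∀ i, ∀ A ∈ P i, ∀ B ∈ P i, ¬ Disjoint A B :=
    fun i A ⟨A₀, hA₀, hA⟩ B ⟨B₀, hB₀, hB⟩ hAB =>
      hpair i A₀ hA₀ B₀ hB₀ (disjoint_of_subset_left hA (disjoint_of_subset_right hB hAB))
  have hPU : ⋃ i, P i = {S | ∃ A ∈ F, A ⊆ S} := by
    ext S
    simp only [hPdef, hF, Set.mem_iUnion, Set.mem_ofPred_eq, mem_biUnion, mem_univ, true_and]
    grind
  have hU : 1 - biasedMeasure p (⋃ i, P i) ≤ ε + (1 - p) ^ (s + 1) := by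
    rw [hPU]
    linarith [one_sub_biasedMeasure_superset_le hp0 hp1 hrn hk hFsz hcard]
  have hdef : ∀ i, p - biasedMeasure p (P i) ≤ 2 ^ (s + 1) * ε := fun i => by
    have hle : ∀ i, biasedMeasure p (P i) ≤ p := fun i =>
      biasedMeasure_le_of_intersecting hp0 hp2.le (hPint i)
    have h1 : (1 - biasedMeasure p (P i)) * (1 - p) ^ s ≤ ∏ i, (1 - biasedMeasure p (P i)) := by
      rw [← mul_prod_erase _ _ (mem_univ i)]
      refine mul_le_mul_of_nonneg_left ?_ (by linarith [hle i])
      have h2 := prod_le_prod (s := (univ : Finset (Fin (s + 1))).erase i)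
        (f := fun _ => 1 - p) (g := fun i => 1 - biasedMeasure p (P i))
        (fun _ _ => by linarith) (fun i _ => by linarith [hle i])
      simpa [card_erase_of_mem] using h2
    have h3 := prod_one_sub_biasedMeasure_le hp0 hp1 hup
    have h4 : (p - biasedMeasure p (P i)) * (1 - p) ^ s ≤ ε := by
      rw [pow_succ] at hU
      nlinarith
    have h5 : 0 ≤ p - biasedMeasure p (P i) := by linarith [hle i]
    have h6 : (0 : ℝ) < 2 ^ s := by positivity
    rw [pow_succ]
    nlinarith
  have hdict : ∀ i, ∃ x, biasedMeasure p {S | S.erase x ∈ P i} ≤ 2 * η := fun i =>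
    exists_dictator_of_intersecting hp hp2 (hup i) (hPint i) (by linarith [hdef i])
      ((hdef i).trans hη) hη1
  choose x hx using hdict
  have hη0 : 0 ≤ 2 * η := (biasedMeasure_nonneg hp0 hp1 _).trans (hx ⟨0, hr⟩)
  refine ⟨x, ?_, fun i => ?_⟩
  · by_contra hinj
    set R := univ.image x with hR
    have hRs : #R ≤ s := by
      have h1 : #R ≤ s + 1 := by simpa using card_image_le (s := univ) (f := x)
      have h2 : #R ≠ s + 1 := fun h => hinj
        (by simpa using (card_image_iff (s := univ) (f := x)).1 (by simpa [hR] using h))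
      omega
    have hsub : ⋃ i, P i ⊆ {S | Disjoint S R}ᶜ ∪ ⋃ i, {S | S.erase (x i) ∈ P i} := by
      intro S hS
      obtain ⟨i, hi⟩ := Set.mem_iUnion.1 hS
      by_cases hxi : x i ∈ S
      · exact Or.inl fun h => disjoint_left.1 h hxi (mem_image_of_mem x (mem_univ i))
      · exact Or.inr (Set.mem_iUnion.2 ⟨i, by simpa [erase_eq_of_notMem hxi] using hi⟩)
    have h1 := (biasedMeasure_mono hp0 hp1 hsub).trans (biasedMeasure_union_le hp0 hp1 _ _)
    rw [biasedMeasure_compl, biasedMeasure_disjoint] at h1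
    have h2 := (biasedMeasure_iUnion_le hp0 hp1 fun i => {S | S.erase (x i) ∈ P i}).trans
      (sum_le_card_nsmul univ _ _ fun i _ => hx i)
    rw [card_univ, Fintype.card_fin, nsmul_eq_mul] at h2
    have h3 : (1 - p) ^ s ≤ (1 - p) ^ #R :=
      pow_le_pow_of_le_one (by linarith) (by linarith) hRs
    have h4 : p * (1 - p) ^ s ≤ ε + 2 * (s + 1 : ℕ) * η := by
      rw [pow_succ] at hU
      linarith
    have h5 : (2 : ℝ) ^ (s + 1 + 1) * (p * (1 - p) ^ s) = 4 * p * (2 ^ s * (1 - p) ^ s) := by ring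
    have h6 := mul_le_mul_of_nonneg_left h4 (show (0 : ℝ) ≤ 2 ^ (s + 1 + 1) by positivity)
    nlinarith
  · have h1 := card_mul_one_sub_le hp0 hp1 hkn (F := (Fs i).filter (x i ∉ ·))
      fun S hS => hsz i S (mem_filter.1 hS).1
    have h2 : {S | ∃ A ∈ (Fs i).filter (x i ∉ ·), A ⊆ S} ⊆ {S | S.erase (x i) ∈ P i} := by
      rintro S ⟨A, hA, hAS⟩
      obtain ⟨hA, hxA⟩ := mem_filter.1 hA
      exact ⟨A, hA, subset_erase.2 ⟨hAS, hxA⟩⟩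
    have h3 := mul_le_mul_of_nonneg_left ((biasedMeasure_mono hp0 hp1 h2).trans (hx i))
      (Nat.cast_nonneg (α := ℝ) (n.choose k))
    have h4 : (0 : ℝ) ≤ #((Fs i).filter (x i ∉ ·)) := Nat.cast_nonneg _
    nlinarith

end Stability

section Main

lemma sq_mul_exp_neg_lt_one {r : ℕ} {n m : ℝ} (hn : 1 ≤ n)
    (h : 2 ^ (2 * r + 20) * n ^ 2 ≤ m ^ 3) :
    2 ^ (5 * r + 8) * n ^ 2 * Real.exp (-(m ^ 2 / n / 128)) < 1 := by
  have hn0 : 0 < n := by linarith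
  have hpow : (1 : ℝ) ≤ 2 ^ r := one_le_pow₀ (by norm_num)
  have h1 : (2 ^ (2 * r + 20)) ^ 4 * n ^ 2 ≤ (m ^ 2 / n) ^ 6 := by
    rw [← pow_mul, div_pow, le_div_iff₀ (by positivity)]
    have := pow_le_pow_left₀ (by positivity) h 4
    ring_nf at this ⊢
    linarith
  have h2 := Real.pow_div_factorial_le_exp (m ^ 2 / n / 128) (by positivity) 6
  have h3 : (2 : ℝ) ^ (5 * r + 8) * n ^ 2 < (m ^ 2 / n / 128) ^ 6 / (Nat.factorial 6 : ℕ) := by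
    have h4 : (2 : ℝ) ^ (5 * r + 8) * (720 * 128 ^ 6) < (2 ^ (2 * r + 20)) ^ 4 := by
      have h5 : (2 : ℝ) ^ (5 * r) ≤ 2 ^ (8 * r) :=
        pow_le_pow_right₀ (by norm_num) (by omega)
      have h6 : (0 : ℝ) < 2 ^ (5 * r) := by positivity
      rw [← pow_mul, show (2 * r + 20) * 4 = 8 * r + 80 by ring, pow_add, pow_add]
      norm_num
      linarith
    rw [show Nat.factorial 6 = 720 from rfl, div_pow, div_div, lt_div_iff₀ (by norm_num)]
    refine lt_of_lt_of_le ?_ h1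
    have := mul_lt_mul_of_pos_right h4 (show 0 < n ^ 2 by positivity)
    push_cast
    linarith
  rw [Real.exp_neg, mul_inv_lt_iff₀ (Real.exp_pos _), one_mul]
  linarith

lemma sixteen_pow_mul_exp_le_one {t : ℕ} {y : ℝ} (h : t ≤ y) :
    16 ^ t * Real.exp (-y) ^ 3 ≤ 1 := by
  have h16 : (16 : ℝ) ≤ Real.exp 1 ^ 3 := by
    refine le_trans ?_ (pow_le_pow_left₀ (by norm_num) Real.exp_one_gt_d9.le 3)
    norm_num
  have h1 : (16 : ℝ) ^ t ≤ Real.exp y ^ 3 := by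
    refine (pow_le_pow_left₀ (by norm_num) h16 t).trans ?_
    rw [← Real.exp_nat_mul, ← Real.exp_nat_mul, ← Real.exp_nat_mul]
    refine Real.exp_le_exp.2 ?_
    push_cast
    linarith
  calc (16 : ℝ) ^ t * Real.exp (-y) ^ 3 ≤ Real.exp y ^ 3 * Real.exp (-y) ^ 3 := by gcongr
    _ = 1 := by rw [← mul_pow, ← Real.exp_add]; simp

variable {n : ℕ}

lemma biasedMeasure_card_lt_le_of_gap {k : ℕ} {m : ℝ} (hn : 0 < n) (hm : 0 ≤ m)
    (hnk : (n : ℝ) = 2 * k + m) :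
    biasedMeasure ((n + 2 * k) / (4 * n)) {S : Finset (Fin n) | #S < k}
      ≤ Real.exp (-(m ^ 2 / n / 32)) := by
  have hn0 : (0 : ℝ) < n := by exact_mod_cast hn
  have hk0 : (0 : ℝ) ≤ k := Nat.cast_nonneg k
  refine (biasedMeasure_card_lt_le (by positivity) ?_ k (θ := m / (4 * n)) (by positivity)
    ?_).trans (Real.exp_le_exp.2 ?_)
  · rw [div_le_one (by positivity)]; linarith
  · rw [div_le_one (by positivity)]; linarith
  · have hk : (k : ℝ) = (n - m) / 2 := by linarith
    rw [← sub_nonneg, hk]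
    have : -(m ^ 2 / n / 32) - (m / (4 * n) * ((n - m) / 2)
        + n * ((n + 2 * ((n - m) / 2)) / (4 * n)) * ((m / (4 * n)) ^ 2 - m / (4 * n)))
        = m ^ 3 / (64 * n ^ 2) := by
      field_simp
      ring
    rw [this]
    positivity

lemma two_pow_le_of_gap {r n m : ℕ} (hn : 0 < n) (hmn : m ≤ n)
    (hgap : 2 ^ (2 * r + 20) * n ^ 2 ≤ m ^ 3) : 2 ^ (2 * r + 20) ≤ m := by
  have h1 : 2 ^ (2 * r + 20) * n ^ 2 ≤ m * n ^ 2 :=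
    hgap.trans (by rw [pow_succ']; gcongr)
  exact Nat.le_of_mul_le_mul_right h1 (by positivity)

lemma two_pow_mul_le_of_gap {r n m : ℕ} (hn : 0 < n) (hmn : m ≤ n)
    (hgap : 2 ^ (2 * r + 20) * n ^ 2 ≤ m ^ 3) : 2 ^ 20 * r ≤ m := by
  refine le_trans ?_ (two_pow_le_of_gap hn hmn hgap)
  rw [pow_add, mul_comm]
  exact Nat.mul_le_mul_right _
    (Nat.lt_two_pow_self.le.trans (Nat.pow_le_pow_right (by norm_num) (by omega)))

lemma exists_scale_of_gap {r n m : ℕ} (hr : 0 < r) (hn : 0 < n) (hmn : m ≤ n)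
    (hgap : 2 ^ (2 * r + 20) * n ^ 2 ≤ m ^ 3) :
    ∃ t : ℕ, (t : ℝ) ≤ (m : ℝ) ^ 2 / n / 128 ∧ 16 * (r + t) ≤ n ∧
      8 * n * (r * 2 ^ r) ≤ n + (t - 1) * (m - r) := by
  have hrm := two_pow_mul_le_of_gap hn hmn hgap
  have hn0R : (0 : ℝ) < n := by exact_mod_cast hn
  have hmnR : (m : ℝ) ≤ n := by exact_mod_cast hmn
  have hm1R : (1 : ℝ) ≤ m := by exact_mod_cast (show 1 ≤ m by omega)
  have hgapR : (2 : ℝ) ^ (2 * r + 20) * (n : ℝ) ^ 2 ≤ (m : ℝ) ^ 3 := by exact_mod_cast hgap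
  obtain ⟨T, hT⟩ : ∃ T : ℝ, T = (m : ℝ) ^ 2 / n := ⟨_, rfl⟩
  rw [← hT]
  have hT0 : 0 ≤ T := hT ▸ by positivity
  have hTm : 2 ^ (2 * r + 20) * (n : ℝ) ≤ m * T := by
    rw [hT, ← mul_div_assoc, le_div_iff₀ hn0R]
    linarith
  have hTn : T ≤ n := by
    rw [hT, div_le_iff₀ hn0R]
    nlinarith
  have hT512 : 512 ≤ T := by
    have h1 : (2 : ℝ) ^ 20 ≤ 2 ^ (2 * r + 20) := pow_le_pow_right₀ (by norm_num) (by omega)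
    have h2 : 2 ^ 20 * (n : ℝ) ≤ n * T :=
      (mul_le_mul_of_nonneg_right h1 hn0R.le).trans
        (hTm.trans (mul_le_mul_of_nonneg_right hmnR hT0))
    rw [mul_comm] at h2
    linarith [le_of_mul_le_mul_left h2 hn0R]
  have htT : (⌊T / 128⌋₊ : ℝ) ≤ T / 128 := Nat.floor_le (by positivity)
  have hTt : T / 128 < ⌊T / 128⌋₊ + 1 := Nat.lt_floor_add_one _
  generalize ⌊T / 128⌋₊ = t at htT hTt
  have ht1 : 1 ≤ t := by
    have : (1 : ℝ) ≤ t := by linarith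
    exact_mod_cast this
  refine ⟨t, htT, ?_, ?_⟩
  · have h1 : (128 * t : ℕ) ≤ n := by
      have : (128 * t : ℝ) ≤ n := by linarith
      exact_mod_cast this
    omega
  · have h1 : (n : ℝ) * (2 ^ (2 * r + 11)) ≤ ((t - 1 : ℕ) : ℝ) * ((m - r : ℕ) : ℝ) := by
      have h2 : (m : ℝ) / 2 ≤ ((m - r : ℕ) : ℝ) := by
        have : (2 * r : ℝ) ≤ m := by exact_mod_cast (show 2 * r ≤ m by omega)
        rw [Nat.cast_sub (by omega)]
        linarith
      have h3 : T / 256 ≤ ((t - 1 : ℕ) : ℝ) := by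
        rw [Nat.cast_sub ht1]
        push_cast
        linarith
      have h4 := mul_le_mul h3 h2 (by positivity) (by positivity)
      have h5 : (2 : ℝ) ^ (2 * r + 20) = 2 ^ (2 * r + 11) * 512 := by
        rw [pow_add, pow_add]
        norm_num
        ring
      rw [h5] at hTm
      linarith
    have h2 : n * 2 ^ (2 * r + 11) ≤ (t - 1) * (m - r) := by exact_mod_cast h1
    refine le_trans ?_ (h2.trans (Nat.le_add_left _ _))
    calc 8 * n * (r * 2 ^ r) ≤ 8 * n * (2 ^ r * 2 ^ r) := by
          gcongr
          exact Nat.lt_two_pow_self.le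
      _ = n * 2 ^ (2 * r + 3) := by ring
      _ ≤ n * 2 ^ (2 * r + 11) := by gcongr <;> omega

/-- The numerical conditions under which the union of `r` intersecting families is close to a union
of dictatorships, in terms of a bound `Y ^ 4` for the lower tail. -/
lemma error_bounds_of_small {r n t : ℕ} {Y : ℝ} (hn : 0 < n) (hY0 : 0 < Y) (hY1 : Y ≤ 1)
    (hYn : 2 ^ (5 * r + 8) * (n : ℝ) ^ 2 * Y < 1) (ht : 16 ^ t * Y ^ 3 ≤ 1) :
    2 ^ r * Y ^ 4 ≤ 1 / 8 ∧ 8 * n * (8 * n * 2 ^ r * Y ^ 4) < 1 ∧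
      2 ^ (r + 1) * (Y ^ 4 + 2 * r * (8 * n * 2 ^ r * Y ^ 4)) < 1 ∧
      4 * (8 * n * 2 ^ r * Y ^ 4) * 16 ^ (r + t) < 1 := by
  have hn1R : (1 : ℝ) ≤ n := by exact_mod_cast hn
  have hY4Y : Y ^ 4 ≤ Y := pow_le_of_le_one hY0.le hY1 (by norm_num)
  have hpow : (1 : ℝ) ≤ 2 ^ r := one_le_pow₀ (by norm_num)
  have hrpow : (r : ℝ) ≤ 2 ^ r := by exact_mod_cast Nat.lt_two_pow_self.le
  have hnn : (n : ℝ) ≤ (n : ℝ) ^ 2 := by nlinarith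
  have h5 : (2 : ℝ) ^ (5 * r + 8) = 256 * (2 ^ r) ^ 5 := by
    rw [pow_add, mul_comm 5 r, pow_mul]
    norm_num
    ring
  have h16 : (16 : ℝ) ^ r = (2 ^ r) ^ 4 := by
    rw [← pow_mul, mul_comm, pow_mul]
    norm_num
  rw [h5] at hYn
  rw [pow_add, pow_add, h16, pow_one]
  generalize (2 : ℝ) ^ r = a at *
  have hsmall : ∀ c : ℝ, c ≤ 256 * a ^ 5 * (n : ℝ) ^ 2 → c * Y ^ 4 < 1 := fun c hc =>
    (mul_le_mul hc hY4Y (by positivity) (by positivity)).trans_lt hYn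
  have ha : a ≤ a ^ 5 := le_self_pow₀ hpow (by norm_num)
  have ha3 : a ^ 3 ≤ a ^ 5 := pow_le_pow_right₀ hpow (by norm_num)
  have hn2 : (1 : ℝ) ≤ (n : ℝ) ^ 2 := by linarith
  refine ⟨?_, ?_, ?_, ?_⟩
  · have := hsmall (8 * a) (by
      calc 8 * a ≤ 256 * a ^ 5 * 1 := by linarith
        _ ≤ 256 * a ^ 5 * (n : ℝ) ^ 2 := by gcongr)
    linarith
  · have := hsmall (64 * a * (n : ℝ) ^ 2) (by gcongr; norm_num)
    linarith
  · have := hsmall (a * 2 * (1 + 16 * r * n * a)) (by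
      calc a * 2 * (1 + 16 * r * n * a) ≤ a * 2 * (a * n * a + 16 * a * n * a) := by
            gcongr
            exact one_le_mul_of_one_le_of_one_le (one_le_mul_of_one_le_of_one_le hpow hn1R) hpow
        _ = 34 * a ^ 3 * n := by ring
        _ ≤ 256 * a ^ 5 * (n : ℝ) ^ 2 := by gcongr; norm_num)
    linarith
  · calc 4 * (8 * n * a * Y ^ 4) * (a ^ 4 * 16 ^ t)
        = 32 * a ^ 5 * n * Y * (16 ^ t * Y ^ 3) := by ring
      _ ≤ 32 * a ^ 5 * n * Y * 1 := by gcongr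
      _ = 32 * a ^ 5 * n * Y := mul_one _
      _ ≤ 256 * a ^ 5 * (n : ℝ) ^ 2 * Y := by gcongr; norm_num
      _ < 1 := hYn

/-- The main result when `n` and `k` are comparable, for families at least as large as the extremal
one. -/
theorem eq_meetLayer_of_union_of_intersecting_of_le {r k : ℕ} (hr : 0 < r) (hk : 0 < k)
    (hn : n ≤ 8 * k) (hkn : 2 * k ≤ n) (hgap : 2 ^ (2 * r + 20) * n ^ 2 ≤ (n - 2 * k) ^ 3)
    {Fs : Fin r → Finset (Finset (Fin n))} {F : Finset (Finset (Fin n))}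
    (hF : F = univ.biUnion Fs) (hsz : ∀ i, ∀ S ∈ Fs i, #S = k)
    (hpair : ∀ i, ∀ A ∈ Fs i, ∀ B ∈ Fs i, ¬ Disjoint A B)
    (hcard : n.choose k ≤ #F + (n - r).choose k) :
    ∃ R : Finset (Fin n), #R = r ∧ F = meetLayer R k := by
  obtain ⟨m, hm⟩ : ∃ m, n = 2 * k + m := ⟨n - 2 * k, by omega⟩
  have hmn : n - 2 * k = m := by omega
  rw [hmn] at hgap
  have hn1 : 0 < n := by omega
  have hrm := two_pow_mul_le_of_gap hn1 (by omega) hgap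
  obtain ⟨t, htT, hrt, hL⟩ := exists_scale_of_gap hr hn1 (by omega) hgap
  have hnR : (n : ℝ) = 2 * k + m := by exact_mod_cast hm
  have hn1R : (1 : ℝ) ≤ n := by exact_mod_cast hn1
  have hn0R : (0 : ℝ) < n := by linarith
  have hm1R : (1 : ℝ) ≤ m := by exact_mod_cast (show 1 ≤ m by omega)
  have hk0R : (0 : ℝ) < k := by exact_mod_cast hk
  have hYn := sq_mul_exp_neg_lt_one (r := r) (m := m) hn1R (by exact_mod_cast hgap)
  have hY3 := sixteen_pow_mul_exp_le_one htT
  have htail := biasedMeasure_card_lt_le_of_gap hn1 (Nat.cast_nonneg m) hnR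
  have hY4 : Real.exp (-((m : ℝ) ^ 2 / n / 32)) = Real.exp (-((m : ℝ) ^ 2 / n / 128)) ^ 4 := by
    rw [← Real.exp_nat_mul]
    congr 1
    push_cast
    ring
  have hY1 : Real.exp (-((m : ℝ) ^ 2 / n / 128)) ≤ 1 :=
    Real.exp_le_one_iff.2 (neg_nonpos.2 (by positivity))
  have hY0 := Real.exp_pos (-((m : ℝ) ^ 2 / n / 128))
  rw [hY4] at htail
  generalize Real.exp (-((m : ℝ) ^ 2 / n / 128)) = Y at *
  obtain ⟨hb1, hb2, hb3, hb4⟩ := error_bounds_of_small hn1 hY0 hY1 hYn hY3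
  have hdefect : 2 ^ r * Y ^ 4 ≤ (n + 2 * k : ℝ) / (4 * n) * (1 - 2 * ((n + 2 * k) / (4 * n)))
      * (8 * n * 2 ^ r * Y ^ 4) := by
    have h1 : (n + 2 * k : ℝ) / (4 * n) * (1 - 2 * ((n + 2 * k) / (4 * n))) * (8 * n)
        = (n + 2 * k) * m / n := by
      rw [show (m : ℝ) = n - 2 * k by linarith]
      field_simp
      ring
    have h2 : 1 ≤ (n + 2 * k) * (m : ℝ) / n := by
      rw [le_div_iff₀ hn0R]
      nlinarith
    have h3 : 0 ≤ (2 : ℝ) ^ r * Y ^ 4 := by positivity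
    calc (2 : ℝ) ^ r * Y ^ 4 ≤ (n + 2 * k) * (m : ℝ) / n * (2 ^ r * Y ^ 4) :=
          le_mul_of_one_le_left h3 h2
      _ = _ := by rw [← h1]; ring
  have hp : 1 / 4 ≤ (n + 2 * k : ℝ) / (4 * n) := by
    rw [div_le_div_iff₀ (by norm_num) (by positivity)]
    linarith
  have hp2 : 2 * ((n + 2 * k : ℝ) / (4 * n)) < 1 := by
    rw [← mul_div_assoc, div_lt_one (by positivity)]
    linarith
  obtain ⟨x, hx, hxs⟩ := exists_injective_dictators hr (by omega) hk (by omega) hF hsz hpair hcard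
    hp hp2 htail hb1 hdefect hb2 hb3
  refine ⟨univ.image x, by rw [card_image_of_injective _ hx, card_univ, Fintype.card_fin],
    eq_meetLayer_of_close_to_dictators hr hk hrt hn (by omega) (by rwa [hmn]) hF hsz hpair hcard hx
      fun i => ?_⟩
  have hpos : (0 : ℝ) < n.choose k := by exact_mod_cast Nat.choose_pos (by omega)
  have h : (#((Fs i).filter (x i ∉ ·)) : ℝ) * 16 ^ (r + t) < n.choose k := by
    calc (#((Fs i).filter (x i ∉ ·)) : ℝ) * 16 ^ (r + t)
        ≤ 4 * (8 * n * 2 ^ r * Y ^ 4) * n.choose k * 16 ^ (r + t) := by gcongr; exact hxs i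
      _ = 4 * (8 * n * 2 ^ r * Y ^ 4) * 16 ^ (r + t) * n.choose k := by ring
      _ < 1 * n.choose k := by gcongr
      _ = n.choose k := one_mul _
  exact_mod_cast h

/-- The main result when `k` is small, by passing to the layer of size `n / 4`. -/
theorem eq_meetLayer_of_union_of_intersecting_of_lt {r k : ℕ} (hr : 0 < r) (hk : 0 < k)
    (hn : 2 ^ (2 * r + 23) ≤ n) (hn8 : 8 * k < n)
    {Fs : Fin r → Finset (Finset (Fin n))} {F : Finset (Finset (Fin n))}
    (hF : F = univ.biUnion Fs) (hsz : ∀ i, ∀ S ∈ Fs i, #S = k)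
    (hpair : ∀ i, ∀ A ∈ Fs i, ∀ B ∈ Fs i, ¬ Disjoint A B)
    (hcard : n.choose k ≤ #F + (n - r).choose k) :
    ∃ R : Finset (Fin n), #R = r ∧ F = meetLayer R k := by
  have hrn : 8 * r ≤ n := by
    refine le_trans ?_ hn
    calc 8 * r ≤ 8 * 2 ^ r := Nat.mul_le_mul_left _ Nat.lt_two_pow_self.le
      _ = 2 ^ (r + 3) := by ring
      _ ≤ 2 ^ (2 * r + 23) := Nat.pow_le_pow_right (by norm_num) (by omega)
  have hn23 : 8 ≤ n := le_trans (by omega) hrn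
  have hFsz : ∀ S ∈ F, #S = k := fun S hS => by
    rw [hF] at hS
    obtain ⟨i, -, hi⟩ := mem_biUnion.1 hS
    exact hsz i S hi
  set j := n / 4 with hj
  have hgap : 2 ^ (2 * r + 20) * n ^ 2 ≤ (n - 2 * j) ^ 3 := by
    have h1 : n ≤ 2 * (n - 2 * j) := by omega
    have h2 := Nat.pow_le_pow_left h1 3
    have h3 : 2 ^ (2 * r + 20) * 8 ≤ n := by
      rw [show 2 ^ (2 * r + 23) = 2 ^ (2 * r + 20) * 8 by ring] at hn
      exact hn
    have h4 := Nat.mul_le_mul_right (n ^ 2) h3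
    rw [mul_pow, pow_succ' n] at h2
    linarith
  have hunion : superLayer F j = univ.biUnion fun i => superLayer (Fs i) j := by
    ext S
    simp only [mem_superLayer, hF, mem_biUnion, mem_univ, true_and]
    grind
  have hpair' : ∀ i, ∀ A ∈ superLayer (Fs i) j, ∀ B ∈ superLayer (Fs i) j, ¬ Disjoint A B := by
    intro i A hA B hB hAB
    obtain ⟨-, A₀, hA₀, hAA⟩ := mem_superLayer.1 hA
    obtain ⟨-, B₀, hB₀, hBB⟩ := mem_superLayer.1 hB
    exact hpair i A₀ hA₀ B₀ hB₀ (disjoint_of_subset_left hAA (disjoint_of_subset_right hBB hAB))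
  obtain ⟨R, hR, hRF⟩ := eq_meetLayer_of_union_of_intersecting_of_le hr (by omega) (by omega)
    (by omega) hgap hunion (fun i S hS => (mem_superLayer.1 hS).1) hpair'
    (choose_le_card_superLayer_add (by omega) hk (by omega) hFsz hcard)
  refine ⟨R, hR, eq_of_subset_of_card_le (fun S hS => ?_) ?_⟩
  · refine mem_meetLayer.2 ⟨hFsz S hS, ?_⟩
    rw [← not_disjoint_iff_nonempty_inter]
    intro hSR
    obtain ⟨T, hST, hTR, hT⟩ := exists_subsuperset_card_eq (n := j)
      (subset_compl_iff_disjoint_right.2 hSR) (by rw [hFsz S hS]; omega)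
      (by rw [card_compl, Fintype.card_fin, hR]; omega)
    have h1 : T ∈ meetLayer R j := hRF ▸ mem_superLayer.2 ⟨hT, S, hS, hST⟩
    exact not_disjoint_iff_nonempty_inter.2 (mem_meetLayer.1 h1).2
      (subset_compl_iff_disjoint_right.1 hTR)
  · have h1 := card_meetLayer_add R k
    rw [hR] at h1
    omega

end Main

theorem union_of_intersecting_families_equality_case :
    ∀ r : ℕ, 2 ≤ r → ∃ C : ℝ, 0 < C ∧
      ∀ n k : ℕ, 0 < n → 0 < k →
      (n : ℝ) ≥ 2 * k + C * (k : ℝ) ^ ((2 : ℝ) / 3) →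
      ∀ F : Finset (Finset (Fin n)), (∀ S ∈ F, S.card = k) →
      (∃ Fs : Fin r → Finset (Finset (Fin n)),
        (∀ i, Intersecting' (Fs i)) ∧ F = Finset.univ.biUnion Fs) →
      F.card = Nat.choose n k - Nat.choose (n - r) k →
      ∃ R : Finset (Fin n), R.card = r ∧
        F = Finset.univ.filter (fun S : Finset (Fin n) =>
          S.card = k ∧ (S ∩ R).Nonempty) := by
  intro r hr
  refine ⟨2 ^ (2 * r + 23), by positivity, fun n k hn hk hnk F hFk ⟨Fs, hFs, hF⟩ hcard => ?_⟩
  have hsz : ∀ i, ∀ S ∈ Fs i, #S = k := fun i S hS =>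
    hFk S (hF ▸ mem_biUnion.2 ⟨i, mem_univ i, hS⟩)
  have hpair : ∀ i, ∀ A ∈ Fs i, ∀ B ∈ Fs i, ¬ Disjoint A B := fun i A hA B hB =>
    not_disjoint_iff_nonempty_inter.2 (hFs i A hA B hB)
  have hcard' : n.choose k ≤ #F + (n - r).choose k := by omega
  have hk1 : (1 : ℝ) ≤ k := by exact_mod_cast hk
  set q : ℝ := (k : ℝ) ^ ((2 : ℝ) / 3) with hq
  have hq1 : 1 ≤ q := Real.one_le_rpow hk1 (by norm_num)
  have hq3 : q ^ 3 = (k : ℝ) ^ 2 := by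
    rw [hq, ← Real.rpow_natCast, ← Real.rpow_mul (by linarith), ← Real.rpow_natCast]
    norm_num
  have hC0 : (0 : ℝ) < 2 ^ (2 * r + 23) := by positivity
  have hkn : 2 * k ≤ n := by
    have : (2 * k : ℝ) ≤ n := by nlinarith
    exact_mod_cast this
  by_cases h8 : n ≤ 8 * k
  · refine eq_meetLayer_of_union_of_intersecting_of_le (by omega) hk h8 hkn ?_ hF hsz hpair hcard'
    have h8R : (n : ℝ) ≤ 8 * k := by exact_mod_cast h8
    have h1 : (2 : ℝ) ^ (2 * r + 20) * (n : ℝ) ^ 2 ≤ ((n - 2 * k : ℕ) : ℝ) ^ 3 := by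
      have hK : (1 : ℝ) ≤ 2 ^ (2 * r + 20) := one_le_pow₀ (by norm_num)
      calc (2 : ℝ) ^ (2 * r + 20) * (n : ℝ) ^ 2 ≤ 2 ^ (2 * r + 20) * (8 * (k : ℝ)) ^ 2 := by gcongr
        _ ≤ (2 ^ (2 * r + 20)) ^ 3 * (8 * (8 * (k : ℝ)) ^ 2) :=
            mul_le_mul (le_self_pow₀ hK (by norm_num))
              (le_mul_of_one_le_left (by positivity) (by norm_num)) (by positivity) (by positivity)
        _ = (2 ^ (2 * r + 23) * q) ^ 3 := by rw [mul_pow _ q, hq3]; ring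
        _ ≤ ((n - 2 * k : ℕ) : ℝ) ^ 3 := by
            gcongr
            rw [Nat.cast_sub hkn]
            push_cast
            linarith
    exact_mod_cast h1
  · refine eq_meetLayer_of_union_of_intersecting_of_lt (by omega) hk ?_ (by omega) hF hsz hpair hcard'
    have : (2 : ℝ) ^ (2 * r + 23) ≤ n := by nlinarith
    exact_mod_cast this
end

section
/- Let k, n be positive integers with k ≤ n, let 0 < p < 1, let 0 ≤ α ≤ 1, and let G ⊆ {S ⊆ {1,...,n} : |S| = k} be a family with |G| = α·C(n,k). Then μ_p(G↑) ≥ α · Pr[Bin(n,p) ≥ k], where Bin(n,p) denotes a binomial random variable with parameters n and p. -/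
open Finset

/-- The `p`-biased measure of a family of subsets of `{1,…,n}`:
`μ_p(F) = ∑_{S ∈ F} p^{|S|} (1-p)^{n-|S|}`. -/
noncomputable def mu {n : ℕ} (p : ℝ) (F : Finset (Finset (Fin n))) : ℝ :=
  ∑ S ∈ F, p ^ S.card * (1 - p) ^ (n - S.card)

/-- The up-closure of a family: all sets containing some member of the family. -/
def upClosure {n : ℕ} (F : Finset (Finset (Fin n))) : Finset (Finset (Fin n)) :=
  Finset.univ.filter (fun T => ∃ S ∈ F, S ⊆ T)

/-- A `k`-set in `Fin n` has at least `(n - k).choose (l - k)` supersets of size `l` within a family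
that contains all of its supersets of size `l`. -/
theorem choose_le_card_supersets {n l : ℕ} (S : Finset (Fin n)) (hl : S.card ≤ l)
    (U : Finset (Finset (Fin n))) (hU : ∀ T, S ⊆ T → T.card = l → T ∈ U) :
    (n - S.card).choose (l - S.card) ≤ (U.filter (S ⊆ ·)).card := by
  have hcard : (powersetCard (l - S.card) Sᶜ).card = (n - S.card).choose (l - S.card) := by
    rw [card_powersetCard, card_compl, Fintype.card_fin]
  rw [← hcard]
  refine card_le_card_of_injOn (S ∪ ·) ?_ ?_
  · intro R hR
    obtain ⟨hRS, hRc⟩ := mem_powersetCard.1 hR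
    have hdisj : Disjoint S R := disjoint_left.2 fun _ ha hb => mem_compl.1 (hRS hb) ha
    refine mem_filter.2 ⟨hU _ subset_union_left ?_, subset_union_left⟩
    rw [card_union_of_disjoint hdisj]
    omega
  · intro R hR R' hR' h
    have hR := (mem_powersetCard.1 hR).1
    have hR' := (mem_powersetCard.1 hR').1
    ext a
    have h := Finset.ext_iff.1 h a
    have h₁ := @hR a
    have h₂ := @hR' a
    simp only [mem_union, mem_compl] at h h₁ h₂
    tauto

/-- Normalized matching between level `k` and level `l` of the cube, multiplicative form. -/
theorem card_mul_choose_le_card_upClosure_slice {n k l : ℕ} (hkl : k ≤ l)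
    (G : Finset (Finset (Fin n))) (hG : ∀ S ∈ G, S.card = k) :
    G.card * (n - k).choose (l - k) ≤
      ((upClosure G).filter (·.card = l)).card * l.choose k := by
  refine Finset.card_mul_le_card_mul (· ⊆ ·) (fun S hS => ?_) (fun T hT => ?_)
  · rw [← hG S hS]
    refine choose_le_card_supersets S (by rw [hG S hS]; exact hkl) _ fun T hST hT => ?_
    simp only [upClosure, Finset.mem_filter, Finset.mem_univ, true_and]
    exact ⟨⟨S, hS, hST⟩, hT⟩
  · rw [← (Finset.mem_filter.1 hT).2, ← Finset.card_powersetCard]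
    refine Finset.card_le_card fun S hS => ?_
    obtain ⟨hSG, hST⟩ := Finset.mem_filter.1 hS
    exact Finset.mem_powersetCard.2 ⟨hST, hG S hSG⟩

/-- The density of a `k`-uniform family does not decrease when passing to level `l ≥ k` of its
up-closure. -/
theorem density_mul_choose_le_card_upClosure_slice {n k l : ℕ} (hkl : k ≤ l)
    {α : ℝ} (G : Finset (Finset (Fin n))) (hG : ∀ S ∈ G, S.card = k)
    (hGcard : (G.card : ℝ) = α * (n.choose k : ℝ)) :
    α * (n.choose l : ℝ) ≤ (((upClosure G).filter (·.card = l)).card : ℝ) := by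
  have hcount : (G.card : ℝ) * ((n - k).choose (l - k) : ℝ) ≤
      (((upClosure G).filter (·.card = l)).card : ℝ) * (l.choose k : ℝ) :=
    mod_cast card_mul_choose_le_card_upClosure_slice hkl G hG
  have hchoose : (n.choose l : ℝ) * (l.choose k : ℝ) =
      (n.choose k : ℝ) * ((n - k).choose (l - k) : ℝ) := mod_cast Nat.choose_mul hkl
  have hpos : (0 : ℝ) < (l.choose k : ℝ) := mod_cast Nat.choose_pos hkl
  refine le_of_mul_le_mul_right ?_ hpos
  rwa [mul_assoc, hchoose, ← mul_assoc, ← hGcard]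

theorem biased_measure_of_upClosure (n k : ℕ) (hk : 0 < k) (hn : 0 < n) (hkn : k ≤ n)
    (p α : ℝ) (hp0 : 0 < p) (hp1 : p < 1) (hα0 : 0 ≤ α) (hα1 : α ≤ 1)
    (G : Finset (Finset (Fin n))) (hG : ∀ S ∈ G, S.card = k)
    (hGcard : (G.card : ℝ) = α * (Nat.choose n k : ℝ)) :
    mu p (upClosure G) ≥
      α * ∑ l ∈ Finset.Icc k n, (Nat.choose n l : ℝ) * p ^ l * (1 - p) ^ (n - l) := by
  have hmaps : ∀ T ∈ upClosure G, T.card ∈ Finset.Icc k n := by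
    intro T hT
    obtain ⟨S, hS, hST⟩ := (Finset.mem_filter.1 hT).2
    rw [Finset.mem_Icc, ← hG S hS]
    exact ⟨Finset.card_le_card hST, by simpa using Finset.card_le_univ T⟩
  rw [ge_iff_le, mu, ← Finset.sum_fiberwise_of_maps_to hmaps, Finset.mul_sum]
  refine Finset.sum_le_sum fun l hl => ?_
  have hkl := (Finset.mem_Icc.1 hl).1
  have hslice : ∑ T ∈ upClosure G with T.card = l, p ^ T.card * (1 - p) ^ (n - T.card) =
      (((upClosure G).filter (·.card = l)).card : ℝ) * (p ^ l * (1 - p) ^ (n - l)) := by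
    rw [← nsmul_eq_mul]
    refine Finset.sum_eq_card_nsmul fun T hT => ?_
    rw [(Finset.mem_filter.1 hT).2]
  have hweight : 0 ≤ p ^ l * (1 - p) ^ (n - l) :=
    mul_nonneg (pow_nonneg hp0.le _) (pow_nonneg (sub_nonneg.2 hp1.le) _)
  rw [hslice, mul_assoc (n.choose l : ℝ), ← mul_assoc α]
  exact mul_le_mul_of_nonneg_right
    (density_mul_choose_le_card_upClosure_slice hkl G hG hGcard) hweight
end

section
/- Let r, n be positive integers, let 0 < p ≤ 1/2, and let F₁, ..., F_r be intersecting families of subsets of {1,...,n}. Then μ_p(F₁ ∪ ... ∪ F_r) ≤ 1 − (1−p)^r. -/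
open Finset

section BiasedForms

variable {α : Type*} [DecidableEq α]

/-- The expectation of `f` over a random subset of `l` which contains each entry of `l`
independently with probability `p`. -/
def biasedMean (p : ℝ) : List α → (Finset α → ℝ) → ℝ
  | [], f => f ∅
  | a :: l, f => (1 - p) * biasedMean p l f + p * biasedMean p l (fun S => f (insert a S))

/-- The expectation of `f S * g T` over a random pair of disjoint subsets `S`, `T` of `l`, where
each entry of `l` independently lies in `S` with probability `p`, in `T` with probability `p`, and
in neither with probability `1 - 2 * p`. -/
def disjointForm (p : ℝ) : List α → (Finset α → ℝ) → (Finset α → ℝ) → ℝ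
  | [], f, g => f ∅ * g ∅
  | a :: l, f, g => (1 - 2 * p) * disjointForm p l f g
      + p * disjointForm p l (fun S => f (insert a S)) g
      + p * disjointForm p l f (fun S => g (insert a S))

lemma biasedMean_linear (p : ℝ) (l : List α) (c d : ℝ) (f g : Finset α → ℝ) :
    biasedMean p l (fun S => c * f S + d * g S)
      = c * biasedMean p l f + d * biasedMean p l g := by
  induction l generalizing f g with
  | nil => rfl
  | cons a l ih =>
    simp only [biasedMean]
    rw [ih f g, ih (fun S => f (insert a S)) (fun S => g (insert a S))]
    ring

lemma disjointForm_comm (p : ℝ) (l : List α) (f g : Finset α → ℝ) :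
    disjointForm p l f g = disjointForm p l g f := by
  induction l generalizing f g with
  | nil => exact mul_comm _ _
  | cons a l ih =>
    simp only [disjointForm]
    rw [ih f g, ih (fun S => f (insert a S)) g, ih f (fun S => g (insert a S))]
    ring

lemma disjointForm_linear_left (p : ℝ) (l : List α) (c d : ℝ) (f g h : Finset α → ℝ) :
    disjointForm p l (fun S => c * f S + d * g S) h
      = c * disjointForm p l f h + d * disjointForm p l g h := by
  induction l generalizing f g h with
  | nil => simp only [disjointForm]; ring
  | cons a l ih =>
    simp only [disjointForm]
    rw [ih f g h, ih f g (fun S => h (insert a S)),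
      ih (fun S => f (insert a S)) (fun S => g (insert a S)) h]
    ring

lemma disjointForm_linear_self (p : ℝ) (l : List α) (c d : ℝ) (f g : Finset α → ℝ) :
    disjointForm p l (fun S => c * f S + d * g S) (fun S => c * f S + d * g S)
      = c ^ 2 * disjointForm p l f f + 2 * c * d * disjointForm p l f g
        + d ^ 2 * disjointForm p l g g := by
  rw [disjointForm_linear_left, disjointForm_comm p l f (fun S => c * f S + d * g S),
    disjointForm_comm p l g (fun S => c * f S + d * g S),
    disjointForm_linear_left, disjointForm_linear_left, disjointForm_comm p l g f]
  ring

/-- Averaging over the first entry and differencing along it diagonalises `disjointForm`. -/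
lemma disjointForm_cons_self (p : ℝ) (a : α) (l : List α) (f : Finset α → ℝ) :
    disjointForm p (a :: l) f f
      = disjointForm p l (fun S => (1 - p) * f S + p * f (insert a S))
          (fun S => (1 - p) * f S + p * f (insert a S))
        - p ^ 2 * disjointForm p l (fun S => 1 * f S + (-1) * f (insert a S))
          (fun S => 1 * f S + (-1) * f (insert a S)) := by
  rw [disjointForm_linear_self p l (1 - p) p f (fun S => f (insert a S)),
    disjointForm_linear_self p l 1 (-1) f (fun S => f (insert a S))]
  simp only [disjointForm]
  rw [disjointForm_comm p l (fun S => f (insert a S)) f]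
  ring

lemma biasedMean_cons_sq (p : ℝ) (a : α) (l : List α) (f : Finset α → ℝ) :
    biasedMean p (a :: l) (fun S => f S ^ 2)
      = biasedMean p l (fun S => ((1 - p) * f S + p * f (insert a S)) ^ 2)
        + p * (1 - p) * biasedMean p l (fun S => (1 * f S + (-1) * f (insert a S)) ^ 2) := by
  simp only [biasedMean]
  rw [← biasedMean_linear]
  conv_rhs => rw [← one_mul (biasedMean p l _), ← biasedMean_linear]
  congr 1
  funext S
  ring

lemma abs_disjointForm_self_le {p : ℝ} (hp0 : 0 ≤ p) (hp : p ≤ 1 / 2) (l : List α)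
    (f : Finset α → ℝ) :
    |disjointForm p l f f| ≤ biasedMean p l (fun S => f S ^ 2) := by
  induction l generalizing f with
  | nil => simp [disjointForm, biasedMean, sq]
  | cons a l ih =>
    rw [disjointForm_cons_self, biasedMean_cons_sq]
    refine (abs_sub _ _).trans (add_le_add (ih _) ?_)
    rw [abs_mul, abs_of_nonneg (sq_nonneg p)]
    exact mul_le_mul (by nlinarith) (ih _) (abs_nonneg _)
      (mul_nonneg hp0 (by linarith))

/-- The ratio bound for `disjointForm`: its least normalised eigenvalue is `-p / (1 - p)`. -/
lemma biasedMean_sq_le {p : ℝ} (hp0 : 0 ≤ p) (hp : p ≤ 1 / 2) (l : List α)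
    (f : Finset α → ℝ) :
    biasedMean p l f ^ 2
      ≤ (1 - p) * disjointForm p l f f + p * biasedMean p l (fun S => f S ^ 2) := by
  induction l generalizing f with
  | nil => simp only [disjointForm, biasedMean]; apply le_of_eq; ring
  | cons a l ih =>
    rw [disjointForm_cons_self, biasedMean_cons_sq]
    have hmean := ih (fun S => (1 - p) * f S + p * f (insert a S))
    rw [biasedMean_linear p l (1 - p) p f (fun S => f (insert a S))] at hmean
    have hdiff := (le_abs_self _).trans
      (abs_disjointForm_self_le hp0 hp l (fun S => 1 * f S + (-1) * f (insert a S)))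
    have hscaled := mul_le_mul_of_nonneg_left hdiff
      (mul_nonneg (sq_nonneg p) (by linarith : (0 : ℝ) ≤ 1 - p))
    simp only [biasedMean]
    linarith

lemma disjointForm_eq_zero (p : ℝ) {l : List α} (hl : l.Nodup) {f g : Finset α → ℝ}
    (hfg : ∀ S ⊆ l.toFinset, ∀ T ⊆ l.toFinset, Disjoint S T → f S * g T = 0) :
    disjointForm p l f g = 0 := by
  induction l generalizing f g with
  | nil => exact hfg ∅ (by simp) ∅ (by simp) (by simp)
  | cons a l ih =>
    obtain ⟨ha, hl⟩ := List.nodup_cons.1 hl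
    have hsub : ∀ S ⊆ l.toFinset, S ⊆ (a :: l).toFinset := fun S hS => by
      rw [List.toFinset_cons]; exact hS.trans (subset_insert _ _)
    have hins : ∀ S ⊆ l.toFinset, insert a S ⊆ (a :: l).toFinset := fun S hS => by
      rw [List.toFinset_cons]; exact insert_subset_insert _ hS
    have hnot : ∀ S ⊆ l.toFinset, a ∉ S := fun S hS h => ha (List.mem_toFinset.1 (hS h))
    simp only [disjointForm]
    rw [ih hl fun S hS T hT h => hfg S (hsub S hS) T (hsub T hT) h,
      ih hl fun S hS T hT h => hfg _ (hins S hS) T (hsub T hT)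
        (disjoint_insert_left.2 ⟨hnot T hT, h⟩),
      ih hl fun S hS T hT h => hfg S (hsub S hS) _ (hins T hT)
        (disjoint_insert_right.2 ⟨hnot S hS, h⟩)]
    ring

lemma biasedMean_eq_sum (p : ℝ) {l : List α} (hl : l.Nodup) (f : Finset α → ℝ) :
    biasedMean p l f
      = ∑ S ∈ l.toFinset.powerset, p ^ S.card * (1 - p) ^ (l.length - S.card) * f S := by
  induction l generalizing f with
  | nil => simp [biasedMean]
  | cons a l ih =>
    obtain ⟨ha, hl⟩ := List.nodup_cons.1 hl
    have ha' : a ∉ l.toFinset := by simpa using ha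
    simp only [biasedMean]
    rw [ih hl, ih hl, List.toFinset_cons, sum_powerset_insert ha', mul_sum, mul_sum]
    refine congrArg₂ _ (sum_congr rfl fun S hS => ?_) (sum_congr rfl fun S hS => ?_)
    · have hcard : S.card ≤ l.length :=
        (card_le_card (mem_powerset.1 hS)).trans (List.toFinset_card_le l)
      rw [List.length_cons, Nat.succ_sub hcard, pow_succ]
      ring
    · rw [card_insert_of_notMem fun h => ha' (mem_powerset.1 hS h), List.length_cons,
        Nat.add_sub_add_right, pow_succ]
      ring

end BiasedForms

section BiasedMeasure

variable {n : ℕ} {p : ℝ}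

lemma mu_eq_sum_indicator (p : ℝ) (F : Finset (Finset (Fin n))) :
    mu p F = ∑ S, p ^ S.card * (1 - p) ^ (n - S.card) * (if S ∈ F then 1 else 0) := by
  simp [mu]

lemma mu_univ (p : ℝ) : mu p (univ : Finset (Finset (Fin n))) = 1 := by
  simpa [mu] using Fintype.sum_pow_mul_eq_add_pow (Fin n) p (1 - p)

lemma biasedWeight_nonneg (hp0 : 0 ≤ p) (hp1 : p ≤ 1) (S : Finset (Fin n)) :
    0 ≤ p ^ S.card * (1 - p) ^ (n - S.card) :=
  mul_nonneg (pow_nonneg hp0 _) (pow_nonneg (sub_nonneg.2 hp1) _)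

lemma mu_mono (hp0 : 0 ≤ p) (hp1 : p ≤ 1) {F G : Finset (Finset (Fin n))} (h : F ⊆ G) :
    mu p F ≤ mu p G :=
  sum_le_sum_of_subset_of_nonneg h fun S _ _ => biasedWeight_nonneg hp0 hp1 S

/-- An intersecting family has `p`-biased measure at most `p`. -/
lemma mu_le_of_intersecting (hp0 : 0 < p) (hp : p ≤ 1 / 2) {F : Finset (Finset (Fin n))}
    (hF : Intersecting' F) : mu p F ≤ p := by
  have hmean : biasedMean p (List.finRange n) (fun S => if S ∈ F then 1 else 0) = mu p F := by
    rw [biasedMean_eq_sum p (List.nodup_finRange n), mu_eq_sum_indicator]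
    simp
  have hzero : disjointForm p (List.finRange n) (fun S => if S ∈ F then 1 else 0)
      (fun S => if S ∈ F then 1 else 0) = 0 := by
    refine disjointForm_eq_zero p (List.nodup_finRange n) fun S _ T _ hST => ?_
    by_cases hS : S ∈ F
    · have hT : T ∉ F := fun hT =>
        not_disjoint_iff_nonempty_inter.2 (hF S hS T hT) hST
      simp [hT]
    · simp [hS]
  have hbound := biasedMean_sq_le hp0.le hp (List.finRange n) (fun S => if S ∈ F then 1 else 0)
  have hsq : (fun S => (if S ∈ F then (1 : ℝ) else 0) ^ 2) = fun S => if S ∈ F then 1 else 0 := by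
    funext S
    split_ifs <;> simp
  rw [hzero, hsq, hmean] at hbound
  by_contra! hlt
  nlinarith

/-- Upper sets are positively correlated under the `p`-biased measure. -/
lemma mu_mul_le_mu_inter (hp0 : 0 ≤ p) (hp1 : p ≤ 1) {F G : Finset (Finset (Fin n))}
    (hF : IsUpperSet (F : Set (Finset (Fin n)))) (hG : IsUpperSet (G : Set (Finset (Fin n)))) :
    mu p F * mu p G ≤ mu p (F ∩ G) := by
  have hmono : ∀ {H : Finset (Finset (Fin n))}, IsUpperSet (H : Set (Finset (Fin n))) →
      Monotone fun S => if S ∈ H then (1 : ℝ) else 0 := by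
    intro H hH S T hST
    by_cases hS : S ∈ H
    · have hT : T ∈ H := hH hST hS
      simp [hS, hT]
    · by_cases hT : T ∈ H <;> simp [hS, hT]
  have hind : ∀ H : Finset (Finset (Fin n)), (0 : Finset (Fin n) → ℝ) ≤
      fun S => if S ∈ H then (1 : ℝ) else 0 := by
    intro H S
    by_cases hS : S ∈ H <;> simp [hS]
  have hfkg := fkg _ _ (fun S : Finset (Fin n) => p ^ S.card * (1 - p) ^ (n - S.card))
    (fun S => biasedWeight_nonneg hp0 hp1 S) (hind F) (hind G) (hmono hF) (hmono hG)
    (fun S T => by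
      have hcard := card_union_add_card_inter S T
      have hS := card_finset_fin_le S
      have hT := card_finset_fin_le T
      have hU := card_finset_fin_le (S ∪ T)
      have hI := card_finset_fin_le (S ∩ T)
      apply le_of_eq
      simp only [inf_eq_inter, sup_eq_union]
      rw [mul_mul_mul_comm, mul_mul_mul_comm (p ^ (S ∩ T).card), ← pow_add, ← pow_add,
        ← pow_add, ← pow_add]
      congr 2 <;> omega)
  have hone : ∑ S : Finset (Fin n), p ^ S.card * (1 - p) ^ (n - S.card) = 1 := mu_univ p
  rw [hone, one_mul, ← mu_eq_sum_indicator, ← mu_eq_sum_indicator] at hfkg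
  refine hfkg.trans_eq ?_
  rw [mu_eq_sum_indicator]
  refine sum_congr rfl fun S _ => ?_
  by_cases hSF : S ∈ F <;> by_cases hSG : S ∈ G <;> simp [hSF, hSG]

/-- Every intersecting family is contained in an intersecting upper set. -/
lemma exists_isUpperSet_intersecting {F : Finset (Finset (Fin n))} (hF : Intersecting' F) :
    ∃ G : Finset (Finset (Fin n)),
      F ⊆ G ∧ Intersecting' G ∧ IsUpperSet (G : Set (Finset (Fin n))) := by
  refine ⟨univ.filter fun T => ∃ S ∈ F, S ⊆ T, fun S hS => ?_, ?_, ?_⟩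
  · simpa using ⟨S, hS, Subset.rfl⟩
  · intro A hA B hB
    obtain ⟨S, hS, hSA⟩ := (mem_filter.1 hA).2
    obtain ⟨T, hT, hTB⟩ := (mem_filter.1 hB).2
    exact (hF S hS T hT).mono (inter_subset_inter hSA hTB)
  · intro A B hAB hA
    obtain ⟨S, hS, hSA⟩ := (mem_filter.1 (mem_coe.1 hA)).2
    exact mem_coe.2 (mem_filter.2 ⟨mem_univ _, S, hS, hSA.trans hAB⟩)

lemma mu_biUnion_le_of_isUpperSet {ι : Type*} (hp0 : 0 < p) (hp : p ≤ 1 / 2)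
    (s : Finset ι) {G : ι → Finset (Finset (Fin n))} (hG : ∀ i, Intersecting' (G i))
    (hup : ∀ i, IsUpperSet (G i : Set (Finset (Fin n)))) :
    mu p (s.biUnion G) ≤ 1 - (1 - p) ^ s.card := by
  classical
  induction s using Finset.induction_on with
  | empty => simp [mu]
  | insert i s hi ih =>
    have hupper : IsUpperSet (s.biUnion G : Set (Finset (Fin n))) := by
      rw [coe_biUnion]
      exact isUpperSet_iUnion₂ fun j _ => hup j
    have hcorr := mu_mul_le_mu_inter hp0.le (by linarith) (hup i) hupper
    have hunion : mu p (G i ∪ s.biUnion G) + mu p (G i ∩ s.biUnion G)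
        = mu p (G i) + mu p (s.biUnion G) := sum_union_inter
    have hprod := mul_le_mul (sub_le_sub_left (mu_le_of_intersecting hp0 hp (hG i)) 1)
      (le_sub_comm.1 ih) (pow_nonneg (by linarith) _)
      (by linarith [mu_le_of_intersecting hp0 hp (hG i)])
    rw [biUnion_insert, card_insert_of_notMem hi, pow_succ']
    linarith

end BiasedMeasure

theorem fkg_bound (r n : ℕ) (hr : 0 < r) (hn : 0 < n)
    (p : ℝ) (hp0 : 0 < p) (hp : p ≤ 1/2)
    (Fs : Fin r → Finset (Finset (Fin n)))
    (hFs : ∀ i, Intersecting' (Fs i)) :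
    mu p (Finset.univ.biUnion Fs) ≤ 1 - (1 - p) ^ r := by
  choose G hsub hint hup using fun i => exists_isUpperSet_intersecting (hFs i)
  refine (mu_mono hp0.le (by linarith) (biUnion_mono fun i _ => hsub i)).trans ?_
  simpa using mu_biUnion_le_of_isUpperSet hp0 hp univ hint hup
end
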